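/- There exists a compact set B ⊆ ℝ³ homeomorphic to the closed unit ball of ℝ³ which is not an attractor for any discrete dynamical system: for every open set U ⊆ ℝ³ containing B and every injective continuous map f : U → U, B is not an attractor for f. (Such a set is the Alexander ball, the closure of the simply connected complementary domain of the Alexander horned sphere.) -/

import Mathlib

open Set

noncomputable section

/-- Euclidean 3-space. -/
abbrev R3 := EuclideanSpace ℝ (Fin 3)

/-- The image in `ℝ³` of a set `P ⊆ ℝ³` under the `n`-th iterate of a map `f : U → U`
defined on (the subtype of) an open set `U ⊆ ℝ³`. -/
def imgIter {U : Set R3} (f : U → U) (n : ℕ) (P : Set R3) : Set R3 :=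
  Subtype.val '' (f^[n] '' (Subtype.val ⁻¹' P))

/-- A compact set `P` is attracted by `K` under `f : U → U` if for every neighbourhood `V`
of `K` there is `n₀` such that `fⁿ(P) ⊆ V` for all `n ≥ n₀`. -/
def IsAttracted {U : Set R3} (f : U → U) (K P : Set R3) : Prop :=
  ∀ V : Set R3, K ⊆ interior V → ∃ n₀ : ℕ, ∀ n ≥ n₀, imgIter f n P ⊆ V

/-- `K` is an attractor for the discrete dynamical system `f : U → U`: it is compact,
invariant (`f(K) = K`), and has a neighbourhood `A ⊆ U` all of whose compact subsets
are attracted by `K`. -/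
def IsAttractor {U : Set R3} (f : U → U) (K : Set R3) : Prop :=
  IsCompact K ∧ K ⊆ U ∧ imgIter f 1 K = K ∧
    ∃ A : Set R3, A ⊆ U ∧ K ⊆ interior A ∧
      ∀ P : Set R3, IsCompact P → P ⊆ A → IsAttracted f K P

section InvarianceOfDomain

open MeasureTheory

variable {E : Type*} [NormedAddCommGroup E] [InnerProductSpace ℝ E] [FiniteDimensional ℝ E]

theorem det_one_add_eq_sum_interpolation (v : ℕ → ℝ) (hv : Function.Injective v) :
    ∃ w : ℕ → ℝ, ∀ A : E →L[ℝ] E, (1 + A).det =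
      ∑ j ∈ Finset.range (Module.finrank ℝ E + 1), w j * (1 + v j • A).det := by
  let s := Finset.range (Module.finrank ℝ E + 1)
  refine ⟨fun j => (Lagrange.basis s v j).eval 1, fun A => ?_⟩
  let b := Module.finBasis ℝ E
  let M := LinearMap.toMatrix b b (A : E →ₗ[ℝ] E)
  let p : Polynomial ℝ := ((Polynomial.X : Polynomial ℝ) • M.map Polynomial.C +
    (1 : Matrix _ _ ℝ).map Polynomial.C).det
  have hp : ∀ t : ℝ, p.eval t = (1 + t • A).det := by
    intro t
    have h1 : p.eval t = (t • M + 1).det := by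
      simp only [p]
      rw [← Polynomial.coe_evalRingHom, RingHom.map_det]
      congr 1
      ext i j
      by_cases hij : i = j <;> simp [hij] <;> ring
    rw [h1, ContinuousLinearMap.det, ← LinearMap.det_toMatrix b]
    congr 1
    have : ((1 + t • A : E →L[ℝ] E) : E →ₗ[ℝ] E) = LinearMap.id + t • (A : E →ₗ[ℝ] E) := rfl
    rw [this, map_add, map_smul, LinearMap.toMatrix_id, add_comm]
  have hdeg : p.degree < s.card := by
    have := Polynomial.natDegree_det_X_add_C_le M 1
    rw [Fintype.card_fin] at this
    refine lt_of_le_of_lt Polynomial.degree_le_natDegree ?_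
    rw [Finset.card_range]
    exact_mod_cast Nat.lt_succ_of_le this
  have h := Lagrange.eq_interpolate hv.injOn hdeg
  have h2 := congrArg (Polynomial.eval 1) h
  rw [hp, one_smul, Lagrange.interpolate_apply, Polynomial.eval_finsetSum] at h2
  rw [h2]
  refine Finset.sum_congr rfl fun j _ => ?_
  rw [Polynomial.eval_mul, Polynomial.eval_C, hp, mul_comm]

theorem exists_lipschitz_extend_zero {ρ : ℝ} {g : E → E}
    (hg : ContDiff ℝ 1 g) (h0 : ∀ x, ‖x‖ = ρ → g x = 0) :
    ∃ L : NNReal, LipschitzWith L (fun x => if ‖x‖ ≤ ρ then g x else 0) := by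
  obtain ⟨L, hL⟩ := hg.contDiffOn.exists_lipschitzOnWith one_ne_zero
    (convex_closedBall (0 : E) ρ) (isCompact_closedBall _ _)
  refine ⟨L, LipschitzWith.of_dist_le_mul ?_⟩
  have key : ∀ x y : E, ‖x‖ ≤ ρ → ¬ ‖y‖ ≤ ρ → dist (g x) 0 ≤ L * dist x y := by
    intro x y hx hy
    obtain ⟨z, hz, hzρ⟩ : ∃ z ∈ segment ℝ x y, ‖z‖ = ρ := by
      have := (convex_segment (𝕜 := ℝ) x y).isPreconnected.intermediate_value
        (left_mem_segment ℝ x y) (right_mem_segment ℝ x y) continuous_norm.continuousOn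
      exact this ⟨hx, (not_le.1 hy).le⟩
    have h1 := hL.dist_le_mul x (by simpa using hx) z (by simp [hzρ])
    rw [h0 z hzρ] at h1
    refine h1.trans (mul_le_mul_of_nonneg_left ?_ L.2)
    have := dist_add_dist_of_mem_segment hz
    linarith [dist_nonneg (x := z) (y := y)]
  intro x y
  by_cases hx : ‖x‖ ≤ ρ <;> by_cases hy : ‖y‖ ≤ ρ <;> simp only [hx, hy, if_true, if_false]
  · exact hL.dist_le_mul x (by simpa using hx) y (by simpa using hy)
  · exact key x y hx hy
  · rw [dist_comm, dist_comm x]; exact key y x hy hx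
  · simp; positivity

theorem exists_contDiff_approx {t : E → Set E} (ht : ∀ x, Convex ℝ (t x))
    (hloc : ∀ x, ∃ c : E, ∀ᶠ y in nhds x, c ∈ t y) : ∃ g : E → E, ContDiff ℝ 1 g ∧ ∀ x, g x ∈ t x := by
  obtain ⟨g, hg⟩ := exists_contMDiffMap_forall_mem_convex_of_local_const (n := 1)
    (modelWithCornersSelf ℝ E) ht hloc
  exact ⟨g, contMDiff_iff_contDiff.1 g.contMDiff, hg⟩

variable [MeasurableSpace E] [BorelSpace E]

theorem exists_zero_of_contDiff_of_eq_id {h : E → E} (hC : ContDiff ℝ 1 h) {ρ : ℝ} (hρ : 0 < ρ)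
    (hout : ∀ x, ρ ≤ ‖x‖ → h x = x) : ∃ x, h x = 0 := by
  by_contra! hne
  let r : E → E := fun x => (ρ / ‖h x‖) • h x
  have hr : ContDiff ℝ 1 r :=
    (contDiff_const.div (hC.norm ℝ hne) fun x => norm_ne_zero_iff.2 (hne x)).smul hC
  have hrn : ∀ x, ‖r x‖ = ρ := by
    intro x
    have := norm_ne_zero_iff.2 (hne x)
    simp only [r, norm_smul, norm_div, abs_norm, Real.norm_eq_abs, abs_of_pos hρ]
    field_simp
  have hrs : ∀ x, ‖x‖ = ρ → r x = x := by
    intro x hx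
    simp only [r]
    rw [hout x hx.ge, hx, div_self hρ.ne', one_smul]
  obtain ⟨L, hL⟩ := exists_lipschitz_extend_zero (ρ := ρ) (g := fun x => r x - x)
    (hr.sub contDiff_id) (fun x hx => by simp [hrs x hx])
  set g : E → E := fun x => if ‖x‖ ≤ ρ then r x - x else 0 with hg
  let A : E → E →L[ℝ] E := fun x => fderiv ℝ r x - 1
  have hAc : Continuous A := (hr.continuous_fderiv one_ne_zero).sub continuous_const
  let s := Metric.closedBall (0 : E) ρ
  have hs : IsCompact s := isCompact_closedBall _ _
  have hsm : MeasurableSet s := Metric.isClosed_closedBall.measurableSet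
  have hdetc : Continuous fun p : ℝ × E => (1 + p.1 • A p.2).det := by
    have : Continuous fun p : ℝ × E => 1 + p.1 • A p.2 := by fun_prop
    exact ContinuousLinearMap.continuous_det.comp this
  have hpos : ∀ᶠ t in nhds (0 : ℝ), ∀ x ∈ s, 0 < (1 + t • A x).det := by
    apply hs.eventually_forall_of_forall_eventually
    intro x hx
    apply hdetc.continuousAt.eventually (lt_mem_nhds _)
    simp [ContinuousLinearMap.det]
  have hvol : ∀ᶠ t in nhds (0 : ℝ), ∫ x in s, (1 + t • A x).det = volume.real s := by
    have h1 : ∀ᶠ t in nhds (0 : ℝ), ‖t‖₊ * L < 1 := by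
      have : Continuous fun t : ℝ => ‖t‖₊ * L := by fun_prop
      exact this.continuousAt.eventually (gt_mem_nhds (by simp))
    filter_upwards [h1, hpos] with t ht htp
    let φ : E → E := fun x => x + t • g x
    have happ : ApproximatesLinearOn φ ((ContinuousLinearEquiv.refl ℝ E : E ≃L[ℝ] E) : E →L[ℝ] E)
        univ (‖t‖₊ * L) := by
      intro x _ y _
      have : φ x - φ y - ((ContinuousLinearEquiv.refl ℝ E : E ≃L[ℝ] E) : E →L[ℝ] E) (x - y) =
          t • (g x - g y) := by
        simp [φ, smul_sub]; abel
      rw [this, norm_smul]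
      have := hL.dist_le_mul x y
      rw [dist_eq_norm, dist_eq_norm] at this
      calc ‖t‖ * ‖g x - g y‖ ≤ ‖t‖ * (L * ‖x - y‖) := by gcongr
        _ = _ := by push_cast; ring
    have hlt : Subsingleton E ∨ ‖t‖₊ * L <
        ‖((ContinuousLinearEquiv.refl ℝ E).symm : E →L[ℝ] E)‖₊⁻¹ := by
      rcases subsingleton_or_nontrivial E with hE | hE
      · exact Or.inl hE
      · right
        have : ‖((ContinuousLinearEquiv.refl ℝ E).symm : E →L[ℝ] E)‖₊ = 1 :=
          ContinuousLinearMap.nnnorm_id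
        rwa [this, inv_one]
    let Φ := happ.toHomeomorph φ hlt
    have hΦ : ∀ x, Φ x = φ x := fun x => rfl
    have hφo : ∀ x, x ∉ s → φ x = x := by
      intro x hx
      have : ¬ ‖x‖ ≤ ρ := by simpa [s] using hx
      simp [φ, hg, this]
    have himg : φ '' s = s := by
      have h1 : φ '' sᶜ = sᶜ := by
        have : EqOn φ id sᶜ := fun x hx => hφo x hx
        rw [this.image_eq, image_id]
      have h2 : (φ '' s)ᶜ = φ '' sᶜ := (image_compl_eq Φ.bijective).symm
      rw [h1, compl_inj_iff] at h2
      exact h2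
    have hder : ∀ x ∈ s, HasFDerivWithinAt φ (1 + t • A x) s x := by
      intro x hx
      have h1 : HasFDerivAt (fun x => x + t • (r x - x)) (1 + t • A x) x := by
        have := (hr.differentiable one_ne_zero x).hasFDerivAt
        exact (hasFDerivAt_id x).add ((this.sub (hasFDerivAt_id x)).const_smul t)
      have hin : ∀ y ∈ s, φ y = y + t • (r y - y) := by
        intro y hy
        have : ‖y‖ ≤ ρ := by simpa [s] using hy
        simp [φ, hg, this]
      exact h1.hasFDerivWithinAt.congr hin (hin x hx)
    have hvol := lintegral_abs_det_fderiv_eq_addHaar_image volume hsm hder Φ.injective.injOn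
    rw [himg] at hvol
    rw [integral_eq_lintegral_of_nonneg_ae, Measure.real, ← hvol]
    · congr 1
      exact setLIntegral_congr_fun hsm fun x hx => by simp only [abs_of_pos (htp x hx)]
    · exact (ae_restrict_iff' hsm).2 (Filter.Eventually.of_forall fun x hx => (htp x hx).le)
    · exact (hdetc.comp (Continuous.prodMk_right t)).aestronglyMeasurable
  obtain ⟨ε, hε, hεv⟩ := Metric.eventually_nhds_iff.1 hvol
  let v : ℕ → ℝ := fun j => ε / (j + 2)
  have hv : Function.Injective v := by
    intro i j hij
    simp only [v] at hij
    field_simp at hij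
    have : (i : ℝ) = j := by linarith
    exact_mod_cast this
  have hvε : ∀ j, dist (v j) 0 < ε := by
    intro j
    have : (0 : ℝ) ≤ j := j.cast_nonneg
    rw [Real.dist_eq, sub_zero, abs_of_pos (by positivity), div_lt_iff₀ (by positivity)]
    nlinarith
  obtain ⟨w, hw⟩ := det_one_add_eq_sum_interpolation (E := E) v hv
  have hw1 : ∑ j ∈ Finset.range (Module.finrank ℝ E + 1), w j = 1 := by
    have := hw 0
    simpa [ContinuousLinearMap.det] using this.symm
  have hdet0 : ∀ x, (1 + A x).det = 0 := by
    intro x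
    by_contra hd
    have e : 1 + A x = fderiv ℝ r x := by simp [A]
    rw [e] at hd
    have hsurj : Function.Surjective (fderiv ℝ r x) := by
      have : IsUnit ((fderiv ℝ r x : E →ₗ[ℝ] E)) := by
        rw [LinearMap.isUnit_iff_isUnit_det]
        exact (Ne.isUnit hd)
      exact ((Module.End.isUnit_iff _).1 this).2
    obtain ⟨u, hu⟩ := hsurj (r x)
    have hd := (hr.differentiable one_ne_zero x).hasFDerivAt.norm_sq
    have hc : (fun y => ‖r y‖ ^ 2) = fun _ => ρ ^ 2 := by ext y; rw [hrn]
    rw [hc] at hd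
    have := congrArg (fun T : E →L[ℝ] ℝ => T u) (hd.unique (hasFDerivAt_const _ _))
    simp [hu, hrn] at this
    exact hρ.ne' this
  have hInt : ∀ j, IntegrableOn (fun x => w j * (1 + v j • A x).det) s := by
    intro j
    exact (continuous_const.mul (hdetc.comp (Continuous.prodMk_right (v j)))).continuousOn.integrableOn_compact
      hs
  have hfin : volume.real s = 0 := by
    calc volume.real s = ∑ j ∈ Finset.range (Module.finrank ℝ E + 1), w j * volume.real s := by
          rw [← Finset.sum_mul, hw1, one_mul]
      _ = ∑ j ∈ Finset.range (Module.finrank ℝ E + 1), ∫ x in s, w j * (1 + v j • A x).det := by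
          refine Finset.sum_congr rfl fun j _ => ?_
          rw [integral_const_mul, hεv (hvε j)]
      _ = ∫ x in s, ∑ j ∈ Finset.range (Module.finrank ℝ E + 1), w j * (1 + v j • A x).det :=
          (integral_finsetSum _ fun j _ => hInt j).symm
      _ = 0 := by simp [← hw, hdet0]
  have : 0 < volume.real s := by
    rw [Measure.real, ENNReal.toReal_pos_iff]
    exact ⟨Metric.measure_closedBall_pos _ _ hρ, measure_closedBall_lt_top⟩
  exact this.ne' hfin

/-- Brouwer's fixed point theorem, in the form of stability of the zero of the identity. -/
theorem exists_zero_of_norm_sub_le {H : E → E} (hH : ContinuousOn H (Metric.closedBall 0 1))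
    (hle : ∀ x ∈ Metric.closedBall (0 : E) 1, ‖x - H x‖ ≤ 1) :
    ∃ x ∈ Metric.closedBall (0 : E) 1, H x = 0 := by
  by_contra! hne
  let π : E → E := fun x => (max 1 ‖x‖)⁻¹ • x
  have hm : ∀ x : E, 0 < max 1 ‖x‖ := fun x => lt_max_of_lt_left one_pos
  have hπ : Continuous π := by
    refine Continuous.smul (Continuous.inv₀ (by fun_prop) fun x => (hm x).ne') continuous_id
  have hπb : ∀ x, π x ∈ Metric.closedBall (0 : E) 1 := by
    intro x
    simp only [π, mem_closedBall_zero_iff, norm_smul, norm_inv, Real.norm_eq_abs,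
      abs_of_pos (hm x)]
    rw [inv_mul_le_iff₀ (hm x), mul_one]
    exact le_max_right _ _
  have hπ1 : ∀ x : E, ‖x‖ ≤ 1 → π x = x := by
    intro x hx
    simp [π, max_eq_left hx]
  let K : E → E := fun x => (max 0 (min 1 (2 - ‖x‖))) • (π x - H (π x))
  have hKc : Continuous K := by
    have : Continuous fun x => H (π x) := hH.comp_continuous hπ hπb
    exact Continuous.smul (by fun_prop) (hπ.sub this)
  have hK1 : ∀ x, ‖K x‖ ≤ 1 := by
    intro x
    simp only [K, norm_smul, Real.norm_eq_abs]
    have h1 : |max 0 (min 1 (2 - ‖x‖))| ≤ 1 := by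
      rw [abs_of_nonneg (le_max_left _ _)]
      exact max_le zero_le_one (min_le_left _ _)
    exact mul_le_one₀ h1 (norm_nonneg _) (hle _ (hπb x))
  have hK2 : ∀ x, 2 ≤ ‖x‖ → K x = 0 := by
    intro x hx
    have : max 0 (min 1 (2 - ‖x‖)) = 0 := max_eq_left ((min_le_right _ _).trans (by linarith))
    simp [K, this]
  have hnz : ∀ x, x - K x ≠ 0 := by
    intro x hx
    rcases le_or_gt ‖x‖ 1 with h | h
    · have : max 0 (min 1 (2 - ‖x‖)) = 1 := by
        rw [min_eq_left (by linarith), max_eq_right zero_le_one]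
      simp only [K, this, one_smul, hπ1 x h] at hx
      rw [sub_sub_cancel] at hx
      exact hne x (by simpa using h) hx
    · have := hK1 x
      rw [sub_eq_zero] at hx
      rw [← hx] at this
      linarith
  obtain ⟨μ, hμ, hμx⟩ : ∃ μ > 0, ∀ x, μ ≤ ‖x - K x‖ := by
    obtain ⟨z, -, hz⟩ := (isCompact_closedBall (0 : E) 2).exists_isMinOn ⟨0, by simp⟩
      (f := fun x => ‖x - K x‖) (by fun_prop)
    refine ⟨min ‖z - K z‖ 1, lt_min (norm_pos_iff.2 (hnz z)) one_pos, fun x => ?_⟩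
    rcases le_or_gt ‖x‖ 2 with h | h
    · exact (min_le_left _ _).trans (hz (by simpa using h))
    · rw [hK2 x h.le, sub_zero]
      exact (min_le_right _ _).trans (by linarith)
  obtain ⟨k, hk, hkt⟩ := exists_contDiff_approx
    (t := fun x => {y : E | y ∈ Metric.ball (K x) μ ∧ (3 ≤ ‖x‖ → y ∈ ({0} : Set E))})
    (fun x => by
      by_cases h : 3 ≤ ‖x‖
      · simp only [h, true_imp_iff]
        exact (convex_ball _ _).inter (convex_singleton _)
      · simp only [h, false_imp_iff, and_true]
        exact convex_ball _ _)
    (fun x => by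
      rcases lt_or_ge ‖x‖ 3 with h | h
      · refine ⟨K x, ?_⟩
        filter_upwards [continuous_norm.continuousAt.eventually (gt_mem_nhds h),
          hKc.continuousAt.eventually (Metric.ball_mem_nhds (K x) hμ)] with y h1 h2
        exact ⟨by rw [Metric.mem_ball, dist_comm]; exact h2, fun h => absurd h (not_le.2 h1)⟩
      · refine ⟨0, ?_⟩
        have h2 : 2 < ‖x‖ := by linarith
        filter_upwards [continuous_norm.continuousAt.eventually (lt_mem_nhds h2)] with y h1
        exact ⟨by simp [hK2 y h1.le, hμ], fun _ => rfl⟩)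
  obtain ⟨x, hx⟩ := exists_zero_of_contDiff_of_eq_id (h := fun x => x - k x) (contDiff_id.sub hk)
    (ρ := 3) (by norm_num) (fun x hx => by
      have : k x = 0 := (hkt x).2 hx
      rw [this, sub_zero])
  have h1 := (hkt x).1
  rw [Metric.mem_ball, dist_eq_norm, ← sub_eq_zero.1 hx] at h1
  exact absurd (hμx x) (not_le.2 h1)

theorem mem_interior_image_closedBall [Nontrivial E] {f : E → E}
    (hf : ContinuousOn f (Metric.closedBall 0 1)) (hi : InjOn f (Metric.closedBall 0 1)) :
    f 0 ∈ interior (f '' Metric.closedBall 0 1) := by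
  set b := Metric.closedBall (0 : E) 1
  have hb : IsCompact b := isCompact_closedBall _ _
  have hfb : IsCompact (f '' b) := hb.image_of_continuousOn hf
  have h0b : (0 : E) ∈ b := by simp [b]
  -- a continuous extension of the inverse
  obtain ⟨G, hGc, hG⟩ : ∃ G : E → E, Continuous G ∧ ∀ x ∈ b, G (f x) = x := by
    have : CompactSpace b := isCompact_iff_compactSpace.1 hb
    have he : Topology.IsClosedEmbedding (b.domRestrict f) :=
      (continuousOn_iff_continuous_domRestrict.1 hf).isClosedEmbedding (injOn_iff_injective.1 hi)
    obtain ⟨G, hG⟩ := ContinuousMap.exists_extension he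
      (⟨Subtype.val, continuous_subtype_val⟩ : C(b, E))
    exact ⟨G, G.continuous, fun x hx => congrArg (fun F : C(b, E) => F ⟨x, hx⟩) hG⟩
  have stab : ∀ F : E → E, ContinuousOn F (f '' b) → (∀ y ∈ f '' b, ‖G y - F y‖ ≤ 1) →
      ∃ y ∈ f '' b, F y = 0 := by
    intro F hF hle
    obtain ⟨x, hx, h⟩ := exists_zero_of_norm_sub_le (H := F ∘ f)
      (hF.comp hf (mapsTo_image _ _)) (fun x hx => by
        have := hle _ (mem_image_of_mem f hx)
        rwa [hG x hx] at this)
    exact ⟨f x, mem_image_of_mem f hx, h⟩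
  by_contra hInt
  obtain ⟨ε, hε, hεG⟩ := Metric.continuousAt_iff.1 (hGc.continuousAt (x := f 0)) (1 / 10)
    (by norm_num)
  obtain ⟨c, hcε, hc⟩ : ∃ c, dist c (f 0) < ε / 2 ∧ c ∉ f '' b := by
    by_contra! h
    exact hInt (mem_interior_iff_mem_nhds.2 (Metric.mem_nhds_iff.2 ⟨ε / 2, by positivity, h⟩))
  set η := ε / 2 with hη
  have hηpos : 0 < η := by positivity
  have hsmall : ∀ y, dist y c ≤ η → ‖G y‖ ≤ 1 / 10 := by
    intro y hy
    have h1 : dist y (f 0) < ε := (dist_triangle y c _).trans_lt (by linarith)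
    have := (hεG h1).le
    rwa [hG 0 h0b, dist_zero_right] at this
  let S₁ := f '' b ∩ {y | η ≤ dist y c}
  have hS₁ : IsCompact S₁ := hfb.inter_right (isClosed_le continuous_const (by fun_prop))
  obtain ⟨δ, hδ, hδ1, hδS⟩ : ∃ δ > 0, δ ≤ 1 / 10 ∧ ∀ y ∈ S₁, δ ≤ ‖G y‖ := by
    rcases S₁.eq_empty_or_nonempty with h | h
    · exact ⟨1 / 10, by norm_num, le_rfl, by simp [h]⟩
    obtain ⟨z, hz, hzm⟩ := hS₁.exists_isMinOn h (f := fun y => ‖G y‖) (by fun_prop)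
    refine ⟨min ‖G z‖ (1 / 10), lt_min (norm_pos_iff.2 ?_) (by norm_num), min_le_right _ _,
      fun y hy => (min_le_left _ _).trans (hzm hy)⟩
    obtain ⟨⟨x, hx, rfl⟩, hxη⟩ := hz
    rw [hG x hx]
    rintro rfl
    rw [mem_ofPred_eq, dist_comm] at hxη
    linarith
  obtain ⟨P, hP, hPG⟩ := exists_contDiff_approx (t := fun y => Metric.ball (G y) (δ / 2))
    (fun _ => convex_ball _ _) (fun y => ⟨G y, by
      filter_upwards [hGc.continuousAt.eventually (Metric.ball_mem_nhds (G y) (half_pos hδ))]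
        with z hz
      rw [Metric.mem_ball, dist_comm]; exact hz⟩)
  have hnull : volume (P '' Metric.sphere c η) = 0 :=
    addHaar_image_eq_zero_of_differentiableOn_of_addHaar_eq_zero volume
      (hP.differentiable one_ne_zero).differentiableOn (Measure.addHaar_sphere _ _ _)
  obtain ⟨a, ha, haS⟩ : ∃ a ∈ Metric.ball (0 : E) (δ / 2), a ∉ P '' Metric.sphere c η := by
    by_contra! h
    have := measure_mono_null h hnull
    exact (Metric.measure_ball_pos volume (0 : E) (half_pos hδ)).ne' this
  rw [mem_ball_zero_iff] at ha
  have hPa : ∀ y, ‖G y - (P y - a)‖ < δ := by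
    intro y
    have h1 := hPG y
    rw [Metric.mem_ball, dist_comm, dist_eq_norm] at h1
    calc ‖G y - (P y - a)‖ = ‖(G y - P y) + a‖ := by congr 1; abel
      _ ≤ ‖G y - P y‖ + ‖a‖ := norm_add_le _ _
      _ < δ := by linarith
  let Φ : E → E := fun y => c + (max (η / ‖y - c‖) 1) • (y - c)
  have hyc : ∀ y ∈ f '' b, ‖y - c‖ ≠ 0 := by
    intro y hy h
    rw [norm_eq_zero, sub_eq_zero] at h
    exact hc (h ▸ hy)
  have hΦc : ContinuousOn Φ (f '' b) := by
    refine continuousOn_const.add (ContinuousOn.smul ?_ (by fun_prop))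
    exact (continuousOn_const.div (by fun_prop) hyc).sup continuousOn_const
  have hΦ1 : ∀ y ∈ f '' b, η ≤ dist y c → Φ y = y := by
    intro y hy h
    have : 0 < ‖y - c‖ := lt_of_le_of_ne (norm_nonneg _) (hyc y hy).symm
    rw [dist_eq_norm] at h
    simp only [Φ]
    rw [max_eq_right ((div_le_one this).2 h), one_smul, add_sub_cancel]
  have hΦ2 : ∀ y ∈ f '' b, dist y c ≤ η → dist (Φ y) c = η := by
    intro y hy h
    have : 0 < ‖y - c‖ := lt_of_le_of_ne (norm_nonneg _) (hyc y hy).symm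
    rw [dist_eq_norm] at h
    simp only [Φ]
    rw [max_eq_left ((one_le_div this).2 h), dist_eq_norm, add_sub_cancel_left, norm_smul,
      Real.norm_eq_abs, abs_of_pos (by positivity)]
    field_simp
  obtain ⟨y, hy, hy0⟩ := stab (fun y => P (Φ y) - a)
    ((hP.continuous.comp_continuousOn hΦc).sub continuousOn_const) (fun y hy => by
      rcases le_total η (dist y c) with h | h
      · rw [hΦ1 y hy h]
        exact (hPa y).le.trans (by linarith)
      · have h1 := hsmall y h
        have h2 := hsmall (Φ y) (hΦ2 y hy h).le
        calc ‖G y - (P (Φ y) - a)‖ = ‖G y - G (Φ y) + (G (Φ y) - (P (Φ y) - a))‖ := by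
              congr 1; abel
          _ ≤ ‖G y - G (Φ y)‖ + ‖G (Φ y) - (P (Φ y) - a)‖ := norm_add_le _ _
          _ ≤ (‖G y‖ + ‖G (Φ y)‖) + δ := add_le_add (norm_sub_le _ _) (hPa _).le
          _ ≤ 1 := by linarith)
  rcases le_total η (dist y c) with h | h
  · rw [hΦ1 y hy h] at hy0
    have h1 := hδS y ⟨hy, h⟩
    have h2 := hPa y
    rw [hy0, sub_zero] at h2
    linarith
  · exact haS ⟨Φ y, hΦ2 y hy h, sub_eq_zero.1 hy0⟩

/-- Brouwer's invariance of domain. -/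
theorem isOpen_image_of_injOn [Nontrivial E] {U : Set E} (hU : IsOpen U) {g : E → E}
    (hg : ContinuousOn g U) (hi : InjOn g U) : IsOpen (g '' U) := by
  rw [isOpen_iff_mem_nhds]
  rintro _ ⟨x, hx, rfl⟩
  obtain ⟨r, hr, hrU⟩ := Metric.nhds_basis_closedBall.mem_iff.1 (hU.mem_nhds hx)
  let A : E → E := fun z => x + r • z
  have hA : MapsTo A (Metric.closedBall 0 1) (Metric.closedBall x r) := by
    intro z hz
    rw [mem_closedBall_zero_iff] at hz
    simp only [A, Metric.mem_closedBall, dist_eq_norm, add_sub_cancel_left, norm_smul,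
      Real.norm_eq_abs, abs_of_pos hr]
    nlinarith
  have hAi : Function.Injective A := by
    intro z w h
    simpa [A, hr.ne'] using h
  have := mem_interior_image_closedBall (f := g ∘ A)
    ((hg.mono hrU).comp (by fun_prop) hA) ((hi.mono hrU).comp hAi.injOn hA)
  have h0 : (g ∘ A) 0 = g x := by simp [A]
  rw [h0] at this
  refine Filter.mem_of_superset (mem_interior_iff_mem_nhds.1 this) ?_
  rw [image_comp]
  exact image_mono (hA.image_subset.trans hrU)

end InvarianceOfDomain

/-- Čech data for a principal bundle with discrete structure group over an open subset of `X`. -/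
structure Cocycle (X ι G : Type*) [TopologicalSpace X] [Group G] where
  U : ι → Set X
  isOpen_U : ∀ i, IsOpen (U i)
  c : ι → ι → X → G
  loc : ∀ i j, ∀ x ∈ U i, x ∈ U j → ∀ᶠ y in nhds x, c i j y = c i j x
  comp : ∀ i j k, ∀ x ∈ U i, x ∈ U j → x ∈ U k → c i j x * c j k x = c i k x

namespace Cocycle

variable {X Y ι G : Type*} [TopologicalSpace X] [TopologicalSpace Y] [Group G]

/-- The open set over which the bundle lives. -/
def dom (E : Cocycle X ι G) : Set X := ⋃ i, E.U i

/-- The bundle is trivial over `Z`. -/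
def SplitsOn (E : Cocycle X ι G) (Z : Set X) : Prop :=
  ∃ s : ι → X → G, (∀ i, ∀ x ∈ E.U i, x ∈ Z → ∀ᶠ y in nhdsWithin x Z, s i y = s i x) ∧
    ∀ i j, ∀ x ∈ E.U i, x ∈ E.U j → x ∈ Z → E.c i j x = (s i x)⁻¹ * s j x

theorem SplitsOn.mono {E : Cocycle X ι G} {Z Z' : Set X} (h : E.SplitsOn Z) (hZ : Z' ⊆ Z) :
    E.SplitsOn Z' := by
  obtain ⟨s, hs, hc⟩ := h
  exact ⟨s, fun i x hx hxZ => (hs i x hx (hZ hxZ)).filter_mono (nhdsWithin_mono _ hZ),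
    fun i j x hi hj hx => hc i j x hi hj (hZ hx)⟩

/-- Pull-back along a map continuous on an open set. -/
def comap (E : Cocycle X ι G) (g : Y → X) (W : Set Y) (hW : IsOpen W) (hg : ContinuousOn g W) :
    Cocycle Y ι G where
  U i := W ∩ g ⁻¹' E.U i
  isOpen_U i := hg.isOpen_inter_preimage hW (E.isOpen_U i)
  c i j y := E.c i j (g y)
  loc i j x hi hj := by
    have h := E.loc i j (g x) hi.2 hj.2
    exact (hg.continuousAt (hW.mem_nhds hi.1)).eventually h
  comp i j k x hi hj hk := E.comp i j k _ hi.2 hj.2 hk.2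

theorem c_self (E : Cocycle X ι G) {i : ι} {x : X} (hi : x ∈ E.U i) : E.c i i x = 1 := by
  have := E.comp i i i x hi hi hi
  simpa using this

open Classical in
/-- The fibre bundle with discrete fibre attached to a cocycle. -/
def core (E : Cocycle X ι G) [TopologicalSpace G] [DiscreteTopology G] (Z : Set X)
    (hZ : Z ⊆ E.dom) : FiberBundleCore ι Z G where
  baseSet i := Subtype.val ⁻¹' E.U i
  isOpen_baseSet i := (E.isOpen_U i).preimage continuous_subtype_val
  indexAt x := (mem_iUnion.1 (hZ x.2)).choose
  mem_baseSet_at x := (mem_iUnion.1 (hZ x.2)).choose_spec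
  coordChange i j x v := E.c j i x * v
  coordChange_self i x hx v := by rw [E.c_self hx, one_mul]
  continuousOn_coordChange i j := by
    rintro ⟨x, v⟩ ⟨⟨hi, hj⟩, -⟩
    apply ContinuousAt.continuousWithinAt
    have h : ∀ᶠ p : Z × G in nhds (x, v), E.c j i p.1 * p.2 = E.c j i x * p.2 := by
      have h1 : Filter.Tendsto (fun p : Z × G => (p.1 : X)) (nhds (x, v)) (nhds x) :=
        (continuous_subtype_val.comp continuous_fst).continuousAt
      filter_upwards [h1.eventually (E.loc j i x hj hi)] with p hp
      rw [hp]
    refine ContinuousAt.congr (f := fun p : Z × G => E.c j i x * p.2) ?_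
      (h.mono fun p hp => hp.symm)
    exact (continuous_of_discreteTopology (f := fun v : G => E.c j i x * v)).continuousAt.comp
      continuous_snd.continuousAt
  coordChange_comp i j k x hx v := by
    rw [← mul_assoc, E.comp k j i x hx.2 hx.1.2 hx.1.1]

theorem splitsOn_of_simplyConnected (E : Cocycle X ι G) {Z : Set X} (hZ : Z ⊆ E.dom)
    [SimplyConnectedSpace Z] [LocallyPathConnectedSpace Z] : E.SplitsOn Z := by
  classical
  let : TopologicalSpace G := ⊥
  have : DiscreteTopology G := ⟨rfl⟩
  let C := E.core Z hZ
  have cov : IsCoveringMap C.proj := FiberBundle.isCoveringMap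
  obtain ⟨a₀⟩ : Nonempty Z := inferInstance
  obtain ⟨S, ⟨-, hS⟩, -⟩ := cov.existsUnique_continuousMap_lifts (ContinuousMap.id Z) a₀
    (⟨a₀, (1 : G)⟩ : C.TotalSpace) rfl
  have hS' : ∀ z, (S z).proj = z := fun z => congrFun hS z
  let σ : ι → Z → G := fun i z => ((C.localTriv i) (S z)).2
  have hσ : ∀ z : Z, ∃ (k : ι) (a : G), (z : X) ∈ E.U k ∧ ∀ i, σ i z = E.c i k z * a := by
    intro z
    refine ⟨C.indexAt z, (S z).2, C.mem_baseSet_at z, fun i => ?_⟩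
    simp only [σ]
    rw [C.localTriv_apply]
    change E.c i (C.indexAt (S z).proj) (S z).proj * _ = _
    rw [hS']
  refine ⟨fun i x => if h : x ∈ Z then (σ i ⟨x, h⟩)⁻¹ else 1, ?_, ?_⟩
  · intro i x hx hxZ
    have hc : ContinuousAt (σ i) ⟨x, hxZ⟩ := by
      have h1 : ContinuousAt (C.localTriv i) (S ⟨x, hxZ⟩) := by
        apply (C.localTriv i).continuousAt
        rw [C.mem_localTriv_source]
        change ((S ⟨x, hxZ⟩).proj : X) ∈ E.U i
        rw [hS']; exact hx
      exact (continuous_snd.continuousAt.comp h1).comp S.continuous.continuousAt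
    have h2 : ∀ᶠ y in nhds (⟨x, hxZ⟩ : Z), σ i y = σ i ⟨x, hxZ⟩ :=
      hc.eventually (IsOpen.mem_nhds (isOpen_discrete {σ i ⟨x, hxZ⟩}) rfl)
    rw [nhdsWithin_eq_map_subtype_coe hxZ, Filter.eventually_map]
    filter_upwards [h2] with y hy
    simp only [y.2, hxZ, dif_pos, inv_inj]
    exact hy
  · intro i j x hi hj hxZ
    simp only [hxZ, dif_pos, inv_inv]
    obtain ⟨k, a, hk, ha⟩ := hσ ⟨x, hxZ⟩
    rw [ha, ha, ← E.comp i j k x hi hj hk]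
    group

theorem splitsOn_of_convex {V : Type*} [NormedAddCommGroup V] [NormedSpace ℝ V]
    (E : Cocycle V ι G) {Z : Set V} (hZ : Z ⊆ E.dom) (ho : IsOpen Z) (hc : Convex ℝ Z) :
    E.SplitsOn Z := by
  rcases Z.eq_empty_or_nonempty with rfl | hne
  · exact ⟨fun _ _ => 1, by simp, by simp⟩
  have : ContractibleSpace Z := hc.contractibleSpace hne
  have : SimplyConnectedSpace Z := inferInstance
  have := ho.locallyPathConnectedSpace
  exact E.splitsOn_of_simplyConnected hZ

end Cocycle

theorem IsPreconnected.eq_of_locally_eq {X G : Type*} [TopologicalSpace X] {S : Set X} (hS : IsPreconnected S)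
    {f : X → G} (hf : ∀ x ∈ S, ∀ᶠ y in nhdsWithin x S, f y = f x) {x y : X} (hx : x ∈ S)
    (hy : y ∈ S) : f x = f y := by
  let : TopologicalSpace G := ⊥
  have : DiscreteTopology G := ⟨rfl⟩
  refine hS.constant (f := f) (fun z hz => ?_) hx hy
  exact tendsto_nhds_of_eventually_eq (hf z hz)

namespace Cocycle

variable {V ι G J : Type*} [NormedAddCommGroup V] [NormedSpace ℝ V] [Group G]

/-- Gluing step: if the pull-backs of `E` and `E'` by an open embedding `g` have the same
transition functions on a shell around `B`, and `E'` is trivial on `D`, then `E` is trivial on the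
part of `D` far from `B`. -/
theorem splitsOn_of_transition_eq (E E' : Cocycle V ι G) (U D K W m : Set V) (g : V → V)
    (β : J → Set V) (s s' : J → ι → V → G)
    (hDo : IsOpen D) (hDc : Convex ℝ D) (hDE' : D ⊆ E'.dom)
    (hKcl : IsClosed (g '' K)) (hWop : IsOpen (g '' W)) (hKW : K ⊆ W)
    (hβo : ∀ j, IsOpen (β j)) (hβU : ∀ j, β j ⊆ U) (hWβ : W \ K ⊆ ⋃ j, β j)
    (hg : ContinuousOn g U) (hUo : IsOpen U)
    (hginj : InjOn g U) (hgop : ∀ x ∈ U, nhds (g x) ≤ Filter.map g (nhds x))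
    (hKE : (g '' K)ᶜ ⊆ E.dom)
    (hmD : m ⊆ D) (hmK : Disjoint m (g '' K))
    (hs : ∀ j i x, x ∈ β j → g x ∈ E.U i → ∀ᶠ y in nhds x, s j i y = s j i x)
    (hsc : ∀ j i k x, x ∈ β j → g x ∈ E.U i → g x ∈ E.U k →
      E.c i k (g x) = (s j i x)⁻¹ * s j k x)
    (hs' : ∀ j i x, x ∈ β j → g x ∈ E'.U i → ∀ᶠ y in nhds x, s' j i y = s' j i x)
    (hsc' : ∀ j i k x, x ∈ β j → g x ∈ E'.U i → g x ∈ E'.U k →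
      E'.c i k (g x) = (s' j i x)⁻¹ * s' j k x)
    (hθ : ∀ j l i i' x, x ∈ β j → x ∈ β l → g x ∈ E.U i → g x ∈ E'.U i' →
      s j i x * (s l i x)⁻¹ = s' j i' x * (s' l i' x)⁻¹) :
    E.SplitsOn m := by
  classical
  obtain ⟨r, hr, hrc⟩ := E'.splitsOn_of_convex hDE' hDo hDc
  have hr' : ∀ i x, x ∈ E'.U i → x ∈ D → ∀ᶠ y in nhds x, r i y = r i x := by
    intro i x hi hx
    have := hr i x hi hx
    rwa [hDo.nhdsWithin_eq hx] at this
  obtain ⟨χ, hχ⟩ : ∃ χ : ι → V → G, ∀ i j i' x, x ∈ β j → g x ∈ D → g x ∈ E.U i → g x ∈ E'.U i' →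
      χ i (g x) = (s j i x)⁻¹ * s' j i' x * (r i' (g x))⁻¹ := by
    refine ⟨fun i p => if h : ∃ (x : V) (j : J) (i' : ι), x ∈ β j ∧ g x = p ∧ p ∈ E'.U i' then
      (s h.choose_spec.choose i h.choose)⁻¹ *
        s' h.choose_spec.choose h.choose_spec.choose_spec.choose h.choose *
        (r h.choose_spec.choose_spec.choose p)⁻¹ else 1, ?_⟩
    intro i j i' x hx hxD hi hi'
    have h : ∃ (y : V) (l : J) (k' : ι), y ∈ β l ∧ g y = g x ∧ g x ∈ E'.U k' :=
      ⟨x, j, i', hx, rfl, hi'⟩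
    simp only
    rw [dif_pos h]
    obtain ⟨hy, hyx, hk⟩ := h.choose_spec.choose_spec.choose_spec
    have e := hginj (hβU _ hy) (hβU _ hx) hyx
    generalize h.choose_spec.choose_spec.choose = k' at *
    generalize h.choose_spec.choose = l at *
    generalize h.choose = y at *
    subst e
    have h1 := hθ j l i i' y hx hy hi hi'
    have h2 := hsc' l i' k' y hy hi' hk
    have h3 := hrc i' k' (g y) hi' hk hxD
    rw [h2] at h3
    have h4 : s' l k' y * (r k' (g y))⁻¹ = s' l i' y * (r i' (g y))⁻¹ := by
      have : s' l k' y = s' l i' y * ((r i' (g y))⁻¹ * r k' (g y)) := by rw [← h3]; group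
      rw [this]; group
    have h5 : (s l i y)⁻¹ = (s j i y)⁻¹ * (s' j i' y * (s' l i' y)⁻¹) := by
      rw [← h1]; group
    rw [mul_assoc, h4, h5]; group
  have hcov : ∀ p ∈ D, p ∉ g '' K → p ∈ g '' W → ∃ x j i', x ∈ β j ∧ g x = p ∧ p ∈ E'.U i' := by
    rintro p hp hpK ⟨x, hxW, rfl⟩
    obtain ⟨j, hj⟩ := mem_iUnion.1 (hWβ ⟨hxW, fun h => hpK ⟨x, h, rfl⟩⟩)
    obtain ⟨i', hi'⟩ := mem_iUnion.1 (hDE' hp)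
    exact ⟨x, j, i', hj, rfl, hi'⟩
  have hχc : ∀ i k p, p ∈ D → p ∉ g '' K → p ∈ g '' W → p ∈ E.U i → p ∈ E.U k →
      E.c i k p * χ k p = χ i p := by
    intro i k p hp hpK hpW hi hk
    obtain ⟨x, j, i', hj, rfl, hi'⟩ := hcov p hp hpK hpW
    rw [hχ i j i' x hj hp hi hi', hχ k j i' x hj hp hk hi', hsc j i k x hj hi hk]
    group
  have hχl : ∀ i p, p ∈ D → p ∉ g '' K → p ∈ g '' W → p ∈ E.U i →
      ∀ᶠ q in nhds p, χ i q = χ i p := by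
    intro i p hp hpK hpW hi
    obtain ⟨x, j, i', hj, rfl, hi'⟩ := hcov p hp hpK hpW
    have hxU := hβU _ hj
    have hgc : Filter.Tendsto g (nhds x) (nhds (g x)) := hg.continuousAt (hUo.mem_nhds hxU)
    refine hgop x hxU (Filter.mem_map.2 ?_)
    have e1 := hgc.eventually (hDo.mem_nhds hp)
    have e2 := hgc.eventually ((E.isOpen_U i).mem_nhds hi)
    have e3 := hgc.eventually ((E'.isOpen_U i').mem_nhds hi')
    have e4 := hgc.eventually (hr' i' _ hi' hp)
    filter_upwards [e1, e2, e3, e4, hs j i x hj hi, hs' j i' x hj hi', (hβo j).mem_nhds hj] with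
      y h1 h2 h3 h4 h5 h6 h7
    show χ i (g y) = _
    rw [hχ i j i' x hj hp hi hi', hχ i j i' y h7 h1 h2 h3, h4, h5, h6]
  let F : Cocycle V (Option ι) G :=
    { U := fun o => o.elim (D ∩ g '' W) (fun i => E.U i ∩ (D ∩ (g '' K)ᶜ))
      isOpen_U := by
        rintro (_ | i)
        · exact hDo.inter hWop
        · exact (E.isOpen_U i).inter (hDo.inter hKcl.isOpen_compl)
      c := fun o o' p => match o, o' with
        | none, none => 1
        | some i, none => χ i p
        | none, some i => (χ i p)⁻¹
        | some i, some k => E.c i k p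
      loc := by
        rintro (_ | i) (_ | k) x hi hk
        · simp
        · filter_upwards [hχl k x hi.1 hk.2.2 hi.2 hk.1] with y hy
          simp [hy]
        · filter_upwards [hχl i x hk.1 hi.2.2 hk.2 hi.1] with y hy
          simp [hy]
        · exact E.loc i k x hi.1 hk.1
      comp := by
        rintro (_ | i) (_ | k) (_ | l) x hi hk hl
        · simp
        · simp
        · simp
        · simp only
          rw [← hχc k l x hi.1 hk.2.2 hi.2 hk.1 hl.1]; group
        · simp
        · simp only
          rw [← hχc i l x hk.1 hi.2.2 hk.2 hi.1 hl.1]; group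
        · exact hχc i k x hl.1 hi.2.2 hl.2 hi.1 hk.1
        · exact E.comp i k l x hi.1 hk.1 hl.1 }
  have hF : D ⊆ F.dom := by
    intro p hp
    by_cases hpK : p ∈ g '' K
    · exact mem_iUnion.2 ⟨none, hp, image_mono hKW hpK⟩
    · obtain ⟨i, hi⟩ := mem_iUnion.1 (hKE hpK)
      exact mem_iUnion.2 ⟨some i, hi, hp, hpK⟩
  obtain ⟨t, ht, htc⟩ := F.splitsOn_of_convex hF hDo hDc
  have hmF : ∀ i x, x ∈ E.U i → x ∈ m → x ∈ F.U (some i) := fun i x hi hx =>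
    ⟨hi, hmD hx, fun h => hmK.le_bot ⟨hx, h⟩⟩
  exact ⟨fun i => t (some i), fun i x hi hx =>
    (ht (some i) x (hmF i x hi hx) (hmD hx)).filter_mono (nhdsWithin_mono _ hmD),
    fun i k x hi hk hx => htc (some i) (some k) x (hmF i x hi hx) (hmF k x hk hx) (hmD hx)⟩

theorem exists_transition (E : Cocycle V ι G) (g : V → V) (β : J → Set V) (s : J → ι → V → G)
    (hβo : ∀ j, IsOpen (β j)) (hβc : ∀ j, Convex ℝ (β j)) (hg : ∀ j, ContinuousOn g (β j))
    (hgE : ∀ j, ∀ x ∈ β j, g x ∈ E.dom)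
    (hs : ∀ j i x, x ∈ β j → g x ∈ E.U i → ∀ᶠ y in nhds x, s j i y = s j i x)
    (hsc : ∀ j i k x, x ∈ β j → g x ∈ E.U i → g x ∈ E.U k →
      E.c i k (g x) = (s j i x)⁻¹ * s j k x) :
    ∃ θ : J → J → G, ∀ j l i x, x ∈ β j → x ∈ β l → g x ∈ E.U i →
      s j i x * (s l i x)⁻¹ = θ j l := by
  classical
  have key : ∀ j l, ∃ a : G, ∀ i x, x ∈ β j → x ∈ β l → g x ∈ E.U i →
      s j i x * (s l i x)⁻¹ = a := by
    intro j l
    choose κ hκ using fun (x : V) (hx : x ∈ β j) => mem_iUnion.1 (hgE j x hx)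
    let t : V → G := fun x => if h : x ∈ β j then s j (κ x h) x * (s l (κ x h) x)⁻¹ else 1
    have ht : ∀ i x, x ∈ β j → x ∈ β l → g x ∈ E.U i → s j i x * (s l i x)⁻¹ = t x := by
      intro i x hj hl hi
      simp only [t, dif_pos hj]
      have h1 := hsc j i _ x hj hi (hκ x hj)
      have h2 := hsc l i _ x hl hi (hκ x hj)
      rw [h1] at h2
      generalize κ x hj = k at *
      have h3 : s j k x = s j i x * ((s l i x)⁻¹ * s l k x) := by rw [← h2]; group
      rw [h3]; group
    rcases (β j ∩ β l).eq_empty_or_nonempty with he | ⟨x₀, hx₀⟩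
    · refine ⟨1, fun i x hj hl => ?_⟩
      have : x ∈ β j ∩ β l := ⟨hj, hl⟩
      simp [he] at this
    refine ⟨t x₀, fun i x hj hl hi => ?_⟩
    rw [ht i x hj hl hi]
    refine ((hβc j).inter (hβc l)).isPreconnected.eq_of_locally_eq ?_ ⟨hj, hl⟩ hx₀
    rintro y ⟨hyj, hyl⟩
    apply Filter.Eventually.filter_mono nhdsWithin_le_nhds
    have hi := hκ y hyj
    have hgc : Filter.Tendsto g (nhds y) (nhds (g y)) :=
      (hg j).continuousAt ((hβo j).mem_nhds hyj)
    filter_upwards [hs j _ y hyj hi, hs l _ y hyl hi, (hβo j).mem_nhds hyj,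
      (hβo l).mem_nhds hyl, hgc.eventually ((E.isOpen_U _).mem_nhds hi)] with z h1 h2 h3 h4 h5
    rw [← ht _ z h3 h4 h5, ← ht _ y hyj hyl hi, h1, h2]
  choose θ hθ using key
  exact ⟨θ, fun j l i x hj hl hi => hθ j l i x hj hl hi⟩

end Cocycle

theorem imgIter_eq_self {U K : Set R3} {f : U → U} (h : imgIter f 1 K = K) (hKU : K ⊆ U) (n : ℕ) :
    imgIter f n K = K := by
  have h1 : f '' (Subtype.val ⁻¹' K) = (Subtype.val ⁻¹' K : Set U) := by
    apply Subtype.val_injective.image_injective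
    have : imgIter f 1 K = Subtype.val '' (f '' (Subtype.val ⁻¹' K)) := rfl
    rw [← this, h, Subtype.image_preimage_coe, inter_eq_right.2 hKU]
  have h2 : f^[n] '' (Subtype.val ⁻¹' K) = (Subtype.val ⁻¹' K : Set U) := by
    induction n with
    | zero => simp
    | succ n ih => rw [Function.iterate_succ, image_comp, h1, ih]
  rw [imgIter, h2, Subtype.image_preimage_coe, inter_eq_right.2 hKU]

/-- A compact set with infinitely many separated wild features, each detected by a bundle with
finite structure group that is nontrivial along a loop off the set, is not an attractor. -/
theorem not_isAttractor_of_cocycles {ι G : Type*} [Group G] [Finite G] {B : Set R3}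
    (E : ℕ → Cocycle R3 ι G) (D m : ℕ → Set R3)
    (hDo : ∀ i, IsOpen (D i)) (hDc : ∀ i, Convex ℝ (D i))
    (hDD : ∀ i j, i ≠ j → Disjoint (D i) (D j)) (hEB : ∀ i, (E i).domᶜ ⊆ B)
    (hED : ∀ i, (E i).domᶜ ⊆ D i) (hmc : ∀ i, IsCompact (m i)) (hmD : ∀ i, m i ⊆ D i)
    (hmB : ∀ i, Disjoint (m i) B) (hm : ∀ i, ¬ (E i).SplitsOn (m i))
    (hID : ∀ U : Set R3, IsOpen U → ∀ g : R3 → R3, ContinuousOn g U → InjOn g U → IsOpen (g '' U))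
    {U : Set R3} (hU : IsOpen U) {f : U → U} (hf : Continuous f) (hfi : Function.Injective f) :
    ¬ IsAttractor f B := by
  classical
  rintro ⟨hBc, hBU, hfB, A, hAU, hBA, hA⟩
  obtain ⟨δ₀, hδ₀, hδA⟩ := hBc.exists_cthickening_subset_open isOpen_interior hBA
  set P := Metric.cthickening δ₀ B
  have hPU : P ⊆ U := hδA.trans (interior_subset.trans hAU)
  set δ := δ₀ / 2 with hδ
  have hδpos : 0 < δ := by positivity
  set S := Metric.cthickening δ B \ Metric.thickening δ B
  have hSc : IsCompact S := hBc.cthickening.diff Metric.isOpen_thickening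
  obtain ⟨T, hTS, hTf, hST⟩ := hSc.finite_cover_balls (e := δ / 2) (by positivity)
  have := hTf.to_subtype
  let β : T → Set R3 := fun p => Metric.ball p (δ / 2)
  set O := ⋃ j, β j with hO
  have hSO : S ⊆ O := by
    intro x hx
    obtain ⟨p, hp, hxp⟩ := mem_iUnion₂.1 (hST hx)
    exact mem_iUnion.2 ⟨⟨p, hp⟩, hxp⟩
  have hβB : ∀ j, Disjoint (β j) B := by
    intro j
    rw [disjoint_left]
    intro x hx hxB
    refine (hTS j.2).2 (Metric.mem_thickening_iff.2 ⟨x, hxB, ?_⟩)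
    rw [dist_comm]; exact (Metric.mem_ball.1 hx).trans (by linarith)
  have hβP : ∀ j, β j ⊆ P := by
    intro j x hx
    have h1 := (hTS j.2).1
    have : x ∈ Metric.cthickening (δ / 2) (Metric.cthickening δ B) :=
      Metric.mem_cthickening_of_dist_le x j _ _ h1 (Metric.mem_ball.1 hx).le
    rw [cthickening_cthickening (by positivity) hδpos.le] at this
    exact Metric.cthickening_mono (by rw [hδ]; linarith) _ this
  have hβU : ∀ j, β j ⊆ U := fun j => (hβP j).trans hPU
  have hβo : ∀ j, IsOpen (β j) := fun j => Metric.isOpen_ball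
  have hβc : ∀ j, Convex ℝ (β j) := fun j => convex_ball _ _
  have hOo : IsOpen O := isOpen_iUnion hβo
  set K := Metric.cthickening δ B \ O
  set W := Metric.thickening δ B
  have hKc : IsCompact K := hBc.cthickening.diff hOo
  have hKW : K ⊆ W := fun x hx => by_contra fun h => hx.2 (hSO ⟨hx.1, h⟩)
  have hBK : B ⊆ K := fun x hx => ⟨Metric.self_subset_cthickening _ hx, fun h => by
    obtain ⟨j, hj⟩ := mem_iUnion.1 h
    exact (hβB j).le_bot ⟨hj, hx⟩⟩
  have hWcP : Metric.cthickening δ B ⊆ P := Metric.cthickening_mono (by rw [hδ]; linarith) _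
  have hWP : W ⊆ P := (Metric.thickening_subset_cthickening _ _).trans hWcP
  have hWU : W ⊆ U := hWP.trans hPU
  have hWK : W \ K ⊆ O := fun x hx => by_contra fun h =>
    hx.2 ⟨Metric.thickening_subset_cthickening _ _ hx.1, h⟩
  -- choose the iterate
  let R := Nat.card (T → T → G) + 1
  have hVo : IsOpen (⋂ i : Fin R, (m i)ᶜ) := isOpen_iInter_of_finite fun i =>
    (hmc i).isClosed.isOpen_compl
  obtain ⟨n, hn⟩ := hA P hBc.cthickening (hδA.trans interior_subset) _ (by
    rw [hVo.interior_eq]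
    exact subset_iInter fun i => disjoint_left.1 (hmB i).symm)
  specialize hn n le_rfl
  let g : R3 → R3 := fun x => if h : x ∈ U then (f^[n] ⟨x, h⟩ : R3) else x
  have hgimg : ∀ Q ⊆ U, g '' Q = imgIter f n Q := by
    intro Q hQ
    ext y
    constructor
    · rintro ⟨x, hx, rfl⟩
      refine ⟨_, ⟨⟨x, hQ hx⟩, hx, rfl⟩, ?_⟩
      simp [g, hQ hx]
    · rintro ⟨_, ⟨⟨x, hxU⟩, hx, rfl⟩, rfl⟩
      exact ⟨x, hx, by simp [g, hxU]⟩
  have hgB : g '' B = B := by rw [hgimg B hBU, imgIter_eq_self hfB hBU]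
  have hgc : ContinuousOn g U := by
    rw [continuousOn_iff_continuous_domRestrict]
    have : U.domRestrict g = fun x => (f^[n] x : R3) := by
      ext1 x; simp [g, domRestrict]
    rw [this]
    exact continuous_subtype_val.comp (hf.iterate n)
  have hgi : InjOn g U := by
    intro x hx y hy hxy
    simp only [g, hx, hy, dif_pos] at hxy
    simpa using (hfi.iterate n) (Subtype.val_injective hxy)
  have hgop : ∀ x ∈ U, nhds (g x) ≤ Filter.map g (nhds x) := by
    intro x hx s hs
    obtain ⟨t, hts, hto, hxt⟩ := mem_nhds_iff.1 (Filter.mem_map.1 hs)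
    have := hID (t ∩ U) (hto.inter hU) g (hgc.mono inter_subset_right) (hgi.mono inter_subset_right)
    refine Filter.mem_of_superset (this.mem_nhds ⟨x, ⟨hxt, hx⟩, rfl⟩) ?_
    rintro _ ⟨y, hy, rfl⟩
    exact hts hy.1
  have hβdom : ∀ i j x, x ∈ β j → g x ∈ (E i).dom := by
    intro i j x hx
    by_contra h
    have h1 := hEB i h
    rw [← hgB] at h1
    obtain ⟨y, hy, hyx⟩ := h1
    rw [hgi (hBU hy) (hβU j hx) hyx] at hy
    exact (hβB j).le_bot ⟨hx, hy⟩
  -- split the pulled back bundles over the shell balls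
  have hsplit : ∀ i j, ∃ s : ι → R3 → G,
      (∀ a x, x ∈ β j → g x ∈ (E i).U a → ∀ᶠ y in nhds x, s a y = s a x) ∧
      ∀ a b x, x ∈ β j → g x ∈ (E i).U a → g x ∈ (E i).U b →
        (E i).c a b (g x) = (s a x)⁻¹ * s b x := by
    intro i j
    have h : ((E i).comap g U hU hgc).SplitsOn (β j) := by
      refine Cocycle.splitsOn_of_convex _ ?_ (hβo j) (hβc j)
      intro x hx
      obtain ⟨a, ha⟩ := mem_iUnion.1 (hβdom i j x hx)
      exact mem_iUnion.2 ⟨a, hβU j hx, ha⟩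
    obtain ⟨s, hs, hc⟩ := h
    refine ⟨s, fun a x hx ha => ?_, fun a b x hx ha hb =>
      hc a b x ⟨hβU j hx, ha⟩ ⟨hβU j hx, hb⟩ hx⟩
    have := hs a x ⟨hβU j hx, ha⟩ hx
    rwa [(hβo j).nhdsWithin_eq hx] at this
  choose s hs hsc using hsplit
  have hθ := fun i => (E i).exists_transition g β (s i) hβo hβc (fun j => hgc.mono (hβU j))
    (hβdom i) (hs i) (hsc i)
  choose θ hθ using hθ
  have := Fintype.ofFinite (T → T → G)
  obtain ⟨i, i', hii, hth⟩ := Fintype.exists_ne_map_eq_of_card_lt (fun i : Fin R => θ i)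
    (by rw [Fintype.card_fin, ← Nat.card_eq_fintype_card]; exact Nat.lt_succ_self _)
  have hne : (i : ℕ) ≠ i' := fun h => hii (Fin.ext h)
  have hKP : K ⊆ P := hKW.trans hWP
  refine hm i ((E i).splitsOn_of_transition_eq (E i') U (D i) K W (m i) g β (s i) (s i') (hDo i)
    (hDc i) ?_ ?_ ?_ hKW hβo hβU hWK hgc hU hgi hgop ?_ (hmD i) ?_ (hs i) (hsc i) (hs i')
    (hsc i') ?_)
  · intro x hx
    by_contra h
    exact (hDD i i' hne).le_bot ⟨hx, hED i' h⟩
  · exact (hKc.image_of_continuousOn (hgc.mono (hKW.trans hWU))).isClosed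
  · exact hID W Metric.isOpen_thickening g (hgc.mono hWU) (hgi.mono hWU)
  · rw [compl_subset_comm]
    exact (hEB i).trans (hgB ▸ image_mono hBK)
  · rw [disjoint_right]
    intro x hx
    rw [hgimg K (hKP.trans hPU)] at hx
    have : x ∈ imgIter f n P := by
      rw [← hgimg _ hPU]; rw [← hgimg K (hKP.trans hPU)] at hx
      exact image_mono hKP hx
    exact mem_iInter.1 (hn this) i
  · intro j l a b x hj hl ha hb
    rw [hθ i j l a x hj hl ha, hθ i' j l b x hj hl hb]
    exact congrFun (congrFun hth j) l

/-- A family of locally constant transition functions given by discontinuous potentials. -/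
structure PotentialAtlas (X κ G : Type*) [TopologicalSpace X] [Group G] where
  U : κ → Set X
  isOpen_U : ∀ a, IsOpen (U a)
  pot : κ → X → G
  loc : ∀ a b, ∀ x ∈ U a, x ∈ U b →
    ∀ᶠ y in nhds x, (pot a y)⁻¹ * pot b y = (pot a x)⁻¹ * pot b x

namespace PotentialAtlas

variable {X Y κ J G : Type*} [TopologicalSpace X] [TopologicalSpace Y] [Group G]

def dom (P : PotentialAtlas X κ G) : Set X := ⋃ a, P.U a

/-- On the common domain, the charts of `P` are contained in those of `Q` and have the same
potentials. -/
def Refines (P Q : PotentialAtlas X κ G) : Prop :=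
  ∀ a, ∀ x ∈ P.U a, x ∈ Q.dom → x ∈ Q.U a ∧ ∀ᶠ y in nhds x, P.pot a y = Q.pot a y

theorem refines_of_disjoint {P Q : PotentialAtlas X κ G} (h : Disjoint P.dom Q.dom) :
    P.Refines Q := fun a _ hx hxQ =>
  (disjoint_left.1 h (mem_iUnion_of_mem a hx) hxQ).elim

def comap (P : PotentialAtlas X κ G) (T : C(Y, X)) : PotentialAtlas Y κ G where
  U a := T ⁻¹' P.U a
  isOpen_U a := (P.isOpen_U a).preimage T.continuous
  pot a := P.pot a ∘ T
  loc a b x ha hb := T.continuous.continuousAt.eventually (P.loc a b (T x) ha hb)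

theorem dom_comap (P : PotentialAtlas X κ G) (T : C(Y, X)) :
    (P.comap T).dom = T ⁻¹' P.dom := preimage_iUnion.symm

theorem Refines.comap {P Q : PotentialAtlas X κ G} (h : P.Refines Q) (T : C(Y, X)) :
    (P.comap T).Refines (Q.comap T) := by
  intro a x hx hxQ
  rw [dom_comap] at hxQ
  exact ⟨(h a (T x) hx hxQ).1, T.continuous.continuousAt.eventually (h a (T x) hx hxQ).2⟩

theorem Refines.loc {P Q : PotentialAtlas X κ G} (h : P.Refines Q) (a b : κ) {x : X}
    (ha : x ∈ P.U a) (hb : x ∈ Q.U b) :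
    ∀ᶠ y in nhds x, (P.pot a y)⁻¹ * Q.pot b y = (P.pot a x)⁻¹ * Q.pot b x := by
  obtain ⟨h1, h2⟩ := h a x ha (mem_iUnion_of_mem b hb)
  filter_upwards [h2, Q.loc a b x h1 hb] with y hy hy'
  rw [hy, hy', h2.self_of_nhds]

/-- The cocycle obtained by gluing compatible atlases. -/
def glue (P : J → PotentialAtlas X κ G)
    (h : ∀ i j, i ≠ j → (P i).Refines (P j) ∨ (P j).Refines (P i)) : Cocycle X (J × κ) G where
  U i := (P i.1).U i.2
  isOpen_U i := (P i.1).isOpen_U i.2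
  c i j x := ((P i.1).pot i.2 x)⁻¹ * (P j.1).pot j.2 x
  loc := by
    rintro ⟨i, a⟩ ⟨j, b⟩ x hi hj
    rcases eq_or_ne i j with rfl | hij
    · exact (P i).loc a b x hi hj
    rcases h i j hij with h | h
    · exact h.loc a b hi hj
    · filter_upwards [h.loc b a hj hi] with y hy
      simpa using congrArg (·⁻¹) hy
  comp i j k x _ _ _ := by group

theorem dom_glue (P : J → PotentialAtlas X κ G) (h) : (glue P h).dom = ⋃ j, (P j).dom :=
  iUnion_prod' _

/-- An atlas with an upper, a middle and a lower chart, as in a Dehn colouring of a plane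
diagram. -/
def ofDiagram (Up Mid Down : Set X) (hU : IsOpen Up) (hM : IsOpen Mid) (hD : IsOpen Down)
    (v m : X → G)
    (hv : ∀ x ∈ Up, x ∈ Down → ∀ᶠ y in nhds x, v y = v x)
    (hm : ∀ x ∈ Up, x ∈ Mid → ∀ᶠ y in nhds x, m y = m x)
    (hmv : ∀ x ∈ Mid, x ∈ Down → ∀ᶠ y in nhds x, (m y)⁻¹ * v y = (m x)⁻¹ * v x) :
    PotentialAtlas X (Fin 3) G where
  U := ![Up, Mid, Down]
  isOpen_U a := by fin_cases a <;> assumption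
  pot := ![1, m, v]
  loc a b x ha hb := by
    have inv : ∀ {f g : X → G}, (∀ᶠ y in nhds x, (f y)⁻¹ * g y = (f x)⁻¹ * g x) →
        ∀ᶠ y in nhds x, (g y)⁻¹ * f y = (g x)⁻¹ * f x := by
      intro f g h
      filter_upwards [h] with y hy
      simpa using congrArg (·⁻¹) hy
    fin_cases a <;> fin_cases b
    · simp
    · simpa using hm x ha hb
    · simpa using hv x ha hb
    · exact inv (by simpa using hm x hb ha)
    · simp
    · exact hmv x ha hb
    · exact inv (by simpa using hv x hb ha)
    · exact inv (hmv x hb ha)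
    · simp

theorem mem_dom_ofDiagram {Up Mid Down : Set X} {hU hM hD} {v m : X → G} {hv hm hmv} {x : X} :
    x ∈ (ofDiagram Up Mid Down hU hM hD v m hv hm hmv).dom ↔ x ∈ Up ∨ x ∈ Mid ∨ x ∈ Down := by
  simp [dom, ofDiagram, Fin.exists_fin_succ]

end PotentialAtlas

namespace WildLeg

variable {G : Type*} [Group G]

theorem isOpen_imp_of_isClosed {X : Type*} [TopologicalSpace X] {p q : X → Prop}
    (hp : IsClosed {x | p x}) (hq : IsOpen {x | q x}) : IsOpen {x | p x → q x} := by
  have : {x | p x → q x} = {x | p x}ᶜ ∪ {x | q x} := by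
    ext x; simp [imp_iff_not_or]
  rw [this]
  exact hp.isOpen_compl.union hq

theorem eventually_coord {p : R3} (i : Fin 3) (a : ℝ) :
    ∀ᶠ q : R3 in nhds p, p i = a ∨ (p i < a ∧ q i < a) ∨ (a < p i ∧ a < q i) := by
  have hc : ContinuousAt (fun q : R3 => q i) p := by fun_prop
  rcases lt_trichotomy (p i) a with h | h | h
  · filter_upwards [hc.eventually (gt_mem_nhds h)] with q hq using .inr (.inl ⟨h, hq⟩)
  · simp [h]
  · filter_upwards [hc.eventually (lt_mem_nhds h)] with q hq using .inr (.inr ⟨h, hq⟩)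

/-- Points above the part of the diagram in the zone `-6 < x < -5/2`. -/
def zoneUp (b : ℝ) : Set R3 := {p | (-6 < p 0 ∧ p 0 < -5 / 2) ∧
  (p 0 = -4 ∧ -16 ≤ p 1 ∧ p 1 ≤ 2 → 0 < p 2) ∧
  (p 0 = -5 ∧ -4 ≤ p 1 ∧ p 1 ≤ -1 → 20 + 8 * p 1 < p 2) ∧
  (p 1 = 2 ∧ p 0 ≤ -4 → -16 - 4 * p 0 < p 2) ∧
  (p 1 = 8 → 6 + 3 * p 0 < p 2) ∧
  (p 1 = -1 ∧ -5 ≤ p 0 → -8 - 4 * p 0 < p 2) ∧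
  (p 1 = -4 ∧ -5 ≤ p 0 → 3 + 3 * p 0 < p 2) ∧
  (p 1 = -16 ∧ p 0 ≤ -4 → b * (-4 - p 0) < p 2)}

/-- Points below the part of the diagram in the zone `-6 < x < -5/2`. -/
def zoneDown (b : ℝ) : Set R3 := {p | (-6 < p 0 ∧ p 0 < -5 / 2) ∧
  (p 0 = -4 ∧ -16 ≤ p 1 ∧ p 1 ≤ 2 → p 2 < 0) ∧
  (p 0 = -5 ∧ -4 ≤ p 1 ∧ p 1 ≤ -1 → p 2 < 20 + 8 * p 1) ∧
  (p 1 = 2 ∧ p 0 ≤ -4 → p 2 < -16 - 4 * p 0) ∧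
  (p 1 = 8 → p 2 < 6 + 3 * p 0) ∧
  (p 1 = -1 ∧ -5 ≤ p 0 → p 2 < -8 - 4 * p 0) ∧
  (p 1 = -4 ∧ -5 ≤ p 0 → p 2 < 3 + 3 * p 0) ∧
  (p 1 = -16 ∧ p 0 ≤ -4 → p 2 < b * (-4 - p 0))}

/-- Points between the two strands at the two crossings. -/
def zoneMid : Set R3 := {p | (-9 / 2 < p 0 ∧ p 0 < -7 / 2) ∧
  ((-2 < p 1 ∧ p 1 < 0 ∧ 0 < p 2 ∧ p 2 < -8 - 4 * p 0) ∨
    (-5 < p 1 ∧ p 1 < -3 ∧ 3 + 3 * p 0 < p 2 ∧ p 2 < 0))}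

theorem isOpen_zoneUp (b : ℝ) : IsOpen (zoneUp b) := by
  refine .and (.and ?_ ?_) (.and ?_ (.and ?_ (.and ?_ (.and ?_ (.and ?_ (.and ?_ ?_))))))
  iterate 2 exact isOpen_lt (by fun_prop) (by fun_prop)
  iterate 2
    exact isOpen_imp_of_isClosed ((isClosed_eq (by fun_prop) (by fun_prop)).and
      ((isClosed_le (by fun_prop) (by fun_prop)).and (isClosed_le (by fun_prop) (by fun_prop))))
      (isOpen_lt (by fun_prop) (by fun_prop))
  · exact isOpen_imp_of_isClosed ((isClosed_eq (by fun_prop) (by fun_prop)).and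
      (isClosed_le (by fun_prop) (by fun_prop))) (isOpen_lt (by fun_prop) (by fun_prop))
  · exact isOpen_imp_of_isClosed (isClosed_eq (by fun_prop) (by fun_prop))
      (isOpen_lt (by fun_prop) (by fun_prop))
  iterate 3
    exact isOpen_imp_of_isClosed ((isClosed_eq (by fun_prop) (by fun_prop)).and
      (isClosed_le (by fun_prop) (by fun_prop))) (isOpen_lt (by fun_prop) (by fun_prop))

theorem isOpen_zoneDown (b : ℝ) : IsOpen (zoneDown b) := by
  refine .and (.and ?_ ?_) (.and ?_ (.and ?_ (.and ?_ (.and ?_ (.and ?_ (.and ?_ ?_))))))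
  iterate 2 exact isOpen_lt (by fun_prop) (by fun_prop)
  iterate 2
    exact isOpen_imp_of_isClosed ((isClosed_eq (by fun_prop) (by fun_prop)).and
      ((isClosed_le (by fun_prop) (by fun_prop)).and (isClosed_le (by fun_prop) (by fun_prop))))
      (isOpen_lt (by fun_prop) (by fun_prop))
  · exact isOpen_imp_of_isClosed ((isClosed_eq (by fun_prop) (by fun_prop)).and
      (isClosed_le (by fun_prop) (by fun_prop))) (isOpen_lt (by fun_prop) (by fun_prop))
  · exact isOpen_imp_of_isClosed (isClosed_eq (by fun_prop) (by fun_prop))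
      (isOpen_lt (by fun_prop) (by fun_prop))
  iterate 3
    exact isOpen_imp_of_isClosed ((isClosed_eq (by fun_prop) (by fun_prop)).and
      (isClosed_le (by fun_prop) (by fun_prop))) (isOpen_lt (by fun_prop) (by fun_prop))

theorem isOpen_zoneMid : IsOpen zoneMid := by
  refine .and (.and ?_ ?_) (.union (.and ?_ (.and ?_ (.and ?_ ?_)))
    (.and ?_ (.and ?_ (.and ?_ ?_)))) <;> exact isOpen_lt (by fun_prop) (by fun_prop)

/-- The colours of the regions of the plane diagram in the zone `-6 < x < -5/2`. -/
def planeColour (a₀ a₁ a₂ : G) (x y : ℝ) : G :=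
  if x < -4 then
    if y < -16 then 1 else if y ≤ -4 then a₀
    else if y ≤ -1 then (if x < -5 then a₀ else a₀ * a₂)
    else if y < 2 then a₀ else if y < 8 then a₁ else 1
  else if y ≤ -4 then 1 else if y ≤ -1 then a₂ else if y ≤ 8 then a₁ else 1

def zoneColour (a₀ a₁ a₂ : G) (p : R3) : G := planeColour a₀ a₁ a₂ (p 0) (p 1)

def zoneMidColour (a₀ a₂ : G) (p : R3) : G :=
  if p 1 < -5 / 2 then (if p 0 < -4 then a₀ else 1)
  else if p 1 ≤ -1 then a₀ * a₂ * a₀⁻¹ else 1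

theorem zoneColour_eventually {a₀ a₁ a₂ : G} {b : ℝ} {p : R3} (hu : p ∈ zoneUp b)
    (hd : p ∈ zoneDown b) :
    ∀ᶠ q in nhds p, zoneColour a₀ a₁ a₂ q = zoneColour a₀ a₁ a₂ p := by
  filter_upwards [eventually_coord (p := p) 0 (-4), eventually_coord (p := p) 0 (-5),
    eventually_coord (p := p) 1 (-16), eventually_coord (p := p) 1 (-4),
    eventually_coord (p := p) 1 (-1), eventually_coord (p := p) 1 2,
    eventually_coord (p := p) 1 8] with q h1 h2 h3 h4 h5 h6 h7
  obtain ⟨⟨hu1, hu2⟩, hu3, hu4, hu5, hu6, hu7, hu8, hu9⟩ := hu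
  obtain ⟨-, hd3, hd4, hd5, hd6, hd7, hd8, hd9⟩ := hd
  have l1 : ¬ (p 0 = -4 ∧ -16 ≤ p 1 ∧ p 1 ≤ 2) := fun h => lt_asymm (hu3 h) (hd3 h)
  have l2 : ¬ (p 0 = -5 ∧ -4 ≤ p 1 ∧ p 1 ≤ -1) := fun h => lt_asymm (hu4 h) (hd4 h)
  have l3 : ¬ (p 1 = 2 ∧ p 0 ≤ -4) := fun h => lt_asymm (hu5 h) (hd5 h)
  have l4 : ¬ (p 1 = 8) := fun h => lt_asymm (hu6 h) (hd6 h)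
  have l5 : ¬ (p 1 = -1 ∧ -5 ≤ p 0) := fun h => lt_asymm (hu7 h) (hd7 h)
  have l6 : ¬ (p 1 = -4 ∧ -5 ≤ p 0) := fun h => lt_asymm (hu8 h) (hd8 h)
  have l7 : ¬ (p 1 = -16 ∧ p 0 ≤ -4) := fun h => lt_asymm (hu9 h) (hd9 h)
  clear hu3 hu4 hu5 hu6 hu7 hu8 hu9 hd3 hd4 hd5 hd6 hd7 hd8 hd9
  unfold zoneColour planeColour
  beta_reduce at *
  generalize p 0 = x at *
  generalize p 1 = y at *
  generalize q 0 = x' at *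
  generalize q 1 = y' at *
  generalize a₀ * a₂ = c
  grind (splits := 30)

theorem zoneMidColour_eventually {a₀ a₂ : G} {b : ℝ} {p : R3} (hu : p ∈ zoneUp b)
    (hm : p ∈ zoneMid) :
    ∀ᶠ q in nhds p, zoneMidColour a₀ a₂ q = zoneMidColour a₀ a₂ p := by
  filter_upwards [eventually_coord (p := p) 0 (-4), eventually_coord (p := p) 1 (-5 / 2),
    eventually_coord (p := p) 1 (-1)] with q h1 h2 h3
  obtain ⟨⟨hu1, hu2⟩, hu3, -, -, -, hu7, -, -⟩ := hu
  obtain ⟨⟨hm1, hm2⟩, hm⟩ := hm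
  unfold zoneMidColour
  rcases hm with ⟨h4, h5, h6, h7⟩ | ⟨h4, h5, h6, h7⟩
  · have : p 1 ≠ -1 := fun h => by have := hu7 ⟨h, by linarith⟩; linarith
    beta_reduce at *
    grind
  · have : p 0 ≠ -4 := fun h => by have := hu3 ⟨h, by linarith, by linarith⟩; linarith
    beta_reduce at *
    grind

theorem zoneMidColour_inv_mul_eventually {a₀ a₁ a₂ : G} (ha : a₁ = a₀ * a₂⁻¹ * a₀⁻¹ * a₂)
    {b : ℝ} {p : R3} (hm : p ∈ zoneMid) (hd : p ∈ zoneDown b) :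
    ∀ᶠ q in nhds p, (zoneMidColour a₀ a₂ q)⁻¹ * zoneColour a₀ a₁ a₂ q =
      (zoneMidColour a₀ a₂ p)⁻¹ * zoneColour a₀ a₁ a₂ p := by
  have key : ∀ q ∈ zoneMid, (zoneMidColour a₀ a₂ q)⁻¹ * zoneColour a₀ a₁ a₂ q =
      if q 1 < -5 / 2 then (if q 1 ≤ -4 then 1 else a₂) else if q 0 < -4 then a₀ else a₁ := by
    rintro q ⟨⟨h1, h2⟩, h⟩
    have h3 : -5 < q 1 ∧ q 1 < 0 := by rcases h with h | h <;> constructor <;> linarith [h.1, h.2.1]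
    unfold zoneMidColour zoneColour planeColour
    have e1 : ¬ q 1 < -16 := by linarith [h3.1]
    have e2 : q 1 < 2 := by linarith [h3.2]
    have e3 : ¬ q 0 < -5 := by linarith
    have e4 : q 1 ≤ 8 := by linarith [h3.2]
    have e5 : q 1 ≤ -4 → q 1 < -5 / 2 := fun h => by linarith
    have e6 : q 1 < -5 / 2 → q 1 ≤ -1 := fun h => by linarith
    simp only [e1, e2, e3, e4, if_false, if_true]
    split_ifs <;> first | (exfalso; tauto) | (subst ha; group)
  filter_upwards [isOpen_zoneMid.mem_nhds hm, eventually_coord (p := p) 0 (-4),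
    eventually_coord (p := p) 1 (-5 / 2), eventually_coord (p := p) 1 (-4)] with q hq h1 h2 h3
  rw [key q hq, key p hm]
  obtain ⟨-, hd3, -, -, -, -, hd8, -⟩ := hd
  obtain ⟨⟨hm1, hm2⟩, hm⟩ := hm
  rcases hm with ⟨h4, h5, h6, h7⟩ | ⟨h4, h5, h6, h7⟩
  · have : p 0 ≠ -4 := fun h => by have := hd3 ⟨h, by linarith, by linarith⟩; linarith
    beta_reduce at *
    grind
  · have : p 1 ≠ -4 := fun h => by have := hd8 ⟨h, by linarith⟩; linarith
    beta_reduce at *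
    grind

/-- The diagram in the zone `-6 < x < -5/2`. -/
def zone (a₀ a₁ a₂ : G) (ha : a₁ = a₀ * a₂⁻¹ * a₀⁻¹ * a₂) (b : ℝ) :
    PotentialAtlas R3 (Fin 3) G :=
  .ofDiagram (zoneUp b) zoneMid (zoneDown b) (isOpen_zoneUp b) isOpen_zoneMid (isOpen_zoneDown b)
    (zoneColour a₀ a₁ a₂) (zoneMidColour a₀ a₂)
    (fun _ hu hd => zoneColour_eventually hu hd)
    (fun _ hu hm => zoneMidColour_eventually hu hm)
    (fun _ hm hd => zoneMidColour_inv_mul_eventually ha hm hd)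

theorem mem_dom_zone_bounds {a₀ a₁ a₂ : G} {ha} {b : ℝ} {p : R3}
    (hp : p ∈ (zone a₀ a₁ a₂ ha b).dom) : -6 < p 0 ∧ p 0 < -5 / 2 := by
  rcases PotentialAtlas.mem_dom_ofDiagram.1 hp with h | h | h
  · exact h.1
  · exact ⟨by linarith [h.1.1], by linarith [h.1.2]⟩
  · exact h.1

/-- The part of the core of the leg lying in the zone `-6 < x < -5/2`. -/
def zoneCore (b : ℝ) : Set R3 := {p | (p 0 = -4 ∧ -16 ≤ p 1 ∧ p 1 ≤ 2 ∧ p 2 = 0) ∨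
  (p 0 = -5 ∧ -4 ≤ p 1 ∧ p 1 ≤ -1 ∧ p 2 = 20 + 8 * p 1) ∨
  (p 1 = 2 ∧ p 0 ≤ -4 ∧ p 2 = -16 - 4 * p 0) ∨
  (p 1 = 8 ∧ p 2 = 6 + 3 * p 0) ∨
  (p 1 = -1 ∧ -5 ≤ p 0 ∧ p 2 = -8 - 4 * p 0) ∨
  (p 1 = -4 ∧ -5 ≤ p 0 ∧ p 2 = 3 + 3 * p 0) ∨
  (p 1 = -16 ∧ p 0 ≤ -4 ∧ p 2 = b * (-4 - p 0))}

set_option maxHeartbeats 1000000 in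
theorem mem_zoneCore_of_notMem_dom {a₀ a₁ a₂ : G} {ha} {b : ℝ} {p : R3} (h1 : -6 < p 0)
    (h2 : p 0 < -5 / 2) (hp : p ∉ (zone a₀ a₁ a₂ ha b).dom) : p ∈ zoneCore b := by
  rw [zone, PotentialAtlas.mem_dom_ofDiagram, not_or, not_or] at hp
  obtain ⟨hu, hm, hd⟩ := hp
  simp only [zoneUp, zoneDown, zoneMid, zoneCore, mem_ofPred_eq] at *
  beta_reduce at *
  generalize p 0 = x at *
  generalize p 1 = y at *
  generalize p 2 = z at *
  have hc : x = -4 → b * (-4 - x) = 0 := by rintro rfl; norm_num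
  generalize b * (-4 - x) = c at *
  have hy : y = 2 ∨ y = 8 ∨ y = -1 ∨ y = -4 ∨ y = -16 ∨
      (y ≠ 2 ∧ y ≠ 8 ∧ y ≠ -1 ∧ y ≠ -4 ∧ y ≠ -16) := by clear * -; tauto
  have hx : x = -4 ∨ x = -5 ∨ (x ≠ -4 ∧ x ≠ -5) := by clear * -; tauto
  rcases hx with rfl | rfl | ⟨hx1, hx2⟩ <;>
    rcases hy with rfl | rfl | rfl | rfl | rfl | ⟨hy1, hy2, hy3, hy4, hy5⟩ <;>
    grind (splits := 30)

def unflip : C(R3, R3) := ⟨fun p => !₂[2 * p 0, -2 * p 1, 2 * p 2], by fun_prop⟩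

@[simp] theorem unflip_zero (p : R3) : unflip p 0 = 2 * p 0 := rfl
@[simp] theorem unflip_one (p : R3) : unflip p 1 = -2 * p 1 := rfl
@[simp] theorem unflip_two (p : R3) : unflip p 2 = 2 * p 2 := rfl

def unflipPow (n : ℕ) : C(R3, R3) := ⟨unflip^[n], unflip.continuous.iterate n⟩

theorem unflipPow_succ (n : ℕ) : unflipPow (n + 1) = unflip.comp (unflipPow n) := by
  ext1 p
  exact Function.iterate_succ_apply' unflip n p

theorem unflipPow_succ_apply (n : ℕ) (p : R3) : unflipPow (n + 1) p = unflip (unflipPow n p) := by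
  rw [unflipPow_succ]; rfl

theorem unflipPow_zero (n : ℕ) (p : R3) : unflipPow n p 0 = 2 ^ n * p 0 := by
  induction n with
  | zero => simp [unflipPow]
  | succ n ih => rw [unflipPow_succ_apply, unflip_zero, ih]; ring

theorem abs_unflipPow_one (n : ℕ) (p : R3) : |unflipPow n p 1| = 2 ^ n * |p 1| := by
  induction n with
  | zero => simp [unflipPow]
  | succ n ih => rw [unflipPow_succ_apply, unflip_one, abs_mul, ih]; norm_num; ring

theorem unflipPow_two (n : ℕ) (p : R3) : unflipPow n p 2 = 2 ^ n * p 2 := by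
  induction n with
  | zero => simp [unflipPow]
  | succ n ih => rw [unflipPow_succ_apply, unflip_two, ih]; ring

theorem planeColour_unflip (a₀ a₁ a₂ a₃ : G) {x : ℝ} (y : ℝ) (h1 : -3 < x) (h2 : x < -5 / 2) :
    planeColour a₀ a₁ a₂ x y = planeColour a₁ a₂ a₃ (2 * x) (-2 * y) := by
  have h3 : ¬ x < -4 := by linarith
  have h4 : 2 * x < -4 := by linarith
  have h5 : 2 * x < -5 := by linarith
  simp only [planeColour, h3, h4, h5, if_true, if_false]
  split_ifs <;> first | rfl | (exfalso; linarith)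

theorem zoneColour_unflip (a₀ a₁ a₂ a₃ : G) {p : R3} (h1 : -3 < p 0) (h2 : p 0 < -5 / 2) :
    zoneColour a₀ a₁ a₂ p = zoneColour a₁ a₂ a₃ (unflip p) :=
  planeColour_unflip a₀ a₁ a₂ a₃ (p 1) h1 h2

theorem zone_refines {a₀ a₁ a₂ a₃ : G} {ha ha'} {b : ℝ} :
    (zone a₀ a₁ a₂ ha b).Refines ((zone a₁ a₂ a₃ ha' (-3)).comap unflip) := by
  intro a p hp hpQ
  rw [PotentialAtlas.dom_comap, mem_preimage] at hpQ
  have h1 : -3 < p 0 := by have := (mem_dom_zone_bounds hpQ).1; rw [unflip_zero] at this; linarith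
  have h2 : p 0 < -5 / 2 := (mem_dom_zone_bounds (mem_iUnion_of_mem a hp)).2
  fin_cases a
  · refine ⟨?_, by simp [zone, PotentialAtlas.ofDiagram, PotentialAtlas.comap]⟩
    obtain ⟨-, -, -, -, hp6, hp7, hp8, -⟩ := (show p ∈ zoneUp b from hp)
    change unflip p ∈ zoneUp (-3)
    simp only [zoneUp, mem_ofPred_eq, unflip_zero, unflip_one, unflip_two]
    refine ⟨⟨by linarith, by linarith⟩, fun h => ?_, fun h => ?_, fun h => ?_, fun h => ?_,
      fun h => ?_, fun h => ?_, fun h => ?_⟩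
    · linarith [h.1]
    · linarith [h.1]
    · linarith [hp7 ⟨by linarith [h.1], by linarith⟩]
    · linarith [hp8 ⟨by linarith, by linarith⟩]
    · linarith [h.2]
    · linarith [h.2]
    · linarith [hp6 (by linarith [h.1])]
  · exfalso
    have := (show p ∈ zoneMid from hp).1.2
    linarith
  · refine ⟨?_, ?_⟩
    · obtain ⟨-, -, -, -, hp6, hp7, hp8, -⟩ := (show p ∈ zoneDown b from hp)
      change unflip p ∈ zoneDown (-3)
      simp only [zoneDown, mem_ofPred_eq, unflip_zero, unflip_one, unflip_two]
      refine ⟨⟨by linarith, by linarith⟩, fun h => ?_, fun h => ?_, fun h => ?_, fun h => ?_,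
        fun h => ?_, fun h => ?_, fun h => ?_⟩
      · linarith [h.1]
      · linarith [h.1]
      · linarith [hp7 ⟨by linarith [h.1], by linarith⟩]
      · linarith [hp8 ⟨by linarith, by linarith⟩]
      · linarith [h.2]
      · linarith [h.2]
      · linarith [hp6 (by linarith [h.1])]
    · have hc : ContinuousAt (fun q : R3 => q 0) p := by fun_prop
      filter_upwards [hc.eventually (Ioo_mem_nhds h1 h2)] with q hq
      exact zoneColour_unflip a₀ a₁ a₂ a₃ hq.1 hq.2

/-- The data colouring the diagram of a leg. -/
structure Colouring (G : Type*) [Group G] where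
  a : ℕ → G
  rel : ∀ n, a (n + 1) = a n * (a (n + 2))⁻¹ * (a n)⁻¹ * a (n + 2)

def slope (b : ℝ) (n : ℕ) : ℝ := if n = 0 then b else -3

namespace Colouring

variable (A : Colouring G) (b : ℝ)

def zone (n : ℕ) : PotentialAtlas R3 (Fin 3) G :=
  (WildLeg.zone (A.a n) (A.a (n + 1)) (A.a (n + 2)) (A.rel n) (slope b n)).comap (unflipPow n)

theorem bounds_of_mem_dom_zone {n : ℕ} {p : R3} (hp : p ∈ (A.zone b n).dom) :
    -6 < 2 ^ n * p 0 ∧ 2 ^ n * p 0 < -5 / 2 := by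
  rw [zone, PotentialAtlas.dom_comap] at hp
  simpa only [unflipPow_zero] using mem_dom_zone_bounds hp

theorem zone_refines_succ (n : ℕ) : (A.zone b n).Refines (A.zone b (n + 1)) := by
  have : slope b (n + 1) = -3 := by simp [slope]
  unfold zone
  rw [unflipPow_succ, this]
  exact (zone_refines (ha' := A.rel (n + 1))).comap (unflipPow n)

theorem pow_bounds_eq_or {n m : ℕ} {x : ℝ} (hnm : n ≤ m) (hn : 2 ^ n * x < -5 / 2)
    (hm : -6 < 2 ^ m * x) : m = n ∨ m = n + 1 := by
  obtain ⟨k, rfl⟩ := Nat.exists_eq_add_of_le hnm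
  rcases k with - | - | k
  · simp
  · simp
  · exfalso
    have : (1 : ℝ) ≤ 2 ^ k := one_le_pow₀ (by norm_num)
    have h : (2 : ℝ) ^ (n + (k + 2)) * x = 4 * 2 ^ k * (2 ^ n * x) := by ring
    nlinarith

theorem zone_refines_or {n m : ℕ} (hnm : n < m) : (A.zone b n).Refines (A.zone b m) := by
  by_cases h : m = n + 1
  · subst h; exact A.zone_refines_succ b n
  · refine PotentialAtlas.refines_of_disjoint (disjoint_left.2 fun p hp hp' => ?_)
    have := pow_bounds_eq_or hnm.le (A.bounds_of_mem_dom_zone b hp).2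
      (A.bounds_of_mem_dom_zone b hp').1
    omega

open Classical in
/-- The colours of the lowest chart of all zones together. -/
def colour (p : R3) : G :=
  if h : ∃ n : ℕ, -6 < 2 ^ n * p 0 ∧ 2 ^ n * p 0 < -5 / 2 then
    zoneColour (A.a (Nat.find h)) (A.a (Nat.find h + 1)) (A.a (Nat.find h + 2))
      (unflipPow (Nat.find h) p)
  else 1

theorem colour_eq {n : ℕ} {p : R3} (h1 : -6 < 2 ^ n * p 0) (h2 : 2 ^ n * p 0 < -5 / 2) :
    A.colour p = zoneColour (A.a n) (A.a (n + 1)) (A.a (n + 2)) (unflipPow n p) := by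
  classical
  have h : ∃ n : ℕ, -6 < 2 ^ n * p 0 ∧ 2 ^ n * p 0 < -5 / 2 := ⟨n, h1, h2⟩
  rw [colour, dif_pos h]
  have hf := Nat.find_spec h
  rcases pow_bounds_eq_or (Nat.find_min' h ⟨h1, h2⟩) hf.2 h1 with e | e
  · rw [← e]
  · generalize Nat.find h = m at *
    subst e
    rw [unflipPow_succ_apply]
    apply zoneColour_unflip <;> rw [unflipPow_zero]
    · rw [pow_succ] at h1; linarith
    · exact hf.2

theorem colour_eq_one {p : R3} (hp : 0 < p 0 ∨ 8 * |p 0| < |p 1|) : A.colour p = 1 := by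
  by_cases h : ∃ n : ℕ, -6 < 2 ^ n * p 0 ∧ 2 ^ n * p 0 < -5 / 2
  · obtain ⟨n, h1, h2⟩ := h
    have hpos : (0 : ℝ) < 2 ^ n := by positivity
    have h0 : p 0 < 0 := by
      by_contra! h
      linarith [mul_nonneg hpos.le h]
    rw [abs_of_neg h0] at hp
    have h3 : 20 < |unflipPow n p 1| := by
      rw [abs_unflipPow_one]
      rcases hp with hp | hp
      · linarith
      · linarith [mul_lt_mul_of_pos_left hp hpos]
    rw [A.colour_eq h1 h2, zoneColour, planeColour]
    rcases lt_abs.1 h3 with h3 | h3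
    all_goals split_ifs <;> first | rfl | (exfalso; linarith)
  · rw [colour, dif_neg h]

def tipUp : Set R3 := {p | -1 < p 0 ∧ (0 < p 0 ∨ 8 * |p 0| < |p 1| ∨ 8 * |p 0| < p 2)}
def tipDown : Set R3 := {p | -1 < p 0 ∧ (0 < p 0 ∨ 8 * |p 0| < |p 1| ∨ p 2 < -(8 * |p 0|))}

theorem isOpen_tipUp : IsOpen tipUp := by
  change IsOpen ({p : R3 | -1 < p 0} ∩ ({p : R3 | 0 < p 0} ∪
    ({p : R3 | 8 * |p 0| < |p 1|} ∪ {p : R3 | 8 * |p 0| < p 2})))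
  refine (isOpen_lt ?_ ?_).inter ((isOpen_lt ?_ ?_).union ((isOpen_lt ?_ ?_).union (isOpen_lt ?_ ?_)))
  all_goals fun_prop

theorem isOpen_tipDown : IsOpen tipDown := by
  change IsOpen ({p : R3 | -1 < p 0} ∩ ({p : R3 | 0 < p 0} ∪
    ({p : R3 | 8 * |p 0| < |p 1|} ∪ {p : R3 | p 2 < -(8 * |p 0|)})))
  refine (isOpen_lt ?_ ?_).inter ((isOpen_lt ?_ ?_).union ((isOpen_lt ?_ ?_).union (isOpen_lt ?_ ?_)))
  all_goals fun_prop

def tip : PotentialAtlas R3 (Fin 3) G :=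
  .ofDiagram tipUp ∅ tipDown isOpen_tipUp isOpen_empty isOpen_tipDown A.colour 1
    (by
      rintro p ⟨-, hu⟩ ⟨-, hd⟩
      have hp : 0 < p 0 ∨ 8 * |p 0| < |p 1| := by
        have := abs_nonneg (p 0)
        rcases hu with h | h | h
        · exact .inl h
        · exact .inr h
        rcases hd with h' | h' | h'
        · exact .inl h'
        · exact .inr h'
        linarith
      have ho : IsOpen ({p : R3 | 0 < p 0} ∪ {p : R3 | 8 * |p 0| < |p 1|}) := by
        refine (isOpen_lt ?_ ?_).union (isOpen_lt ?_ ?_) <;> fun_prop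
      filter_upwards [ho.mem_nhds hp] with q hq
      rw [A.colour_eq_one hp, A.colour_eq_one hq])
    (by simp) (by simp)

theorem mem_dom_tip {p : R3} : p ∈ A.tip.dom ↔ p ∈ tipUp ∨ p ∈ tipDown := by
  simp [tip, PotentialAtlas.mem_dom_ofDiagram]

theorem bounds_of_mem_dom_tip {p : R3} (hp : p ∈ A.tip.dom) : -1 < p 0 := by
  rcases A.mem_dom_tip.1 hp with h | h <;> exact h.1

theorem eq_zero_of_notMem_dom_tip {p : R3} (hp : p ∉ A.tip.dom) (h0 : 0 ≤ p 0) : p = 0 := by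
  rw [mem_dom_tip, not_or, tipUp, tipDown] at hp
  simp only [mem_ofPred_eq, not_and, not_or, not_lt] at hp
  obtain ⟨h1, h2, h3⟩ := hp.1 (by linarith)
  obtain ⟨-, -, h4⟩ := hp.2 (by linarith)
  have h5 : p 0 = 0 := le_antisymm h1 h0
  rw [h5, abs_zero, mul_zero] at h2 h3 h4
  ext i
  fin_cases i
  · exact h5
  · exact abs_eq_zero.1 (le_antisymm h2 (abs_nonneg _))
  · exact le_antisymm h3 (by simpa using h4)

theorem tip_refines_zone (n : ℕ) : A.tip.Refines (A.zone b n) := by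
  intro a p hp hpQ
  have hb := A.bounds_of_mem_dom_zone b hpQ
  have h0 := A.bounds_of_mem_dom_tip (mem_iUnion_of_mem a hp)
  have hpos : (0 : ℝ) < 2 ^ n := by positivity
  have hn : slope b n = -3 := by
    rcases n with - | n
    · linarith [hb.2]
    · simp [slope]
  have hneg : p 0 < 0 := by
    by_contra! h
    linarith [mul_nonneg hpos.le h, hb.2]
  have e0 := unflipPow_zero n p
  have e1 := abs_unflipPow_one n p
  have e2 := unflipPow_two n p
  have hy : 8 * |p 0| < |p 1| → 20 < |unflipPow n p 1| := by
    intro h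
    rw [abs_of_neg hneg] at h
    linarith [mul_lt_mul_of_pos_left h hpos, hb.2]
  have hy' : 20 < |unflipPow n p 1| →
      unflipPow n p 1 < -16 ∨ 8 < unflipPow n p 1 := by
    intro h
    rcases lt_abs.1 h with h | h
    · right; linarith
    · left; linarith
  rw [← e0] at hb
  fin_cases a
  · refine ⟨?_, by simp [tip, zone, WildLeg.zone, PotentialAtlas.ofDiagram, PotentialAtlas.comap]⟩
    change unflipPow n p ∈ zoneUp (slope b n)
    obtain ⟨-, h⟩ : p ∈ tipUp := hp
    have h : 20 < |unflipPow n p 1| ∨ -8 * unflipPow n p 0 < unflipPow n p 2 := by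
      rcases h with h | h | h
      · linarith
      · exact .inl (hy h)
      · right
        rw [abs_of_neg hneg] at h
        linarith [mul_lt_mul_of_pos_left h hpos]
    rw [hn]
    simp only [zoneUp, mem_ofPred_eq]
    clear e0 e1 e2 hy
    beta_reduce at *
    generalize unflipPow n p 0 = x at *
    generalize unflipPow n p 1 = y at *
    generalize unflipPow n p 2 = z at *
    rcases h with h | h
    · have := hy' h
      clear hy' h
      grind
    · grind
  · exact absurd hp (notMem_empty p)
  · constructor
    · change unflipPow n p ∈ zoneDown (slope b n)
      obtain ⟨-, h⟩ : p ∈ tipDown := hp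
      have h : 20 < |unflipPow n p 1| ∨ unflipPow n p 2 < 8 * unflipPow n p 0 := by
        rcases h with h | h | h
        · linarith
        · exact .inl (hy h)
        · right
          rw [abs_of_neg hneg] at h
          linarith [mul_lt_mul_of_pos_left h hpos]
      rw [hn]
      simp only [zoneDown, mem_ofPred_eq]
      clear e0 e1 e2 hy
      beta_reduce at *
      generalize unflipPow n p 0 = x at *
      generalize unflipPow n p 1 = y at *
      generalize unflipPow n p 2 = z at *
      rcases h with h | h
      · have := hy' h
        grind
      · grind
    · have hc : ContinuousAt (fun q : R3 => 2 ^ n * q 0) p := by fun_prop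
      rw [e0] at hb
      filter_upwards [hc.eventually (Ioo_mem_nhds hb.1 hb.2)] with q hq
      exact A.colour_eq hq.1 hq.2

end Colouring

/-- The polygonal core of a leg. -/
def legCore (b : ℝ) : Set R3 := {p | p = 0 ∨ ∃ n : ℕ, -6 < 2 ^ n * p 0 ∧ 2 ^ n * p 0 < -5 / 2 ∧
  unflipPow n p ∈ zoneCore (slope b n)}

theorem exists_pow_mul_mem {x : ℝ} (h1 : -6 < x) (h2 : x < 0) :
    ∃ n : ℕ, -6 < 2 ^ n * x ∧ 2 ^ n * x < -5 / 2 := by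
  classical
  have h : ∃ n : ℕ, 2 ^ n * x < -5 / 2 := by
    obtain ⟨n, hn⟩ := pow_unbounded_of_one_lt (5 / 2 / (-x)) (one_lt_two : (1 : ℝ) < 2)
    refine ⟨n, ?_⟩
    rw [div_lt_iff₀ (by linarith)] at hn
    linarith
  refine ⟨Nat.find h, ?_, Nat.find_spec h⟩
  rcases hk : Nat.find h with - | k
  · simpa using h1
  · have := Nat.find_min h (m := k) (by omega)
    rw [pow_succ]
    linarith

theorem mem_legCore_of_notMem_dom (A : Colouring G) {b : ℝ} {p : R3} (h6 : -6 < p 0)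
    (ht : p ∉ A.tip.dom) (hz : ∀ n, p ∉ (A.zone b n).dom) : p ∈ legCore b := by
  rcases le_or_gt 0 (p 0) with h | h
  · exact .inl (A.eq_zero_of_notMem_dom_tip ht h)
  · obtain ⟨n, h1, h2⟩ := exists_pow_mul_mem h6 h
    have := hz n
    rw [Colouring.zone, PotentialAtlas.dom_comap, mem_preimage] at this
    rw [← unflipPow_zero] at h1 h2
    refine .inr ⟨n, ?_, ?_, mem_zoneCore_of_notMem_dom h1 h2 this⟩ <;> rwa [← unflipPow_zero]

/-- Points above the part of the diagram with `-4 < x < 4`. -/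
def centreUp : Set R3 := {p | (-4 < p 0 ∧ p 0 < 4) ∧
  (p 1 = 0 → 6 * (p 0 + 5) / 5 < p 2) ∧
  (p 1 = 18 ∧ -1 ≤ p 0 → 32 - 4 * p 0 < p 2) ∧
  (p 0 = -1 ∧ 18 ≤ p 1 ∧ p 1 ≤ 24 → 36 - 8 * (p 1 - 18) < p 2) ∧
  (p 1 = 24 ∧ -1 ≤ p 0 → 3 * p 0 - 9 < p 2) ∧
  (p 1 = 21 ∧ p 0 ≤ 1 → 10 + 2 * p 0 < p 2) ∧
  (p 0 = 1 ∧ 21 ≤ p 1 ∧ p 1 ≤ 28 → 84 - 24 * p 1 / 7 < p 2) ∧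
  (p 1 = 28 ∧ p 0 ≤ 1 → -(3 / 2) * (p 0 + 7) < p 2)}

/-- Points below the part of the diagram with `-4 < x < 4`. -/
def centreDown : Set R3 := {p | (-4 < p 0 ∧ p 0 < 4) ∧
  (p 1 = 0 → p 2 < 6 * (p 0 + 5) / 5) ∧
  (p 1 = 18 ∧ -1 ≤ p 0 → p 2 < 32 - 4 * p 0) ∧
  (p 0 = -1 ∧ 18 ≤ p 1 ∧ p 1 ≤ 24 → p 2 < 36 - 8 * (p 1 - 18)) ∧
  (p 1 = 24 ∧ -1 ≤ p 0 → p 2 < 3 * p 0 - 9) ∧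
  (p 1 = 21 ∧ p 0 ≤ 1 → p 2 < 10 + 2 * p 0) ∧
  (p 0 = 1 ∧ 21 ≤ p 1 ∧ p 1 ≤ 28 → p 2 < 84 - 24 * p 1 / 7) ∧
  (p 1 = 28 ∧ p 0 ≤ 1 → p 2 < -(3 / 2) * (p 0 + 7))}

def centreMid : Set R3 := {p |
  ((-3 / 2 < p 0 ∧ p 0 < -1 / 2) ∧ (20 < p 1 ∧ p 1 < 22) ∧
    (10 + 2 * p 0 < p 2 ∧ p 2 < 36 - 8 * (p 1 - 18))) ∨
  ((1 / 2 < p 0 ∧ p 0 < 3 / 2) ∧ (23 < p 1 ∧ p 1 < 25) ∧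
    (3 * p 0 - 9 < p 2 ∧ p 2 < 84 - 24 * p 1 / 7))}

theorem isOpen_centreUp : IsOpen centreUp := by
  refine .and (.and (isOpen_lt ?_ ?_) (isOpen_lt ?_ ?_)) (.and
    (isOpen_imp_of_isClosed (isClosed_eq ?_ ?_) (isOpen_lt ?_ ?_)) (.and
    (isOpen_imp_of_isClosed (.and (isClosed_eq ?_ ?_) (isClosed_le ?_ ?_)) (isOpen_lt ?_ ?_)) (.and
    (isOpen_imp_of_isClosed (.and (isClosed_eq ?_ ?_) (.and (isClosed_le ?_ ?_) (isClosed_le ?_ ?_)))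
      (isOpen_lt ?_ ?_)) (.and
    (isOpen_imp_of_isClosed (.and (isClosed_eq ?_ ?_) (isClosed_le ?_ ?_)) (isOpen_lt ?_ ?_)) (.and
    (isOpen_imp_of_isClosed (.and (isClosed_eq ?_ ?_) (isClosed_le ?_ ?_)) (isOpen_lt ?_ ?_)) (.and
    (isOpen_imp_of_isClosed (.and (isClosed_eq ?_ ?_) (.and (isClosed_le ?_ ?_) (isClosed_le ?_ ?_)))
      (isOpen_lt ?_ ?_))
    (isOpen_imp_of_isClosed (.and (isClosed_eq ?_ ?_) (isClosed_le ?_ ?_))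
      (isOpen_lt ?_ ?_))))))))
  all_goals fun_prop

theorem isOpen_centreDown : IsOpen centreDown := by
  refine .and (.and (isOpen_lt ?_ ?_) (isOpen_lt ?_ ?_)) (.and
    (isOpen_imp_of_isClosed (isClosed_eq ?_ ?_) (isOpen_lt ?_ ?_)) (.and
    (isOpen_imp_of_isClosed (.and (isClosed_eq ?_ ?_) (isClosed_le ?_ ?_)) (isOpen_lt ?_ ?_)) (.and
    (isOpen_imp_of_isClosed (.and (isClosed_eq ?_ ?_) (.and (isClosed_le ?_ ?_) (isClosed_le ?_ ?_)))
      (isOpen_lt ?_ ?_)) (.and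
    (isOpen_imp_of_isClosed (.and (isClosed_eq ?_ ?_) (isClosed_le ?_ ?_)) (isOpen_lt ?_ ?_)) (.and
    (isOpen_imp_of_isClosed (.and (isClosed_eq ?_ ?_) (isClosed_le ?_ ?_)) (isOpen_lt ?_ ?_)) (.and
    (isOpen_imp_of_isClosed (.and (isClosed_eq ?_ ?_) (.and (isClosed_le ?_ ?_) (isClosed_le ?_ ?_)))
      (isOpen_lt ?_ ?_))
    (isOpen_imp_of_isClosed (.and (isClosed_eq ?_ ?_) (isClosed_le ?_ ?_))
      (isOpen_lt ?_ ?_))))))))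
  all_goals fun_prop

theorem isOpen_centreMid : IsOpen centreMid := by
  refine .union (.and (.and ?_ ?_) (.and (.and ?_ ?_) (.and ?_ ?_)))
    (.and (.and ?_ ?_) (.and (.and ?_ ?_) (.and ?_ ?_))) <;>
    exact isOpen_lt (by fun_prop) (by fun_prop)

/-- The colours of the regions of the plane diagram for `-4 < x < 4`. -/
def centrePlaneColour (e X Y : G) (x y : ℝ) : G :=
  if x < -1 then if y < 0 then 1 else if y < 21 then e else if y < 28 then Y else 1
  else if x < 1 then
    if y < 0 then 1 else if y < 18 then e else if y < 21 then X else if y < 24 then Y * X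
    else if y < 28 then Y else 1
  else if y < 0 then 1 else if y < 18 then e else if y < 24 then X else 1

def centreColour (e X Y : G) (p : R3) : G := centrePlaneColour e X Y (p 0) (p 1)

def centreMidColour (X Y : G) (p : R3) : G :=
  if p 0 < 0 then if p 0 < -1 then Y * X⁻¹ * Y⁻¹ else 1 else if p 0 < 1 then Y else 1

theorem centreColour_eventually {e X Y : G} {p : R3} (hu : p ∈ centreUp) (hd : p ∈ centreDown) :
    ∀ᶠ q in nhds p, centreColour e X Y q = centreColour e X Y p := by
  filter_upwards [eventually_coord (p := p) 0 (-1), eventually_coord (p := p) 0 1,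
    eventually_coord (p := p) 1 0, eventually_coord (p := p) 1 18,
    eventually_coord (p := p) 1 21, eventually_coord (p := p) 1 24,
    eventually_coord (p := p) 1 28] with q h1 h2 h3 h4 h5 h6 h7
  obtain ⟨⟨hu1, hu2⟩, hu3, hu4, hu5, hu6, hu7, hu8, hu9⟩ := hu
  obtain ⟨-, hd3, hd4, hd5, hd6, hd7, hd8, hd9⟩ := hd
  have l1 : ¬ (p 1 = 0) := fun h => lt_asymm (hu3 h) (hd3 h)
  have l2 : ¬ (p 1 = 18 ∧ -1 ≤ p 0) := fun h => lt_asymm (hu4 h) (hd4 h)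
  have l3 : ¬ (p 0 = -1 ∧ 18 ≤ p 1 ∧ p 1 ≤ 24) := fun h => lt_asymm (hu5 h) (hd5 h)
  have l4 : ¬ (p 1 = 24 ∧ -1 ≤ p 0) := fun h => lt_asymm (hu6 h) (hd6 h)
  have l5 : ¬ (p 1 = 21 ∧ p 0 ≤ 1) := fun h => lt_asymm (hu7 h) (hd7 h)
  have l6 : ¬ (p 0 = 1 ∧ 21 ≤ p 1 ∧ p 1 ≤ 28) := fun h => lt_asymm (hu8 h) (hd8 h)
  have l7 : ¬ (p 1 = 28 ∧ p 0 ≤ 1) := fun h => lt_asymm (hu9 h) (hd9 h)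
  clear hu3 hu4 hu5 hu6 hu7 hu8 hu9 hd3 hd4 hd5 hd6 hd7 hd8 hd9
  unfold centreColour centrePlaneColour
  beta_reduce at *
  generalize p 0 = x at *
  generalize p 1 = y at *
  generalize q 0 = x' at *
  generalize q 1 = y' at *
  generalize Y * X = c
  grind (splits := 30)

theorem centreMidColour_eventually {X Y : G} {p : R3} (hu : p ∈ centreUp) (hm : p ∈ centreMid) :
    ∀ᶠ q in nhds p, centreMidColour X Y q = centreMidColour X Y p := by
  filter_upwards [eventually_coord (p := p) 0 (-1), eventually_coord (p := p) 0 0,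
    eventually_coord (p := p) 0 1] with q h1 h2 h3
  obtain ⟨⟨hu1, hu2⟩, -, -, hu5, -, -, hu8, -⟩ := hu
  unfold centreMidColour
  rcases hm with ⟨⟨h4, h5⟩, ⟨h6, h7⟩, h8, h9⟩ | ⟨⟨h4, h5⟩, ⟨h6, h7⟩, h8, h9⟩
  · have : p 0 ≠ -1 := fun h => by have := hu5 ⟨h, by linarith, by linarith⟩; linarith
    beta_reduce at *
    grind
  · have : p 0 ≠ 1 := fun h => by have := hu8 ⟨h, by linarith, by linarith⟩; linarith
    beta_reduce at *
    grind

theorem centreMidColour_inv_mul_eventually {e X Y : G} (he : e = Y * X⁻¹ * Y⁻¹ * X) {p : R3}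
    (hm : p ∈ centreMid) (hd : p ∈ centreDown) :
    ∀ᶠ q in nhds p, (centreMidColour X Y q)⁻¹ * centreColour e X Y q =
      (centreMidColour X Y p)⁻¹ * centreColour e X Y p := by
  have key' : ∀ x y : ℝ, ((-3 / 2 < x ∧ x < -1 / 2) ∧ 20 < y ∧ y < 22) ∨
      ((1 / 2 < x ∧ x < 3 / 2) ∧ 23 < y ∧ y < 25) →
      (if x < 0 then if x < -1 then Y * X⁻¹ * Y⁻¹ else 1 else if x < 1 then Y else 1)⁻¹ *
        centrePlaneColour e X Y x y =
      if y < 21 then X else if y < 45 / 2 then Y * X else if y < 24 then X else 1 := by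
    intro x y hq
    unfold centrePlaneColour
    rcases hq with ⟨⟨h4, h5⟩, h6, h7⟩ | ⟨⟨h4, h5⟩, h6, h7⟩
    · rw [if_pos (by linarith : x < 0), if_pos (by linarith : x < 1)]
      split_ifs <;> first | (exfalso; linarith) | (subst he; group)
    · rw [if_neg (by linarith : ¬ x < 0), if_neg (by linarith : ¬ x < -1)]
      split_ifs <;> first | (exfalso; linarith) | (subst he; group)
  have key : ∀ q ∈ centreMid, (centreMidColour X Y q)⁻¹ * centreColour e X Y q =
      if q 1 < 21 then X else if q 1 < 45 / 2 then Y * X else if q 1 < 24 then X else 1 :=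
    fun q hq => key' (q 0) (q 1) (hq.imp (fun h => ⟨h.1, h.2.1⟩) fun h => ⟨h.1, h.2.1⟩)
  filter_upwards [isOpen_centreMid.mem_nhds hm, eventually_coord (p := p) 1 21,
    eventually_coord (p := p) 1 (45 / 2), eventually_coord (p := p) 1 24] with q hq h1 h2 h3
  rw [key q hq, key p hm]
  obtain ⟨-, -, -, -, hd6, hd7, -, -⟩ := hd
  rcases hm with ⟨⟨h4, h5⟩, ⟨h6, h7⟩, h8, h9⟩ | ⟨⟨h4, h5⟩, ⟨h6, h7⟩, h8, h9⟩
  · have : p 1 ≠ 21 := fun h => by have := hd7 ⟨h, by linarith⟩; linarith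
    beta_reduce at *
    grind
  · have : p 1 ≠ 24 := fun h => by have := hd6 ⟨h, by linarith⟩; linarith
    beta_reduce at *
    grind

/-- The diagram of the middle part, where the two legs clasp. -/
def centre (e X Y : G) (he : e = Y * X⁻¹ * Y⁻¹ * X) : PotentialAtlas R3 (Fin 3) G :=
  .ofDiagram centreUp centreMid centreDown isOpen_centreUp isOpen_centreMid isOpen_centreDown
    (centreColour e X Y) (centreMidColour X Y)
    (fun _ hu hd => centreColour_eventually hu hd)
    (fun _ hu hm => centreMidColour_eventually hu hm)
    (fun _ hm hd => centreMidColour_inv_mul_eventually he hm hd)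

theorem bounds_of_mem_dom_centre {e X Y : G} {he} {p : R3} (hp : p ∈ (centre e X Y he).dom) :
    -4 < p 0 ∧ p 0 < 4 := by
  rcases PotentialAtlas.mem_dom_ofDiagram.1 hp with h | (⟨h, -⟩ | ⟨h, -⟩) | h
  · exact h.1
  · constructor <;> linarith [h.1, h.2]
  · constructor <;> linarith [h.1, h.2]
  · exact h.1

def centreCore : Set R3 := {p | (p 1 = 0 ∧ p 2 = 6 * (p 0 + 5) / 5) ∨
  (p 1 = 18 ∧ -1 ≤ p 0 ∧ p 2 = 32 - 4 * p 0) ∨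
  (p 0 = -1 ∧ 18 ≤ p 1 ∧ p 1 ≤ 24 ∧ p 2 = 36 - 8 * (p 1 - 18)) ∨
  (p 1 = 24 ∧ -1 ≤ p 0 ∧ p 2 = 3 * p 0 - 9) ∨
  (p 1 = 21 ∧ p 0 ≤ 1 ∧ p 2 = 10 + 2 * p 0) ∨
  (p 0 = 1 ∧ 21 ≤ p 1 ∧ p 1 ≤ 28 ∧ p 2 = 84 - 24 * p 1 / 7) ∨
  (p 1 = 28 ∧ p 0 ≤ 1 ∧ p 2 = -(3 / 2) * (p 0 + 7))}

set_option maxHeartbeats 1000000 in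
theorem mem_centreCore_of_notMem_dom {e X Y : G} {he} {p : R3} (h1 : -4 < p 0) (h2 : p 0 < 4)
    (hp : p ∉ (centre e X Y he).dom) : p ∈ centreCore := by
  rw [centre, PotentialAtlas.mem_dom_ofDiagram, not_or, not_or] at hp
  obtain ⟨hu, hm, hd⟩ := hp
  simp only [centreUp, centreDown, centreMid, centreCore, mem_ofPred_eq] at *
  clear he
  beta_reduce at *
  generalize p 0 = x at *
  generalize p 1 = y at *
  generalize p 2 = z at *
  have hy : y = 0 ∨ y = 18 ∨ y = 24 ∨ y = 21 ∨ y = 28 ∨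
      (y ≠ 0 ∧ y ≠ 18 ∧ y ≠ 24 ∧ y ≠ 21 ∧ y ≠ 28) := by clear * -; tauto
  have hx : x = -1 ∨ x = 1 ∨ (x ≠ -1 ∧ x ≠ 1) := by clear * -; tauto
  rcases hx with rfl | rfl | ⟨hx1, hx2⟩ <;>
    rcases hy with rfl | rfl | rfl | rfl | rfl | ⟨hy1, hy2, hy3, hy4, hy5⟩ <;>
    grind (splits := 30)

/-- The affine map taking a leg of the clasped pair to standard position; `true` is the leg
at the right. -/
def toChain : Bool → C(R3, R3)
  | true => ⟨fun p => !₂[p 0 - 9, p 1 - 16, p 2 - 12], by fun_prop⟩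
  | false => ⟨fun p => !₂[-p 0 - 9, 6 / 7 * p 1 - 16, 2 * p 2], by fun_prop⟩

def footSlope : Bool → ℝ
  | true => -6 / 5
  | false => 12 / 5

/-- Colourings of the two legs which match at the clasp. -/
structure ClaspColouring (G : Type*) [Group G] where
  leg : Bool → Colouring G
  leg_zero : ∀ s, (leg s).a 0 = (leg false).a 1 * ((leg true).a 1)⁻¹ * ((leg false).a 1)⁻¹ *
    (leg true).a 1

namespace ClaspColouring

variable (A : ClaspColouring G)

/-- The atlases describing the bundle over the complement of two clasped wild legs. -/
def piece : Option (Bool × Option ℕ) → PotentialAtlas R3 (Fin 3) G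
  | none => centre ((A.leg false).a 0) ((A.leg true).a 1) ((A.leg false).a 1) (A.leg_zero false)
  | some (s, none) => (A.leg s).tip.comap (toChain s)
  | some (s, some n) => ((A.leg s).zone (footSlope s) n).comap (toChain s)

theorem piece_none_bounds {p : R3} (hp : p ∈ (A.piece none).dom) : -4 < p 0 ∧ p 0 < 4 :=
  bounds_of_mem_dom_centre (he := A.leg_zero false) hp

theorem toChain_bounds {s : Bool} {t : Option ℕ} {p : R3} (hp : p ∈ (A.piece (some (s, t))).dom) :
    -6 < toChain s p 0 := by
  rcases t with - | n
  · rw [piece, PotentialAtlas.dom_comap] at hp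
    linarith [(A.leg s).bounds_of_mem_dom_tip hp]
  · rw [piece, PotentialAtlas.dom_comap] at hp
    have h := ((A.leg s).bounds_of_mem_dom_zone _ hp).1
    by_contra! h6
    have : (1 : ℝ) ≤ 2 ^ n := one_le_pow₀ one_le_two
    nlinarith

theorem toChain_bounds' {s : Bool} {t : Option ℕ} (ht : t ≠ some 0) {p : R3}
    (hp : p ∈ (A.piece (some (s, t))).dom) : -3 < toChain s p 0 := by
  rcases t with - | n
  · rw [piece, PotentialAtlas.dom_comap] at hp
    linarith [(A.leg s).bounds_of_mem_dom_tip hp]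
  · rw [piece, PotentialAtlas.dom_comap] at hp
    have h := ((A.leg s).bounds_of_mem_dom_zone _ hp).1
    obtain ⟨m, rfl⟩ := Nat.exists_eq_succ_of_ne_zero (show n ≠ 0 from fun h => ht (by rw [h]))
    by_contra! h6
    have : (1 : ℝ) ≤ 2 ^ m := one_le_pow₀ one_le_two
    rw [Nat.succ_eq_add_one, pow_succ] at h
    nlinarith

theorem centre_refines_right : (A.piece none).Refines (A.piece (some (true, some 0))) := by
  intro a p hp hpQ
  have hb := A.toChain_bounds hpQ
  change -6 < p 0 - 9 at hb
  have hb' := (A.piece_none_bounds (mem_iUnion_of_mem a hp)).2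
  fin_cases a
  · refine ⟨?_, .of_forall fun _ => rfl⟩
    obtain ⟨-, h1, h2, -, h4, -⟩ := (show p ∈ centreUp from hp)
    refine (show toChain true p ∈ zoneUp (-6 / 5) from ?_)
    change (-6 < p 0 - 9 ∧ p 0 - 9 < -5 / 2) ∧
      (p 0 - 9 = -4 ∧ -16 ≤ p 1 - 16 ∧ p 1 - 16 ≤ 2 → 0 < p 2 - 12) ∧
      (p 0 - 9 = -5 ∧ -4 ≤ p 1 - 16 ∧ p 1 - 16 ≤ -1 → 20 + 8 * (p 1 - 16) < p 2 - 12) ∧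
      (p 1 - 16 = 2 ∧ p 0 - 9 ≤ -4 → -16 - 4 * (p 0 - 9) < p 2 - 12) ∧
      (p 1 - 16 = 8 → 6 + 3 * (p 0 - 9) < p 2 - 12) ∧
      (p 1 - 16 = -1 ∧ -5 ≤ p 0 - 9 → -8 - 4 * (p 0 - 9) < p 2 - 12) ∧
      (p 1 - 16 = -4 ∧ -5 ≤ p 0 - 9 → 3 + 3 * (p 0 - 9) < p 2 - 12) ∧
      (p 1 - 16 = -16 ∧ p 0 - 9 ≤ -4 → -6 / 5 * (-4 - (p 0 - 9)) < p 2 - 12)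
    refine ⟨⟨by linarith, by linarith⟩, fun h => ?_, fun h => ?_, fun h => ?_, fun h => ?_,
      fun h => ?_, fun h => ?_, fun h => ?_⟩
    · linarith [h.1]
    · linarith [h.1]
    · linarith [h2 ⟨by linarith [h.1], by linarith⟩]
    · linarith [h4 ⟨by linarith, by linarith⟩]
    · linarith [h.2]
    · linarith [h.2]
    · linarith [h1 (by linarith [h.1])]
  · exfalso
    rcases (show p ∈ centreMid from hp) with h | h <;> linarith [h.1.2]
  · refine ⟨?_, ?_⟩
    · obtain ⟨-, h1, h2, -, h4, -⟩ := (show p ∈ centreDown from hp)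
      refine (show toChain true p ∈ zoneDown (-6 / 5) from ?_)
      change (-6 < p 0 - 9 ∧ p 0 - 9 < -5 / 2) ∧
        (p 0 - 9 = -4 ∧ -16 ≤ p 1 - 16 ∧ p 1 - 16 ≤ 2 → p 2 - 12 < 0) ∧
        (p 0 - 9 = -5 ∧ -4 ≤ p 1 - 16 ∧ p 1 - 16 ≤ -1 → p 2 - 12 < 20 + 8 * (p 1 - 16)) ∧
        (p 1 - 16 = 2 ∧ p 0 - 9 ≤ -4 → p 2 - 12 < -16 - 4 * (p 0 - 9)) ∧
        (p 1 - 16 = 8 → p 2 - 12 < 6 + 3 * (p 0 - 9)) ∧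
        (p 1 - 16 = -1 ∧ -5 ≤ p 0 - 9 → p 2 - 12 < -8 - 4 * (p 0 - 9)) ∧
        (p 1 - 16 = -4 ∧ -5 ≤ p 0 - 9 → p 2 - 12 < 3 + 3 * (p 0 - 9)) ∧
        (p 1 - 16 = -16 ∧ p 0 - 9 ≤ -4 → p 2 - 12 < -6 / 5 * (-4 - (p 0 - 9)))
      refine ⟨⟨by linarith, by linarith⟩, fun h => ?_, fun h => ?_, fun h => ?_, fun h => ?_,
        fun h => ?_, fun h => ?_, fun h => ?_⟩
      · linarith [h.1]
      · linarith [h.1]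
      · linarith [h2 ⟨by linarith [h.1], by linarith⟩]
      · linarith [h4 ⟨by linarith, by linarith⟩]
      · linarith [h.2]
      · linarith [h.2]
      · linarith [h1 (by linarith [h.1])]
    · have hc : ContinuousAt (fun q : R3 => q 0) p := by fun_prop
      have key : ∀ x y : ℝ, 3 < x → x < 4 → centrePlaneColour ((A.leg false).a 0)
          ((A.leg true).a 1) ((A.leg false).a 1) x y = planeColour ((A.leg true).a 0)
          ((A.leg true).a 1) ((A.leg true).a 2) (x - 9) (y - 16) := by
        intro x y h3 h4
        rw [A.leg_zero true, ← A.leg_zero false]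
        simp only [centrePlaneColour, planeColour, show ¬ x < -1 by linarith,
          show ¬ x < 1 by linarith, show x - 9 < -4 by linarith, show x - 9 < -5 by linarith,
          if_true, if_false]
        split_ifs <;> first | rfl | (exfalso; linarith)
      filter_upwards [hc.eventually (Ioo_mem_nhds (by linarith : 3 < p 0) hb')] with q hq
      exact key (q 0) (q 1) hq.1 hq.2

theorem centre_refines_left : (A.piece none).Refines (A.piece (some (false, some 0))) := by
  intro a p hp hpQ
  have hb := A.toChain_bounds hpQ
  change -6 < -p 0 - 9 at hb
  have hb' := (A.piece_none_bounds (mem_iUnion_of_mem a hp)).1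
  fin_cases a
  · refine ⟨?_, .of_forall fun _ => rfl⟩
    obtain ⟨-, h1, -, -, -, h2, -, h4⟩ := (show p ∈ centreUp from hp)
    refine (show toChain false p ∈ zoneUp (12 / 5) from ?_)
    change (-6 < -p 0 - 9 ∧ -p 0 - 9 < -5 / 2) ∧
      (-p 0 - 9 = -4 ∧ -16 ≤ 6 / 7 * p 1 - 16 ∧ 6 / 7 * p 1 - 16 ≤ 2 → 0 < 2 * p 2) ∧
      (-p 0 - 9 = -5 ∧ -4 ≤ 6 / 7 * p 1 - 16 ∧ 6 / 7 * p 1 - 16 ≤ -1 →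
        20 + 8 * (6 / 7 * p 1 - 16) < 2 * p 2) ∧
      (6 / 7 * p 1 - 16 = 2 ∧ -p 0 - 9 ≤ -4 → -16 - 4 * (-p 0 - 9) < 2 * p 2) ∧
      (6 / 7 * p 1 - 16 = 8 → 6 + 3 * (-p 0 - 9) < 2 * p 2) ∧
      (6 / 7 * p 1 - 16 = -1 ∧ -5 ≤ -p 0 - 9 → -8 - 4 * (-p 0 - 9) < 2 * p 2) ∧
      (6 / 7 * p 1 - 16 = -4 ∧ -5 ≤ -p 0 - 9 → 3 + 3 * (-p 0 - 9) < 2 * p 2) ∧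
      (6 / 7 * p 1 - 16 = -16 ∧ -p 0 - 9 ≤ -4 → 12 / 5 * (-4 - (-p 0 - 9)) < 2 * p 2)
    refine ⟨⟨by linarith, by linarith⟩, fun h => ?_, fun h => ?_, fun h => ?_, fun h => ?_,
      fun h => ?_, fun h => ?_, fun h => ?_⟩
    · linarith [h.1]
    · linarith [h.1]
    · linarith [h2 ⟨by linarith [h.1], by linarith⟩]
    · linarith [h4 ⟨by linarith, by linarith⟩]
    · linarith [h.2]
    · linarith [h.2]
    · linarith [h1 (by linarith [h.1])]
  · exfalso
    rcases (show p ∈ centreMid from hp) with h | h <;> linarith [h.1.1]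
  · refine ⟨?_, ?_⟩
    · obtain ⟨-, h1, -, -, -, h2, -, h4⟩ := (show p ∈ centreDown from hp)
      refine (show toChain false p ∈ zoneDown (12 / 5) from ?_)
      change (-6 < -p 0 - 9 ∧ -p 0 - 9 < -5 / 2) ∧
        (-p 0 - 9 = -4 ∧ -16 ≤ 6 / 7 * p 1 - 16 ∧ 6 / 7 * p 1 - 16 ≤ 2 → 2 * p 2 < 0) ∧
        (-p 0 - 9 = -5 ∧ -4 ≤ 6 / 7 * p 1 - 16 ∧ 6 / 7 * p 1 - 16 ≤ -1 →
          2 * p 2 < 20 + 8 * (6 / 7 * p 1 - 16)) ∧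
        (6 / 7 * p 1 - 16 = 2 ∧ -p 0 - 9 ≤ -4 → 2 * p 2 < -16 - 4 * (-p 0 - 9)) ∧
        (6 / 7 * p 1 - 16 = 8 → 2 * p 2 < 6 + 3 * (-p 0 - 9)) ∧
        (6 / 7 * p 1 - 16 = -1 ∧ -5 ≤ -p 0 - 9 → 2 * p 2 < -8 - 4 * (-p 0 - 9)) ∧
        (6 / 7 * p 1 - 16 = -4 ∧ -5 ≤ -p 0 - 9 → 2 * p 2 < 3 + 3 * (-p 0 - 9)) ∧
        (6 / 7 * p 1 - 16 = -16 ∧ -p 0 - 9 ≤ -4 → 2 * p 2 < 12 / 5 * (-4 - (-p 0 - 9)))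
      refine ⟨⟨by linarith, by linarith⟩, fun h => ?_, fun h => ?_, fun h => ?_, fun h => ?_,
        fun h => ?_, fun h => ?_, fun h => ?_⟩
      · linarith [h.1]
      · linarith [h.1]
      · linarith [h2 ⟨by linarith [h.1], by linarith⟩]
      · linarith [h4 ⟨by linarith, by linarith⟩]
      · linarith [h.2]
      · linarith [h.2]
      · linarith [h1 (by linarith [h.1])]
    · have hc : ContinuousAt (fun q : R3 => q 0) p := by fun_prop
      have key : ∀ x y : ℝ, -4 < x → x < -3 → centrePlaneColour ((A.leg false).a 0)
          ((A.leg true).a 1) ((A.leg false).a 1) x y = planeColour ((A.leg false).a 0)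
          ((A.leg false).a 1) ((A.leg false).a 2) (-x - 9) (6 / 7 * y - 16) := by
        intro x y h3 h4
        simp only [centrePlaneColour, planeColour, show x < -1 by linarith,
          show -x - 9 < -4 by linarith, show -x - 9 < -5 by linarith, if_true]
        split_ifs <;> first | rfl | (exfalso; linarith)
      filter_upwards [hc.eventually (Ioo_mem_nhds hb' (by linarith : p 0 < -3))] with q hq
      exact key (q 0) (q 1) hq.1 hq.2

theorem centre_refines (s : Bool) (t : Option ℕ) :
    (A.piece none).Refines (A.piece (some (s, t))) := by
  rcases eq_or_ne t (some 0) with rfl | ht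
  · cases s
    exacts [A.centre_refines_left, A.centre_refines_right]
  · refine PotentialAtlas.refines_of_disjoint (disjoint_left.2 fun p hp hp' => ?_)
    have h1 := A.piece_none_bounds hp
    have h2 := A.toChain_bounds' ht hp'
    cases s
    · change -3 < -p 0 - 9 at h2; linarith
    · change -3 < p 0 - 9 at h2; linarith

theorem refines_or : ∀ i j, i ≠ j →
    (A.piece i).Refines (A.piece j) ∨ (A.piece j).Refines (A.piece i) := by
  rintro (- | ⟨s, t⟩) (- | ⟨s', t'⟩) hij
  · exact absurd rfl hij
  · exact .inl (A.centre_refines s' t')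
  · exact .inr (A.centre_refines s t)
  · rcases eq_or_ne s s' with rfl | hs
    · rcases t with - | n <;> rcases t' with - | m
      · exact absurd rfl hij
      · exact .inl (((A.leg s).tip_refines_zone _ m).comap _)
      · exact .inr (((A.leg s).tip_refines_zone _ n).comap _)
      · have hnm : n ≠ m := fun h => hij (by rw [h])
        rcases hnm.lt_or_gt with h | h
        · exact .inl (((A.leg s).zone_refines_or _ h).comap _)
        · exact .inr (((A.leg s).zone_refines_or _ h).comap _)
    · refine .inl (PotentialAtlas.refines_of_disjoint (disjoint_left.2 fun p hp hp' => ?_))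
      have h1 := A.toChain_bounds hp
      have h2 := A.toChain_bounds hp'
      cases s <;> cases s' <;> first
        | exact hs rfl
        | (change -6 < -p 0 - 9 at h1; change -6 < p 0 - 9 at h2; linarith)
        | (change -6 < p 0 - 9 at h1; change -6 < -p 0 - 9 at h2; linarith)

/-- The bundle over the complement of two clasped wild legs. -/
def cocycle : Cocycle R3 (Option (Bool × Option ℕ) × Fin 3) G :=
  PotentialAtlas.glue A.piece A.refines_or

theorem compl_dom_cocycle_subset : A.cocycle.domᶜ ⊆ {p | -4 < p 0 ∧ p 0 < 4 ∧ p ∈ centreCore} ∪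
    ⋃ s, toChain s ⁻¹' (legCore (footSlope s)) := by
  intro p hp
  rw [cocycle, PotentialAtlas.dom_glue, mem_compl_iff, mem_iUnion, not_exists] at hp
  have hleg : ∀ s, -6 < toChain s p 0 → p ∈ toChain s ⁻¹' (legCore (footSlope s)) := by
    intro s h
    refine mem_legCore_of_notMem_dom (A.leg s) h (fun h' => ?_) fun n h' => ?_
    · exact hp (some (s, none)) (by rw [piece, PotentialAtlas.dom_comap]; exact h')
    · exact hp (some (s, some n)) (by rw [piece, PotentialAtlas.dom_comap]; exact h')
  by_cases h1 : -4 < p 0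
  · by_cases h2 : p 0 < 4
    · exact .inl ⟨h1, h2, mem_centreCore_of_notMem_dom (he := A.leg_zero false) h1 h2 (hp none)⟩
    · refine .inr (mem_iUnion_of_mem true (hleg true ?_))
      change -6 < p 0 - 9
      linarith
  · refine .inr (mem_iUnion_of_mem false (hleg false ?_))
    change -6 < -p 0 - 9
    linarith

/-- The part `z ≥ 0` of a loop around the base of the clasp. -/
def _root_.WildLeg.arc (M R : ℝ) : Set R3 :=
  segment ℝ !₂[0, 4, 0] !₂[0, 0, M] ∪ segment ℝ !₂[0, 0, M] !₂[0, -R, 0]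

theorem _root_.WildLeg.isPreconnected_arc (M R : ℝ) : IsPreconnected (arc M R) :=
  .union !₂[0, 0, M] (right_mem_segment _ _ _) (left_mem_segment _ _ _)
    (convex_segment _ _).isPreconnected (convex_segment _ _).isPreconnected

theorem _root_.WildLeg.isCompact_arc (M R : ℝ) : IsCompact (arc M R) := by
  refine .union ?_ ?_ <;> (rw [segment_eq_image_lineMap]; exact isCompact_Icc.image (by fun_prop))

theorem _root_.WildLeg.coords_of_mem_arc {M R : ℝ} {p : R3} (hp : p ∈ arc M R) :
    p 0 = 0 ∧ ∃ t : ℝ, 0 ≤ t ∧ t ≤ 1 ∧ (p 1 = 4 * t ∨ p 1 = -R * t) ∧ p 2 = (1 - t) * M := by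
  rcases hp with hp | hp
  · rw [segment_symm, segment_eq_image_lineMap] at hp
    obtain ⟨t, ⟨h0, h1⟩, rfl⟩ := hp
    refine ⟨?_, t, h0, h1, .inl ?_, ?_⟩ <;> simp [AffineMap.lineMap_apply] <;> ring
  · rw [segment_eq_image_lineMap] at hp
    obtain ⟨t, ⟨h0, h1⟩, rfl⟩ := hp
    refine ⟨?_, t, h0, h1, .inr ?_, ?_⟩ <;> simp [AffineMap.lineMap_apply] <;> ring

theorem _root_.WildLeg.arc_subset_centreUp {M R : ℝ} (hM : 6 < M) (hR : 0 < R) :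
    arc M R ⊆ centreUp := by
  intro p hp
  obtain ⟨h0, t, ht0, ht1, h1, h2⟩ := coords_of_mem_arc hp
  have h4 : p 1 ≤ 4 := by rcases h1 with h1 | h1 <;> nlinarith
  refine ⟨by constructor <;> linarith, fun h => ?_, fun h => ?_, fun h => ?_, fun h => ?_,
    fun h => ?_, fun h => ?_, fun h => ?_⟩ <;> try linarith [h.1]
  have : t = 0 := by
    rcases h1 with h1 | h1
    · linarith
    · exact (mul_eq_zero.1 (h1.symm.trans h)).resolve_left (by linarith)
  rw [h2, h0, this]
  linarith

theorem _root_.WildLeg.arc_subset_centreDown {M R : ℝ} (hM : 0 < M) (hR : 0 < R) :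
    arc (-M) R ⊆ centreDown := by
  intro p hp
  obtain ⟨h0, t, ht0, ht1, h1, h2⟩ := coords_of_mem_arc hp
  have h4 : p 1 ≤ 4 := by rcases h1 with h1 | h1 <;> nlinarith
  refine ⟨by constructor <;> linarith, fun h => ?_, fun h => ?_, fun h => ?_, fun h => ?_,
    fun h => ?_, fun h => ?_, fun h => ?_⟩ <;> try linarith [h.1]
  rw [h2, h0]
  nlinarith

/-- A loop around the base of the clasp. -/
def _root_.WildLeg.loop (M R : ℝ) : Set R3 := arc M R ∪ arc (-M) R

theorem not_splitsOn_loop (hA : (A.leg false).a 0 ≠ 1) {M R : ℝ} (hM : 6 < M) (hR : 0 < R) :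
    ¬ A.cocycle.SplitsOn (loop M R) := by
  rintro ⟨s, hs, hc⟩
  have hend : ∀ M, !₂[0, 4, 0] ∈ arc M R ∧ !₂[0, -R, 0] ∈ arc M R := fun M =>
    ⟨.inl (left_mem_segment _ _ _), .inr (right_mem_segment _ _ _)⟩
  have hU := arc_subset_centreUp hM hR
  have hD := arc_subset_centreDown (by linarith : 0 < M) hR
  have e1 := (isPreconnected_arc M R).eq_of_locally_eq (f := s (none, 0)) (fun x hx =>
    (hs (none, 0) x (hU hx) (.inl hx)).filter_mono (nhdsWithin_mono _ subset_union_left))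
    (hend M).1 (hend M).2
  have e2 := (isPreconnected_arc (-M) R).eq_of_locally_eq (f := s (none, 2)) (fun x hx =>
    (hs (none, 2) x (hD hx) (.inr hx)).filter_mono (nhdsWithin_mono _ subset_union_right))
    (hend (-M)).1 (hend (-M)).2
  have c1 := hc (none, 0) (none, 2) _ (hU (hend M).1) (hD (hend (-M)).1) (.inl (hend M).1)
  have c2 := hc (none, 0) (none, 2) _ (hU (hend M).2) (hD (hend (-M)).2) (.inl (hend M).2)
  rw [e1, e2, ← c2] at c1
  have c3 : centrePlaneColour ((A.leg false).a 0) ((A.leg true).a 1) ((A.leg false).a 1) 0 4 =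
      centrePlaneColour ((A.leg false).a 0) ((A.leg true).a 1) ((A.leg false).a 1) 0 (-R) :=
    mul_left_cancel (a := (1 : G)⁻¹) c1
  simp only [centrePlaneColour, neg_neg_iff_pos.2 hR] at c3
  norm_num at c3
  exact hA c3

end ClaspColouring

theorem _root_.Cocycle.SplitsOn.of_comap {X Y ι : Type*} [TopologicalSpace X] [TopologicalSpace Y]
    {E : Cocycle X ι G} {g : Y → X} {hg : ContinuousOn g univ} {h : X → Y} (hh : Continuous h)
    (hgh : ∀ x, g (h x) = x) {Z : Set X}
    (hs : (E.comap g univ isOpen_univ hg).SplitsOn (g ⁻¹' Z)) : E.SplitsOn Z := by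
  obtain ⟨s, hs, hc⟩ := hs
  have hU : ∀ {i x}, x ∈ E.U i → h x ∈ (E.comap g univ isOpen_univ hg).U i := fun {i x} hx =>
    ⟨mem_univ _, by rwa [mem_preimage, hgh]⟩
  have hZ : ∀ {x}, x ∈ Z → h x ∈ g ⁻¹' Z := fun {x} hx => by rwa [mem_preimage, hgh]
  refine ⟨fun i x => s i (h x), fun i x hx hxZ => ?_, fun i j x hi hj hx => ?_⟩
  · exact (hh.continuousWithinAt.tendsto_nhdsWithin fun y hy => hZ hy).eventually
      (hs i (h x) (hU hx) (hZ hxZ))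
  · rw [← hc i j (h x) (hU hi) (hU hj) (hZ hx)]
    change _ = E.c i j (g (h x))
    rw [hgh]

/-- The colours, written as the image tuples of permutations, repeat with period three. -/
def rightColour (n : ℕ) : Equiv.Perm (Fin 5) :=
  match n % 3 with
  | 0 => ⟨![2, 4, 1, 0, 3], ![3, 2, 0, 4, 1], by decide, by decide⟩
  | 1 => ⟨![1, 2, 3, 4, 0], ![4, 0, 1, 2, 3], by decide, by decide⟩
  | _ => ⟨![3, 0, 4, 2, 1], ![1, 4, 3, 0, 2], by decide, by decide⟩

def leftColour (n : ℕ) : Equiv.Perm (Fin 5) :=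
  match n % 3 with
  | 0 => ⟨![2, 4, 1, 0, 3], ![3, 2, 0, 4, 1], by decide, by decide⟩
  | 1 => ⟨![1, 3, 0, 4, 2], ![2, 0, 4, 1, 3], by decide, by decide⟩
  | _ => ⟨![3, 2, 4, 1, 0], ![4, 3, 1, 0, 2], by decide, by decide⟩

def permColouring : ClaspColouring (Equiv.Perm (Fin 5)) where
  leg s := bif s then
    { a := rightColour
      rel := fun n => by
        have h : n % 3 = 0 ∨ n % 3 = 1 ∨ n % 3 = 2 := by omega
        rcases h with h | h | h <;>
          simp only [rightColour, Nat.add_mod n 1, Nat.add_mod n 2, h] <;> decide }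
    else
    { a := leftColour
      rel := fun n => by
        have h : n % 3 = 0 ∨ n % 3 = 1 ∨ n % 3 = 2 := by omega
        rcases h with h | h | h <;>
          simp only [leftColour, Nat.add_mod n 1, Nat.add_mod n 2, h] <;> decide }
  leg_zero s := by cases s <;> decide

theorem permColouring_ne_one : (permColouring.leg false).a 0 ≠ 1 := by decide

theorem norm_le_abs_add_abs_add_abs (p : R3) : ‖p‖ ≤ |p 0| + |p 1| + |p 2| := by
  have h : p = p 0 • EuclideanSpace.single 0 1 + p 1 • EuclideanSpace.single 1 1 +
      p 2 • EuclideanSpace.single 2 (1 : ℝ) := by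
    ext i; fin_cases i <;> simp
  calc ‖p‖ = _ := congrArg norm h
    _ ≤ _ := norm_add₃_le
    _ = _ := by simp [norm_smul]

theorem abs_coord_le_norm (p : R3) (i : Fin 3) : |p i| ≤ ‖p‖ := PiLp.norm_apply_le p i

/-- The inverse of `unflip`. -/
def flip : C(R3, R3) := ⟨fun p => !₂[p 0 / 2, -p 1 / 2, p 2 / 2], by fun_prop⟩

@[simp] theorem flip_zero (p : R3) : flip p 0 = p 0 / 2 := rfl
@[simp] theorem flip_one (p : R3) : flip p 1 = -p 1 / 2 := rfl
@[simp] theorem flip_two (p : R3) : flip p 2 = p 2 / 2 := rfl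

theorem unflip_flip (p : R3) : unflip (flip p) = p := by
  ext i; fin_cases i <;> simp <;> ring

theorem flip_unflip (p : R3) : flip (unflip p) = p := by
  ext i; fin_cases i <;> simp

/-- The doubling map on the parameters `(r, a, b)` of a leg. -/
def dbl (q : ℝ × ℝ × ℝ) : ℝ × ℝ × ℝ := (2 * q.1, -2 * q.2.1, 2 * q.2.2)

theorem continuous_dbl : Continuous dbl := by unfold dbl; fun_prop

theorem dbl_injective : Function.Injective dbl := by
  rintro ⟨r, a, b⟩ ⟨r', a', b'⟩ h
  simp only [dbl, Prod.mk.injEq] at h ⊢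
  exact ⟨by linarith, by linarith, by linarith⟩

/-- The parameters of a leg: `r` runs from the foot at `1` to the wild point at `0`, and
`a`, `b` are the coordinates in a cross-section. -/
def params : Set (ℝ × ℝ × ℝ) := {q | q.1 ≤ 1 ∧ |q.2.1| ≤ q.1 / 8 ∧ |q.2.2| ≤ q.1 / 8}

theorem dbl_mem_params {q : ℝ × ℝ × ℝ} (hq : q ∈ params) (h : q.1 ≤ 1 / 2) : dbl q ∈ params := by
  obtain ⟨-, ha, hb⟩ := hq
  refine ⟨by simp only [dbl]; linarith, ?_, ?_⟩ <;> simp only [dbl, abs_mul] <;> norm_num <;> linarith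

def clamp (j : ℝ) (r : ℝ) : ℝ := max 0 (min 1 (8 * (1 - r) - j))

theorem clamp_of_le {j r : ℝ} (h : 8 * (1 - r) ≤ j) : clamp j r = 0 := by
  unfold clamp
  rw [min_eq_right (by linarith), max_eq_left (by linarith)]

theorem clamp_of_ge {j r : ℝ} (h : j + 1 ≤ 8 * (1 - r)) : clamp j r = 1 := by
  unfold clamp
  rw [min_eq_left (by linarith), max_eq_right zero_le_one]

theorem clamp_of_mem {j r : ℝ} (h : j ≤ 8 * (1 - r)) (h' : 8 * (1 - r) ≤ j + 1) :
    clamp j r = 8 * (1 - r) - j := by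
  unfold clamp
  rw [min_eq_right (by linarith), max_eq_right (by linarith)]

/-- The initial part of a leg; `e` is the slope of the foot. -/
def ref (e : ℝ) (q : ℝ × ℝ × ℝ) : R3 :=
  !₂[-4 - q.2.1 - 6 * clamp 1 q.1 + (8 + 2 * q.2.1) * clamp 3 q.1,
    -16 + e * q.2.1 + (18 - (1 + e) * q.2.1) * clamp 0 q.1 + (6 + 2 * q.2.1) * clamp 2 q.1,
    q.2.2 + 24 * clamp 1 q.1 - 48 * clamp 2 q.1 + 24 * clamp 3 q.1]

theorem ref_zero (e : ℝ) (q : ℝ × ℝ × ℝ) : ref e q 0 =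
    -4 - q.2.1 - 6 * clamp 1 q.1 + (8 + 2 * q.2.1) * clamp 3 q.1 := rfl

theorem ref_one (e : ℝ) (q : ℝ × ℝ × ℝ) : ref e q 1 =
    -16 + e * q.2.1 + (18 - (1 + e) * q.2.1) * clamp 0 q.1 + (6 + 2 * q.2.1) * clamp 2 q.1 := rfl

theorem ref_two (e : ℝ) (q : ℝ × ℝ × ℝ) : ref e q 2 =
    q.2.2 + 24 * clamp 1 q.1 - 48 * clamp 2 q.1 + 24 * clamp 3 q.1 := rfl

theorem continuous_ref (e : ℝ) : Continuous (ref e) := by unfold ref clamp; fun_prop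

theorem flip_ref_dbl (e : ℝ) {q : ℝ × ℝ × ℝ} (hq : q.1 = 1 / 2) : flip (ref 1 (dbl q)) = ref e q := by
  have h0 : ∀ j : ℝ, 0 ≤ j → clamp j (dbl q).1 = 0 := fun j hj =>
    clamp_of_le (by simp only [dbl, hq]; linarith)
  have h1 : ∀ j : ℝ, j ≤ 3 → clamp j q.1 = 1 := fun j hj => clamp_of_ge (by rw [hq]; linarith)
  unfold ref
  rw [h0 0, h0 1, h0 2, h0 3, h1 0, h1 1, h1 2, h1 3] <;> try norm_num
  ext i
  fin_cases i <;> simp [dbl] <;> ring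

/-- Approximations of a leg, where the part near the wild point is replaced. -/
def approx : ℕ → ℝ → ℝ × ℝ × ℝ → R3
  | 0, e, q => ref e q
  | n + 1, e, q => if q.1 ≤ 1 / 2 then flip (approx n 1 (dbl q)) else ref e q

theorem approx_of_lt (n : ℕ) (e : ℝ) {q : ℝ × ℝ × ℝ} (hq : 1 / 2 < q.1) : approx n e q = ref e q := by
  cases n
  · rfl
  · exact if_neg hq.not_ge

theorem continuous_approx (n : ℕ) (e : ℝ) : Continuous (approx n e) := by
  induction n generalizing e with
  | zero => exact continuous_ref e
  | succ n ih =>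
    refine Continuous.if_le (flip.continuous.comp ((ih 1).comp continuous_dbl)) (continuous_ref e)
      continuous_fst continuous_const fun q hq => ?_
    rw [approx_of_lt n 1 (by simp only [dbl, hq]; norm_num), flip_ref_dbl e hq]

theorem approx_succ {n : ℕ} (e : ℝ) {q : ℝ × ℝ × ℝ} (h : 1 / 2 < 2 ^ n * q.1) :
    approx (n + 1) e q = approx n e q := by
  induction n generalizing e q with
  | zero =>
    rw [pow_zero, one_mul] at h
    exact if_neg h.not_ge
  | succ n ih =>
    have := ih 1 (q := dbl q) (by rw [pow_succ] at h; simpa only [dbl, mul_assoc] using h)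
    change (if _ then flip (approx (n + 1) 1 (dbl q)) else _) = _
    rw [this]
    rfl

theorem approx_eq {n m : ℕ} (hnm : n ≤ m) (e : ℝ) {q : ℝ × ℝ × ℝ} (h : 1 / 2 < 2 ^ n * q.1) :
    approx m e q = approx n e q := by
  induction m, hnm using Nat.le_induction with
  | base => rfl
  | succ m hm ih =>
    rw [← ih, approx_succ]
    have h0 : 0 < q.1 := pos_of_mul_pos_right (by linarith) (by positivity : (0 : ℝ) ≤ 2 ^ n)
    exact h.trans_le (mul_le_mul_of_nonneg_right (pow_le_pow_right₀ one_le_two hm) h0.le)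

/-- A wild leg. -/
def leg (e : ℝ) (q : ℝ × ℝ × ℝ) : R3 := if q.1 ≤ 0 then 0 else approx ⌈1 / q.1⌉₊ e q

theorem leg_of_nonpos (e : ℝ) {q : ℝ × ℝ × ℝ} (h : q.1 ≤ 0) : leg e q = 0 := if_pos h

theorem leg_eq_approx {n : ℕ} (e : ℝ) {q : ℝ × ℝ × ℝ} (h : 1 / 2 < 2 ^ n * q.1) :
    leg e q = approx n e q := by
  have h0 : 0 < q.1 := pos_of_mul_pos_right (by linarith) (by positivity : (0 : ℝ) ≤ 2 ^ n)
  rw [leg, if_neg h0.not_ge]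
  have hN : 1 / 2 < 2 ^ ⌈1 / q.1⌉₊ * q.1 := by
    have h1 : 1 ≤ (⌈1 / q.1⌉₊ : ℝ) * q.1 := (div_le_iff₀ h0).1 (Nat.le_ceil _)
    have h2 : (⌈1 / q.1⌉₊ : ℝ) < 2 ^ ⌈1 / q.1⌉₊ := by exact_mod_cast Nat.lt_two_pow_self
    nlinarith
  rcases le_total n ⌈1 / q.1⌉₊ with hn | hn
  · exact approx_eq hn e h
  · exact (approx_eq hn e hN).symm

theorem leg_of_half_lt (e : ℝ) {q : ℝ × ℝ × ℝ} (h : 1 / 2 < q.1) : leg e q = ref e q :=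
  leg_eq_approx (n := 0) e (by simpa using h)

theorem exists_half_lt {r : ℝ} (hr : 0 < r) : ∃ n : ℕ, 1 / 2 < 2 ^ n * r := by
  obtain ⟨n, hn⟩ := pow_unbounded_of_one_lt (1 / 2 / r) (one_lt_two : (1 : ℝ) < 2)
  exact ⟨n, (div_lt_iff₀ hr).1 hn⟩

theorem leg_of_le_half (e : ℝ) {q : ℝ × ℝ × ℝ} (h : q.1 ≤ 1 / 2) :
    leg e q = flip (leg 1 (dbl q)) := by
  rcases le_or_gt q.1 0 with h0 | h0
  · rw [leg_of_nonpos e h0, leg_of_nonpos 1 (by simp only [dbl]; linarith)]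
    ext i; fin_cases i <;> simp
  · obtain ⟨n, hn⟩ := exists_half_lt h0
    have h1 : 1 / 2 < 2 ^ n * (dbl q).1 := by simp only [dbl]; linarith
    have h2 : 1 / 2 < 2 ^ (n + 1) * q.1 := by rw [pow_succ]; simp only [dbl] at h1; linarith
    rw [leg_eq_approx e h2, leg_eq_approx 1 h1, approx, if_pos h]

/-- Induction towards the wild point. -/
theorem leg_induction {Q : ℝ → ℝ × ℝ × ℝ → R3 → Prop}
    (h0 : ∀ e, ∀ q ∈ params, q.1 = 0 → Q e q 0)
    (h1 : ∀ e, ∀ q ∈ params, 1 / 2 < q.1 → Q e q (ref e q))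
    (h2 : ∀ e, ∀ q ∈ params, q.1 ≤ 1 / 2 → Q 1 (dbl q) (leg 1 (dbl q)) →
      Q e q (flip (leg 1 (dbl q))))
    (e : ℝ) {q : ℝ × ℝ × ℝ} (hq : q ∈ params) : Q e q (leg e q) := by
  rcases (show 0 ≤ q.1 by linarith [hq.2.1, abs_nonneg q.2.1]).eq_or_lt' with h | h
  · rw [leg_of_nonpos e h.le]
    exact h0 e q hq h
  obtain ⟨n, hn⟩ := exists_half_lt h
  induction n generalizing e q with
  | zero =>
    have : 1 / 2 < q.1 := by simpa using hn
    rw [leg_of_half_lt e this]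
    exact h1 e q hq this
  | succ n ih =>
    rcases le_or_gt q.1 (1 / 2) with h' | h'
    · rw [leg_of_le_half e h']
      refine h2 e q hq h' (ih 1 (dbl_mem_params hq h') (by simp only [dbl]; linarith) ?_)
      rw [pow_succ] at hn
      simp only [dbl]
      linarith
    · rw [leg_of_half_lt e h']
      exact h1 e q hq h'

/-- The four straight parts of the initial part of a leg. -/
def Part (e : ℝ) (a b c X Y Z : ℝ) : Fin 4 → Prop
  | 0 => X = -4 - a ∧ Y = -16 + e * a + (18 - (1 + e) * a) * c ∧ Z = b
  | 1 => X = -4 - a - 6 * c ∧ Y = 2 - a ∧ Z = b + 24 * c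
  | 2 => X = -10 - a ∧ Y = 2 - a + (6 + 2 * a) * c ∧ Z = b + 24 - 48 * c
  | 3 => X = -10 - a + (8 + 2 * a) * c ∧ Y = 8 + a ∧ Z = b - 24 + 24 * c

theorem exists_part (e : ℝ) {q : ℝ × ℝ × ℝ} (h : q.1 ≤ 1) (h' : 1 / 2 < q.1) :
    ∃ (k : Fin 4) (c : ℝ), 0 ≤ c ∧ c < 1 ∧ q.1 = 1 - (k + c) / 8 ∧
      Part e q.2.1 q.2.2 c (ref e q 0) (ref e q 1) (ref e q 2) k := by
  rcases lt_or_ge (7 / 8) q.1 with h1 | h1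
  · refine ⟨0, 8 * (1 - q.1) - 0, by linarith, by linarith, by norm_num, ?_⟩
    simp only [Part, ref_zero, ref_one, ref_two, clamp_of_mem (j := 0) (r := q.1) (by linarith) (by linarith),
      clamp_of_le (j := 1) (r := q.1) (by linarith),
      clamp_of_le (j := 2) (r := q.1) (by linarith),
      clamp_of_le (j := 3) (r := q.1) (by linarith)]
    refine ⟨by ring, by ring, by ring⟩
  rcases lt_or_ge (6 / 8) q.1 with h2 | h2
  · refine ⟨1, 8 * (1 - q.1) - 1, by linarith, by linarith, by norm_num, ?_⟩
    simp only [Part, ref_zero, ref_one, ref_two, clamp_of_ge (j := 0) (r := q.1) (by linarith),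
      clamp_of_mem (j := 1) (r := q.1) (by linarith) (by linarith),
      clamp_of_le (j := 2) (r := q.1) (by linarith),
      clamp_of_le (j := 3) (r := q.1) (by linarith)]
    refine ⟨by ring, by ring, by ring⟩
  rcases lt_or_ge (5 / 8) q.1 with h3 | h3
  · refine ⟨2, 8 * (1 - q.1) - 2, by linarith, by linarith, by norm_num, ?_⟩
    simp only [Part, ref_zero, ref_one, ref_two, clamp_of_ge (j := 0) (r := q.1) (by linarith),
      clamp_of_ge (j := 1) (r := q.1) (by linarith),
      clamp_of_mem (j := 2) (r := q.1) (by linarith) (by linarith),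
      clamp_of_le (j := 3) (r := q.1) (by linarith)]
    refine ⟨by ring, by ring, by ring⟩
  · refine ⟨3, 8 * (1 - q.1) - 3, by linarith, by linarith, by norm_num, ?_⟩
    simp only [Part, ref_zero, ref_one, ref_two, clamp_of_ge (j := 0) (r := q.1) (by linarith),
      clamp_of_ge (j := 1) (r := q.1) (by linarith),
      clamp_of_ge (j := 2) (r := q.1) (by linarith),
      clamp_of_mem (j := 3) (r := q.1) (by linarith) (by linarith)]
    refine ⟨by ring, by ring, by ring⟩

theorem abs_leg_le (e : ℝ) {q : ℝ × ℝ × ℝ} (he : |e| ≤ 1) (hq : q ∈ params) :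
    |leg e q 0| ≤ 60 * q.1 ∧ |leg e q 1| ≤ 60 * q.1 ∧ |leg e q 2| ≤ 60 * q.1 := by
  refine leg_induction (Q := fun e q p => |e| ≤ 1 →
    |p 0| ≤ 60 * q.1 ∧ |p 1| ≤ 60 * q.1 ∧ |p 2| ≤ 60 * q.1) ?_ ?_ ?_ e hq he
  · intro e q hq h _
    simp [h]
  · intro e q hq h he
    obtain ⟨k, c, hc0, hc1, hr, hk⟩ := exists_part e hq.1 h
    obtain ⟨h1, ha, hb⟩ := hq
    rw [abs_le] at ha hb he
    generalize q.1 = r at *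
    generalize q.2.1 = a at *
    generalize q.2.2 = b at *
    have hac : |a * c| ≤ 1 / 8 := by
      rw [abs_mul]
      nlinarith [abs_le.2 ha, abs_nonneg a, abs_of_nonneg hc0]
    have hea : |e * a| ≤ 1 / 8 := by
      rw [abs_mul]
      nlinarith [abs_le.2 ha, abs_nonneg a, abs_le.2 he, abs_nonneg e]
    have heac : |e * (a * c)| ≤ 1 / 8 := by
      rw [abs_mul]
      nlinarith [abs_nonneg (a * c), abs_le.2 he, abs_nonneg e]
    rw [abs_le] at hac hea heac
    have key : ∀ X Y Z : ℝ, Part e a b c X Y Z k → |X| ≤ 60 * r ∧ |Y| ≤ 60 * r ∧ |Z| ≤ 60 * r := by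
      rintro X Y Z h
      simp only [abs_le]
      fin_cases k <;> obtain ⟨rfl, rfl, rfl⟩ := h <;>
        refine ⟨⟨?_, ?_⟩, ⟨?_, ?_⟩, ?_, ?_⟩ <;> linarith
    exact key _ _ _ hk
  · intro e q hq h ih _
    have := ih (by norm_num)
    simp only [dbl, flip_zero, flip_one, flip_two, abs_div, abs_neg, abs_two] at this ⊢
    refine ⟨?_, ?_, ?_⟩ <;> linarith [this.1, this.2.1, this.2.2]

theorem continuousOn_leg {e : ℝ} (he : |e| ≤ 1) : ContinuousOn (leg e) params := by
  intro q hq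
  rcases (show 0 ≤ q.1 by linarith [hq.2.1, abs_nonneg q.2.1]).eq_or_lt' with h | h
  · rw [ContinuousWithinAt, leg_of_nonpos e h.le, tendsto_zero_iff_norm_tendsto_zero]
    have hc : Filter.Tendsto (fun q' : ℝ × ℝ × ℝ => 180 * q'.1) (nhdsWithin q params) (nhds 0) := by
      have : ContinuousWithinAt (fun q' : ℝ × ℝ × ℝ => 180 * q'.1) params q := by fun_prop
      simpa [ContinuousWithinAt, h] using this
    refine squeeze_zero' (.of_forall fun _ => norm_nonneg _) ?_ hc
    filter_upwards [self_mem_nhdsWithin] with q' hq'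
    have := abs_leg_le e he hq'
    linarith [norm_le_abs_add_abs_add_abs (leg e q'), this.1, this.2.1, this.2.2]
  · obtain ⟨n, hn⟩ := exists_half_lt h
    refine ContinuousAt.continuousWithinAt ?_
    have hc : ContinuousAt (fun q' : ℝ × ℝ × ℝ => 2 ^ n * q'.1) q := by fun_prop
    refine (continuous_approx n e).continuousAt.congr ?_
    filter_upwards [hc.eventually (lt_mem_nhds hn)] with q' hq'
    exact (leg_eq_approx e hq').symm

/-- A coarse description of the position of a part of a leg. -/
def Near (X Y Z : ℝ) : Fin 4 → Prop
  | 0 => |X + 4| ≤ 1 / 8 ∧ -129 / 8 ≤ Y ∧ Y ≤ 17 / 8 ∧ |Z| ≤ 1 / 8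
  | 1 => |Y - 2| ≤ 1 / 8 ∧ -81 / 8 ≤ X ∧ X ≤ -31 / 8 ∧ |Z + 16 + 4 * X| ≤ 5 / 8
  | 2 => |X + 10| ≤ 1 / 8 ∧ 15 / 8 ≤ Y ∧ Y ≤ 65 / 8 ∧ |Z + 8 * (Y - 2) - 24| ≤ 9 / 8
  | 3 => |Y - 8| ≤ 1 / 8 ∧ -81 / 8 ≤ X ∧ X ≤ -15 / 8 ∧ |Z + 24 - 3 * (X + 10)| ≤ 9 / 8

theorem Part.near {e a b c X Y Z : ℝ} {k : Fin 4} (he : |e| ≤ 1) (hc0 : 0 ≤ c) (hc1 : c ≤ 1)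
    (ha : |a| ≤ 1 / 8) (hb : |b| ≤ 1 / 8) (h : Part e a b c X Y Z k) : Near X Y Z k := by
  rw [abs_le] at ha hb he
  have hea : -(1 / 8) ≤ e * a ∧ e * a ≤ 1 / 8 := by
    rw [← abs_le, abs_mul]
    nlinarith [abs_le.2 ha, abs_nonneg a, abs_le.2 he, abs_nonneg e]
  have hac : -(1 / 8) ≤ a * c ∧ a * c ≤ 1 / 8 := by
    constructor <;> nlinarith
  have h1 : 0 ≤ (1 - c) * (1 / 8 + e * a) := mul_nonneg (by linarith) (by linarith)
  have h2 : 0 ≤ (1 - c) * (1 / 8 - e * a) := mul_nonneg (by linarith) (by linarith)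
  have h3 : 0 ≤ (1 - c) * (1 / 8 + a) := mul_nonneg (by linarith) (by linarith)
  have h4 : 0 ≤ (1 - c) * (1 / 8 - a) := mul_nonneg (by linarith) (by linarith)
  have h5 : 0 ≤ c * (1 / 8 + a) := mul_nonneg hc0 (by linarith)
  have h6 : 0 ≤ c * (1 / 8 - a) := mul_nonneg hc0 (by linarith)
  fin_cases k <;> obtain ⟨rfl, rfl, rfl⟩ := h <;> simp only [Near, abs_le] <;>
    refine ⟨⟨?_, ?_⟩, ?_, ?_, ?_, ?_⟩ <;> linarith

theorem Near.bounds {X Y Z : ℝ} {k : Fin 4} (h : Near X Y Z k) :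
    (-81 / 8 ≤ X ∧ X ≤ 0) ∧ -129 / 8 ≤ Y ∧ Y ≤ 65 / 8 := by
  fin_cases k <;> simp only [Near, abs_le] at h <;> refine ⟨⟨?_, ?_⟩, ?_, ?_⟩ <;> linarith

theorem leg_bounds (e : ℝ) {q : ℝ × ℝ × ℝ} (he : |e| ≤ 1) (hq : q ∈ params) :
    (-81 / 8 ≤ leg e q 0 ∧ leg e q 0 ≤ 0) ∧ -129 / 8 ≤ leg e q 1 ∧ leg e q 1 ≤ 65 / 8 := by
  refine leg_induction (Q := fun e q p => |e| ≤ 1 →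
    (-81 / 8 ≤ p 0 ∧ p 0 ≤ 0) ∧ -129 / 8 ≤ p 1 ∧ p 1 ≤ 65 / 8) ?_ ?_ ?_ e hq he
  · intro e q hq h _
    norm_num
  · intro e q hq h he
    obtain ⟨k, c, hc0, hc1, hr, hk⟩ := exists_part e hq.1 h
    obtain ⟨h1, ha, hb⟩ := hq
    exact (hk.near he hc0 hc1.le (by linarith) (by linarith)).bounds
  · intro e q hq h ih _
    obtain ⟨⟨h1, h2⟩, h3, h4⟩ := ih (by norm_num)
    simp only [flip_zero, flip_one]
    refine ⟨⟨?_, ?_⟩, ?_, ?_⟩ <;> linarith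

theorem leg_cases (e : ℝ) {q : ℝ × ℝ × ℝ} (hq : q ∈ params) :
    (1 / 2 < q.1 ∧ ∃ (k : Fin 4) (c : ℝ), 0 ≤ c ∧ c < 1 ∧ q.1 = 1 - (k + c) / 8 ∧
      Part e q.2.1 q.2.2 c (leg e q 0) (leg e q 1) (leg e q 2) k) ∨
    (q.1 ≤ 1 / 2 ∧ (-81 / 16 ≤ leg e q 0 ∧ leg e q 0 ≤ 0) ∧
      -65 / 16 ≤ leg e q 1 ∧ leg e q 1 ≤ 129 / 16) := by
  rcases lt_or_ge (1 / 2) q.1 with h | h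
  · rw [leg_of_half_lt e h]
    exact .inl ⟨h, exists_part e hq.1 h⟩
  · refine .inr ⟨h, ?_⟩
    rw [leg_of_le_half e h]
    obtain ⟨⟨h1, h2⟩, h3, h4⟩ := leg_bounds 1 (by norm_num) (dbl_mem_params hq h)
    simp only [flip_zero, flip_one]
    refine ⟨⟨?_, ?_⟩, ?_, ?_⟩ <;> linarith

theorem Part.unique {e a b c a' b' c' X Y Z : ℝ} {k k' : Fin 4} (he0 : 0 ≤ e) (he1 : e ≤ 1)
    (hc0 : 0 ≤ c) (hc1 : c < 1) (hc0' : 0 ≤ c') (hc1' : c' < 1)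
    (ha : |a| ≤ 1 / 8) (hb : |b| ≤ 1 / 8) (ha' : |a'| ≤ 1 / 8) (hb' : |b'| ≤ 1 / 8)
    (h : Part e a b c X Y Z k) (h' : Part e a' b' c' X Y Z k') :
    k = k' ∧ a = a' ∧ b = b' ∧ c = c' := by
  wlog hk : k ≤ k' generalizing a b c a' b' c' k k'
  · obtain ⟨rfl, rfl, rfl, rfl⟩ := this hc0' hc1' hc0 hc1 ha' hb' ha hb h' h (le_of_not_ge hk)
    simp
  have he : |e| ≤ 1 := abs_le.2 ⟨by linarith, he1⟩
  have hn := h.near he hc0 hc1.le ha hb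
  have hn' := h'.near he hc0' hc1'.le ha' hb'
  rw [abs_le] at ha hb ha' hb'
  have hm : ∀ s : ℝ, 0 < s → s * c = s * c' → c = c' := fun s hs h => mul_left_cancel₀ hs.ne' h
  have hsame : k = k' → k = k' ∧ a = a' ∧ b = b' ∧ c = c' := by
    rintro rfl
    fin_cases k <;> obtain ⟨hX, hY, hZ⟩ := h <;> obtain ⟨hX', hY', hZ'⟩ := h'
    · obtain rfl : a = a' := by linarith
      exact ⟨rfl, rfl, by linarith, hm (18 - (1 + e) * a) (by nlinarith) (by linarith)⟩
    · obtain rfl : a = a' := by linarith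
      obtain rfl : c = c' := by linarith
      exact ⟨rfl, rfl, by linarith, rfl⟩
    · obtain rfl : a = a' := by linarith
      obtain rfl := hm (6 + 2 * a) (by linarith) (by linarith)
      exact ⟨rfl, rfl, by linarith, rfl⟩
    · obtain rfl : a = a' := by linarith
      obtain rfl := hm (8 + 2 * a) (by linarith) (by linarith)
      exact ⟨rfl, rfl, by linarith, rfl⟩
  rcases hk.eq_or_lt with hk | hk
  · exact hsame hk
  exfalso
  have p1 : 0 < (1 - c) * (12 - (1 + e) * a) := mul_pos (by linarith) (by nlinarith)
  have p2 : 0 ≤ (6 + 2 * a') * c' := mul_nonneg (by linarith) hc0'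
  have p3 : 0 < (1 - c) * (6 + 2 * a) := mul_pos (by linarith) (by linarith)
  have p4 : 0 ≤ (8 + 2 * a') * c' := mul_nonneg (by linarith) hc0'
  clear hsame hm
  fin_cases k <;> fin_cases k' <;> (try exact absurd hk (by decide)) <;>
    simp only [Near, abs_le, Part] at hn hn' h h' <;> linarith

theorem Part.ne_flip_part {e a b c a' b' c' X Y Z : ℝ} {k k' : Fin 4} (he0 : 0 ≤ e) (he1 : e ≤ 1)
    (hc0 : 0 ≤ c) (hc1 : c < 1) (hc0' : 0 ≤ c') (hc1' : c' < 1)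
    (ha : |a| ≤ 1 / 8) (hb : |b| ≤ 1 / 8) (ha' : |a'| ≤ 1 / 8) (hb' : |b'| ≤ 1 / 8)
    (h : Part e a b c X Y Z k) (h' : Part 1 a' b' c' (2 * X) (-2 * Y) (2 * Z) k') : False := by
  have he : |e| ≤ 1 := abs_le.2 ⟨by linarith, he1⟩
  have hn := h.near he hc0 hc1.le ha hb
  have hn' := h'.near (by norm_num) hc0' hc1'.le ha' hb'
  rw [abs_le] at ha hb ha' hb'
  have p1 : 0 < (1 - c) * (8 + 2 * a) := mul_pos (by linarith) (by linarith)
  have p2 : 0 ≤ (18 - (1 + 1) * a') * c' := mul_nonneg (by linarith) hc0'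
  fin_cases k <;> fin_cases k' <;> simp only [Near, abs_le, Part] at hn hn' h h' <;> linarith

theorem leg_ne_of_half_lt {e : ℝ} {q q' : ℝ × ℝ × ℝ} (he0 : 0 ≤ e) (he1 : e ≤ 1) (hq : q ∈ params)
    (hq' : q' ∈ params) (h : 1 / 2 < q.1) (h' : q'.1 ≤ 1 / 2) : leg e q ≠ leg e q' := by
  intro heq
  have he : |e| ≤ 1 := abs_le.2 ⟨by linarith, he1⟩
  obtain ⟨-, k, c, hc0, hc1, -, hk⟩ := (leg_cases e hq).resolve_right fun H => by linarith [H.1]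
  have hd := dbl_mem_params hq' h'
  have hx : leg 1 (dbl q') = unflip (leg e q) := by rw [heq, leg_of_le_half e h', unflip_flip]
  have h0 := congrArg (fun p : R3 => p 0) hx
  have h1 := congrArg (fun p : R3 => p 1) hx
  have h2 := congrArg (fun p : R3 => p 2) hx
  simp only [unflip_zero, unflip_one, unflip_two] at h0 h1 h2
  have ha : |q.2.1| ≤ 1 / 8 := hq.2.1.trans (by linarith [hq.1])
  have hb : |q.2.2| ≤ 1 / 8 := hq.2.2.trans (by linarith [hq.1])
  rcases leg_cases 1 hd with ⟨-, k', c', hc0', hc1', -, hk'⟩ | ⟨-, hb1, hb2⟩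
  · rw [h0, h1, h2] at hk'
    exact hk.ne_flip_part he0 he1 hc0 hc1 hc0' hc1' ha hb (hd.2.1.trans (by linarith [hd.1]))
      (hd.2.2.trans (by linarith [hd.1])) hk'
  · rw [h0] at hb1
    rw [h1] at hb2
    have hn := hk.near he hc0 hc1.le ha hb
    generalize leg e q 0 = X at *
    generalize leg e q 1 = Y at *
    fin_cases k <;> simp only [Near, abs_le] at hn <;> linarith

theorem leg_injOn {e : ℝ} (he0 : 0 ≤ e) (he1 : e ≤ 1) : InjOn (leg e) params := by
  have key : ∀ (n : ℕ) (e : ℝ) (q q' : ℝ × ℝ × ℝ), 0 ≤ e → e ≤ 1 → q ∈ params → q' ∈ params →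
      1 / 2 < 2 ^ n * q.1 → leg e q = leg e q' → q = q' := by
    intro n
    have base : ∀ (e : ℝ) (q q' : ℝ × ℝ × ℝ), 0 ≤ e → e ≤ 1 → q ∈ params → q' ∈ params →
        1 / 2 < q.1 → leg e q = leg e q' → q = q' := by
      intro e q q' he0 he1 hq hq' h heq
      rcases leg_cases e hq' with ⟨h', k', c', hc0', hc1', hr', hk'⟩ | ⟨h', -⟩
      · obtain ⟨-, k, c, hc0, hc1, hr, hk⟩ := (leg_cases e hq).resolve_right fun H => by linarith [H.1]
        rw [heq] at hk
        obtain ⟨rfl, h1, h2, rfl⟩ := hk.unique he0 he1 hc0 hc1 hc0' hc1'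
          (hq.2.1.trans (by linarith [hq.1])) (hq.2.2.trans (by linarith [hq.1]))
          (hq'.2.1.trans (by linarith [hq'.1])) (hq'.2.2.trans (by linarith [hq'.1])) hk'
        exact Prod.ext (hr.trans hr'.symm) (Prod.ext h1 h2)
      · exact absurd heq (leg_ne_of_half_lt he0 he1 hq hq' h h')
    induction n with
    | zero =>
      intro e q q' he0 he1 hq hq' h
      exact base e q q' he0 he1 hq hq' (by simpa using h)
    | succ n ih =>
      intro e q q' he0 he1 hq hq' h heq
      rcases lt_or_ge (1 / 2) q.1 with h1 | h1
      · exact base e q q' he0 he1 hq hq' h1 heq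
      rcases lt_or_ge (1 / 2) q'.1 with h2 | h2
      · exact (base e q' q he0 he1 hq' hq h2 heq.symm).symm
      refine dbl_injective (ih 1 _ _ zero_le_one le_rfl (dbl_mem_params hq h1) (dbl_mem_params hq' h2)
        ?_ ?_)
      · rw [pow_succ] at h
        simp only [dbl]
        linarith
      · rw [leg_of_le_half e h1, leg_of_le_half e h2] at heq
        rw [← unflip_flip (leg 1 (dbl q)), heq, unflip_flip]
  intro q hq q' hq' heq
  rcases (show 0 ≤ q.1 by linarith [hq.2.1, abs_nonneg q.2.1]).eq_or_lt' with h | h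
  · rcases (show 0 ≤ q'.1 by linarith [hq'.2.1, abs_nonneg q'.2.1]).eq_or_lt' with h' | h'
    · have z : ∀ q ∈ params, q.1 = 0 → q = 0 := fun q hq h =>
        Prod.ext h (Prod.ext (abs_nonpos_iff.1 (hq.2.1.trans (by simp [h])))
          (abs_nonpos_iff.1 (hq.2.2.trans (by simp [h]))))
      rw [z q hq h, z q' hq' h']
    · obtain ⟨n, hn⟩ := exists_half_lt h'
      exact (key n e q' q he0 he1 hq' hq hn heq.symm).symm
  · obtain ⟨n, hn⟩ := exists_half_lt h
    exact key n e q q' he0 he1 hq hq' hn heq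

theorem leg_one (a b : ℝ) : leg 0 (1, a, b) = !₂[-4 - a, -16, b] := by
  rw [leg_of_half_lt 0 (by norm_num)]
  ext i
  fin_cases i <;> simp [ref, clamp]

theorem lt_leg_of_lt_one {q : ℝ × ℝ × ℝ} (hq : q ∈ params) (h : q.1 < 1) : -16 < leg 0 q 1 := by
  rcases leg_cases 0 hq with ⟨h', k, c, hc0, hc1, hr, hk⟩ | ⟨-, -, h, -⟩
  · have ha : |q.2.1| ≤ 1 / 8 := hq.2.1.trans (by linarith [hq.1])
    have hb : |q.2.2| ≤ 1 / 8 := hq.2.2.trans (by linarith [hq.1])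
    have hn := hk.near (by norm_num) hc0 hc1.le ha hb
    rw [abs_le] at ha
    generalize leg 0 q 0 = X at *
    generalize leg 0 q 1 = Y at *
    generalize leg 0 q 2 = Z at *
    fin_cases k <;> simp only [Near, abs_le, Part] at hn hk
    · obtain ⟨-, rfl, -⟩ := hk
      have : 0 < c := by norm_num at hr; linarith
      nlinarith [mul_pos this (show 0 < 18 - q.2.1 by linarith)]
    all_goals linarith
  · linarith

/-- The axis of a leg. -/
def axis : Set R3 := (fun r => leg 0 (r, 0, 0)) '' Icc 0 1

theorem leg_axis (e r : ℝ) : leg e (r, 0, 0) = leg 0 (r, 0, 0) := by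
  rcases lt_or_ge (1 / 2) r with h | h
  · rw [leg_of_half_lt e h, leg_of_half_lt 0 h]
    simp [ref]
  · rw [leg_of_le_half e h, leg_of_le_half 0 h]

theorem flip_mem_axis {p : R3} (hp : p ∈ axis) : flip p ∈ axis := by
  obtain ⟨r, hr, rfl⟩ := hp
  refine ⟨r / 2, ⟨by linarith [hr.1], by linarith [hr.2]⟩, ?_⟩
  have h : (r / 2, (0 : ℝ), (0 : ℝ)).1 ≤ 1 / 2 := by simpa using by linarith [hr.2]
  simp only [leg_of_le_half 0 h, dbl, mul_zero, mul_div_cancel₀ r (two_ne_zero' ℝ), leg_axis 1]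

theorem mem_axis_of_unflip {p : R3} (hp : unflip p ∈ axis) : p ∈ axis :=
  flip_unflip p ▸ flip_mem_axis hp

theorem mem_axis_of_unflipPow {n : ℕ} {p : R3} (hp : unflipPow n p ∈ axis) : p ∈ axis := by
  induction n with
  | zero => exact hp
  | succ n ih =>
    rw [unflipPow_succ_apply] at hp
    exact ih (mem_axis_of_unflip hp)

theorem leg_of_half_le (e : ℝ) {q : ℝ × ℝ × ℝ} (h : 1 / 2 ≤ q.1) : leg e q = ref e q := by
  rcases h.eq_or_lt' with h | h
  · rw [leg_of_le_half e h.le, leg_of_half_lt 1 (by simp only [dbl, h]; norm_num),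
      flip_ref_dbl e h]
  · exact leg_of_half_lt e h

theorem mem_axis_of_part {p : R3} {c : ℝ} {k : Fin 4} (hc0 : 0 ≤ c) (hc1 : c ≤ 1)
    (h : Part 0 0 0 c (p 0) (p 1) (p 2) k) : p ∈ axis := by
  have hk : ((k : ℕ) : ℝ) ≤ 3 := by exact_mod_cast Nat.le_of_lt_succ k.2
  have hk0 : (0 : ℝ) ≤ (k : ℕ) := Nat.cast_nonneg _
  obtain ⟨r, hr⟩ : ∃ r : ℝ, r = 1 - ((k : ℕ) + c) / 8 := ⟨_, rfl⟩
  refine ⟨r, ⟨by linarith, by linarith⟩, ?_⟩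
  simp only
  rw [leg_of_half_le 0 (by simp only; linarith)]
  have hlt : ∀ j : ℝ, (k : ℕ) + 1 ≤ j → clamp j r = 0 := fun j hj => clamp_of_le (by linarith)
  have hgt : ∀ j : ℝ, j + 1 ≤ (k : ℕ) → clamp j r = 1 := fun j hj => clamp_of_ge (by linarith)
  have heq : clamp (k : ℕ) r = c := by rw [clamp_of_mem (by linarith) (by linarith)]; linarith
  ext i
  fin_cases k
  · have h1 := hlt 1 (by simp)
    have h2 := hlt 2 (by norm_num)
    have h3 := hlt 3 (by norm_num)
    have h0 : clamp 0 r = c := by simpa using heq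
    obtain ⟨hX, hY, hZ⟩ := h
    fin_cases i <;> simp [ref, h0, h1, h2, h3, hX, hY, hZ]
  · have h0 := hgt 0 (by simp)
    have h2 := hlt 2 (by norm_num)
    have h3 := hlt 3 (by norm_num)
    have h1 : clamp 1 r = c := by simpa using heq
    obtain ⟨hX, hY, hZ⟩ := h
    fin_cases i <;> simp [ref, h0, h1, h2, h3, hX, hY, hZ] <;> ring
  · have h0 := hgt 0 (by norm_num)
    have h1 := hgt 1 (by norm_num)
    have h3 := hlt 3 (by norm_num)
    have h2 : clamp 2 r = c := by simpa using heq
    obtain ⟨hX, hY, hZ⟩ := h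
    fin_cases i <;> simp [ref, h0, h1, h2, h3, hX, hY, hZ] <;> ring
  · have h0 := hgt 0 (by norm_num)
    have h1 := hgt 1 (by norm_num)
    have h2 := hgt 2 (by norm_num)
    have h3 : clamp 3 r = c := by simpa using heq
    obtain ⟨hX, hY, hZ⟩ := h
    fin_cases i <;> simp [ref, h0, h1, h2, h3, hX, hY, hZ] <;> ring

theorem mem_axis_shaft {p : R3} (h0 : p 0 = -4) (h1 : -16 ≤ p 1) (h1' : p 1 ≤ 2) (h2 : p 2 = 0) :
    p ∈ axis :=
  mem_axis_of_part (k := 0) (c := (p 1 + 16) / 18) (by linarith) (by linarith)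
    ⟨by linarith, by linarith, h2⟩

theorem mem_axis_descent {p : R3} (h0 : -10 ≤ p 0) (h0' : p 0 ≤ -4) (h1 : p 1 = 2)
    (h2 : p 2 = -16 - 4 * p 0) : p ∈ axis :=
  mem_axis_of_part (k := 1) (c := (-4 - p 0) / 6) (by linarith) (by linarith)
    ⟨by linarith, by linarith, by linarith⟩

theorem mem_axis_riser {p : R3} (h0 : p 0 = -10) (h1 : 2 ≤ p 1) (h1' : p 1 ≤ 8)
    (h2 : p 2 = 40 - 8 * p 1) : p ∈ axis :=
  mem_axis_of_part (k := 2) (c := (p 1 - 2) / 6) (by linarith) (by linarith)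
    ⟨by linarith, by linarith, by linarith⟩

theorem mem_axis_return {p : R3} (h0 : -10 ≤ p 0) (h0' : p 0 ≤ -2) (h1 : p 1 = 8)
    (h2 : p 2 = 6 + 3 * p 0) : p ∈ axis :=
  mem_axis_of_part (k := 3) (c := (p 0 + 10) / 8) (by linarith) (by linarith)
    ⟨by linarith, by linarith, by linarith⟩

theorem mem_axis_or_of_mem_legCore {b : ℝ} {p : R3} (hp : p ∈ legCore b) :
    p ∈ axis ∨ (p 1 = -16 ∧ -6 < p 0 ∧ p 0 ≤ -4 ∧ p 2 = b * (-4 - p 0)) := by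
  obtain rfl | ⟨n, hn, hn', hz⟩ := hp
  · exact .inl ⟨0, by simp, leg_of_nonpos 0 le_rfl⟩
  rw [← unflipPow_zero] at hn hn'
  obtain ⟨h0, h1, h1', h2⟩ | ⟨h0, h1, h1', h2⟩ | ⟨h1, h0, h2⟩ | ⟨h1, h2⟩ | ⟨h1, h0, h2⟩ |
    ⟨h1, h0, h2⟩ | ⟨h1, h0, h2⟩ := hz
  · exact .inl (mem_axis_of_unflipPow (mem_axis_shaft h0 h1 h1' h2))
  · refine .inl (mem_axis_of_unflipPow (n := n) (mem_axis_of_unflip (mem_axis_riser ?_ ?_ ?_ ?_))) <;>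
      simp only [unflip_zero, unflip_one, unflip_two] <;> linarith
  · exact .inl (mem_axis_of_unflipPow (mem_axis_descent (by linarith) h0 h1 h2))
  · exact .inl (mem_axis_of_unflipPow (mem_axis_return (by linarith) (by linarith) h1 h2))
  · refine .inl (mem_axis_of_unflipPow (n := n) (mem_axis_of_unflip (mem_axis_descent ?_ ?_ ?_ ?_))) <;>
      simp only [unflip_zero, unflip_one, unflip_two] <;> linarith
  · refine .inl (mem_axis_of_unflipPow (n := n) (mem_axis_of_unflip (mem_axis_return ?_ ?_ ?_ ?_))) <;>
      simp only [unflip_zero, unflip_one, unflip_two] <;> linarith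
  · cases n with
    | zero => exact .inr ⟨h1, hn, h0, h2.trans (by rw [slope, if_pos rfl]; rfl)⟩
    | succ n =>
      rw [unflipPow_succ_apply] at h0 h1 h2 hn hn'
      simp only [unflip_zero, unflip_one, unflip_two, slope, if_neg n.succ_ne_zero] at h0 h1 h2 hn hn'
      exact .inl (mem_axis_of_unflipPow (mem_axis_return (by linarith) (by linarith) (by linarith)
        (by linarith)))

theorem legCore_bounds {b : ℝ} {p : R3} (hp : p ∈ legCore b) : -6 < p 0 ∧ p 0 ≤ 0 := by
  obtain rfl | ⟨n, hn, hn', -⟩ := hp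
  · norm_num
  · have : (1 : ℝ) ≤ 2 ^ n := one_le_pow₀ one_le_two
    constructor <;> nlinarith

theorem mem_centreCore {p : R3} (h0 : -4 < p 0) (h0' : p 0 < 4) (hp : p ∈ centreCore) :
    (∃ s, toChain s p ∈ axis) ∨ (p 1 = 0 ∧ p 2 = 6 * (p 0 + 5) / 5) := by
  obtain h | ⟨h1, h0, h2⟩ | ⟨h0, h1, h1', h2⟩ | ⟨h1, h0, h2⟩ | ⟨h1, h0, h2⟩ | ⟨h0, h1, h1', h2⟩ |
    ⟨h1, h0, h2⟩ := hp
  · exact .inr h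
  · refine .inl ⟨true, mem_axis_descent ?_ ?_ ?_ ?_⟩ <;> simp [toChain] <;> linarith
  · refine .inl ⟨true, mem_axis_riser ?_ ?_ ?_ ?_⟩ <;> simp [toChain] <;> linarith
  · refine .inl ⟨true, mem_axis_return ?_ ?_ ?_ ?_⟩ <;> simp [toChain] <;> linarith
  · refine .inl ⟨false, mem_axis_descent ?_ ?_ ?_ ?_⟩ <;> simp [toChain] <;> linarith
  · refine .inl ⟨false, mem_axis_riser ?_ ?_ ?_ ?_⟩ <;> simp [toChain] <;> linarith
  · refine .inl ⟨false, mem_axis_return ?_ ?_ ?_ ?_⟩ <;> simp [toChain] <;> linarith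

/-- The size of a point of the base in the cross-section of the leg, with value `1` at the centre
and `0` at the boundary. -/
def cap (p : R3) : ℝ := 1 - 8 * max |p 0 + 4| |p 2|

/-- The height of a point below the base after stretching the foot. -/
def height (p : R3) : ℝ := max (p 1 + 16) (2 * (p 1 + 16) + cap p)

def legParam (p : R3) : ℝ × ℝ × ℝ := (1 - height p, -(p 0 + 4), p 2)

/-- The embedding of the half-space `p 1 ≤ -16` which grows a wild leg. -/
def grow (p : R3) : R3 := if height p ≤ 0 then !₂[p 0, height p - 16, p 2] else leg 0 (legParam p)

theorem continuous_cap : Continuous cap := by unfold cap; fun_prop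

theorem continuous_height : Continuous height := by
  unfold height
  have := continuous_cap
  fun_prop

theorem continuous_legParam : Continuous legParam := by
  unfold legParam
  have := continuous_height
  fun_prop

theorem cap_congr {p p' : R3} (h0 : p 0 = p' 0) (h2 : p 2 = p' 2) : cap p = cap p' := by
  simp only [cap, h0, h2]

theorem cap_le_one (p : R3) : cap p ≤ 1 := by
  have := (abs_nonneg (p 2)).trans (le_max_right |p 0 + 4| _)
  unfold cap
  linarith

theorem cap_pos {p : R3} (h : 0 < cap p) : |p 0 + 4| < 1 / 8 ∧ |p 2| < 1 / 8 := by
  unfold cap at h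
  exact max_lt_iff.1 (by linarith)

theorem height_of_cap_nonpos {p : R3} (hp : p 1 ≤ -16) (h : cap p ≤ 0) : height p = p 1 + 16 :=
  max_eq_left (by linarith)

theorem legParam_mem {p : R3} (hp : p 1 ≤ -16) (h : 0 ≤ cap p) (h' : 0 ≤ height p) :
    legParam p ∈ params := by
  have hc : height p ≤ 1 - 8 * max |p 0 + 4| |p 2| := max_le (by unfold cap at h; linarith)
    (by unfold cap; linarith)
  refine ⟨by simp only [legParam]; linarith, ?_, ?_⟩
  · have := le_max_left |p 0 + 4| |p 2|
    simp only [legParam, abs_neg]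
    linarith
  · have := le_max_right |p 0 + 4| |p 2|
    simp only [legParam]
    linarith

theorem grow_of_height_nonpos {p : R3} (h : height p ≤ 0) :
    grow p = !₂[p 0, height p - 16, p 2] := if_pos h

theorem grow_of_height_nonneg {p : R3} (h : 0 ≤ height p) : grow p = leg 0 (legParam p) := by
  rcases h.eq_or_lt with h | h
  · rw [grow_of_height_nonpos h.ge, legParam, ← h, sub_zero, leg_one]
    ext i
    fin_cases i <;> simp
  · exact if_neg h.not_ge

theorem cap_pos_of_height_pos {p : R3} (hp : p 1 ≤ -16) (h : 0 < height p) : 0 < cap p := by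
  by_contra! hc
  rw [height_of_cap_nonpos hp hc] at h
  linarith

theorem grow_of_cap_nonpos {p : R3} (hp : p 1 ≤ -16) (h : cap p ≤ 0) : grow p = p := by
  rw [grow_of_height_nonpos, height_of_cap_nonpos hp h]
  · ext i
    fin_cases i <;> simp
  · rw [height_of_cap_nonpos hp h]
    linarith

theorem continuousOn_grow : ContinuousOn grow {p | p 1 ≤ -16} := by
  have h1 : ContinuousOn grow ({p | p 1 ≤ -16} ∩ {p | height p ≤ 0}) := by
    refine ContinuousOn.congr (f := fun p : R3 => !₂[p 0, height p - 16, p 2]) ?_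
      fun p hp => grow_of_height_nonpos hp.2
    have := continuous_height
    fun_prop
  have h2 : ContinuousOn grow ({p | p 1 ≤ -16} ∩ {p | 0 ≤ cap p ∧ 0 ≤ height p}) :=
    ((continuousOn_leg (by norm_num)).comp continuous_legParam.continuousOn
      fun p hp => legParam_mem hp.1 hp.2.1 hp.2.2).congr fun p hp => grow_of_height_nonneg hp.2.2
  have hc : IsClosed {p : R3 | p 1 ≤ -16} := isClosed_le (by fun_prop) continuous_const
  refine (h1.union_of_isClosed h2 (hc.inter (isClosed_le continuous_height continuous_const))
    (hc.inter ((isClosed_le continuous_const continuous_cap).inter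
      (isClosed_le continuous_const continuous_height)))).mono fun p hp => ?_
  rcases le_or_gt (height p) 0 with h | h
  · exact .inl ⟨hp, h⟩
  · exact .inr ⟨hp, (cap_pos_of_height_pos hp h).le, h.le⟩

theorem grow_cases {p : R3} (hp : p 1 ≤ -16) :
    (height p ≤ 0 ∧ grow p 0 = p 0 ∧ p 1 ≤ grow p 1 ∧ grow p 1 ≤ -16 ∧ grow p 2 = p 2) ∨
    (0 < height p ∧ 0 < cap p ∧ -16 < grow p 1 ∧ grow p ∈ leg 0 '' params) := by
  rcases le_or_gt (height p) 0 with h | h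
  · refine .inl ⟨h, ?_⟩
    rw [grow_of_height_nonpos h]
    refine ⟨rfl, ?_, ?_, rfl⟩
    · have : p 1 + 16 ≤ height p := le_max_left _ _
      change p 1 ≤ height p - 16
      linarith
    · change height p - 16 ≤ -16
      linarith
  · have hc := cap_pos_of_height_pos hp h
    have hm := legParam_mem hp hc.le h.le
    refine .inr ⟨h, hc, ?_⟩
    rw [grow_of_height_nonneg h.le]
    exact ⟨lt_leg_of_lt_one hm (by simp only [legParam]; linarith), _, hm, rfl⟩

theorem height_injective {p p' : R3} (h0 : p 0 = p' 0) (h2 : p 2 = p' 2)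
    (h : height p = height p') : p = p' := by
  have h1 : p 1 = p' 1 := by
    unfold height at h
    rw [cap_congr h0 h2] at h
    rcases lt_trichotomy (p 1) (p' 1) with h' | h' | h'
    · exact absurd h (max_lt_max (by linarith) (by linarith)).ne
    · exact h'
    · exact absurd h.symm (max_lt_max (by linarith) (by linarith)).ne
  ext i
  fin_cases i
  exacts [h0, h1, h2]

theorem grow_injOn : InjOn grow {p | p 1 ≤ -16} := by
  intro p hp p' hp' heq
  rcases grow_cases hp with ⟨h, h0, -, h1, h2⟩ | ⟨h, hc, h1, -⟩ <;>
    rcases grow_cases hp' with ⟨h', h0', -, h1', h2'⟩ | ⟨h', hc', h1', -⟩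
  · refine height_injective (by rw [← h0, ← h0', heq]) (by rw [← h2, ← h2', heq]) ?_
    rw [grow_of_height_nonpos h, grow_of_height_nonpos h'] at heq
    simpa using congrArg (fun q : R3 => q 1) heq
  · rw [heq] at h1
    linarith
  · rw [heq] at h1
    linarith
  · rw [grow_of_height_nonneg h.le, grow_of_height_nonneg h'.le] at heq
    have := leg_injOn le_rfl zero_le_one (legParam_mem hp hc.le h.le)
      (legParam_mem hp' hc'.le h'.le) heq
    simp only [legParam, Prod.mk.injEq] at this
    exact height_injective (by linarith) (by linarith) (by linarith)

theorem norm_grow_sub_le {p : R3} (hp : p 1 ≤ -16) : ‖grow p - p‖ ≤ 300 := by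
  have hn := norm_le_abs_add_abs_add_abs (grow p - p)
  rcases le_or_gt (cap p) 0 with hc | hc
  · rw [grow_of_cap_nonpos hp hc]
    norm_num
  rcases grow_cases hp with ⟨h, h0, h1, h1', h2⟩ | ⟨h, -, -, -⟩
  · have : grow p 1 = height p - 16 := by rw [grow_of_height_nonpos h]; rfl
    have hh : height p ≤ p 1 + 17 := max_le (by linarith) (by linarith [cap_le_one p])
    simp only [PiLp.sub_apply, h0, h2, this, sub_self, abs_zero] at hn
    rw [abs_of_nonneg (by linarith)] at hn
    linarith
  · have h1 := abs_leg_le 0 (by norm_num) (legParam_mem hp hc.le h.le)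
    rw [← grow_of_height_nonneg h.le] at h1
    have hr : (legParam p).1 ≤ 1 := by simp only [legParam]; linarith
    have hV : -33 / 2 < p 1 := by
      have : 0 < 2 * (p 1 + 16) + cap p := by
        rcases lt_max_iff.1 h with h | h <;> linarith
      linarith [cap_le_one p]
    obtain ⟨hx, hz⟩ := cap_pos hc
    simp only [PiLp.sub_apply] at hn
    have b0 : |grow p 0 - p 0| ≤ 65 := by
      rw [abs_le] at *; rw [abs_lt] at hx; constructor <;> linarith [h1.1.1, h1.1.2]
    have b1 : |grow p 1 - p 1| ≤ 77 := by
      have := abs_le.1 h1.2.1; rw [abs_le]; constructor <;> linarith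
    have b2 : |grow p 2 - p 2| ≤ 61 := by
      have := abs_le.1 h1.2.2; rw [abs_le]; rw [abs_lt] at hz; constructor <;> linarith
    linarith

theorem exists_grow_eq_of_base {p : R3} (hp : p 1 = -16) :
    ∃ p' : R3, grow p' = p ∧ p' 0 = p 0 ∧ p' 2 = p 2 ∧ -17 ≤ p' 1 ∧ p' 1 ≤ -16 := by
  have hc : cap !₂[p 0, -16 + min 0 (-cap p / 2), p 2] = cap p := cap_congr rfl rfl
  have hh : height !₂[p 0, -16 + min 0 (-cap p / 2), p 2] = 0 := by
    rw [height, hc]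
    change max (-16 + min 0 (-cap p / 2) + 16) (2 * (-16 + min 0 (-cap p / 2) + 16) + cap p) = 0
    rcases le_total (cap p) 0 with h | h
    · rw [min_eq_left (by linarith), max_eq_left (by linarith)]
      norm_num
    · rw [min_eq_right (by linarith), max_eq_right (by linarith)]
      ring
  refine ⟨!₂[p 0, -16 + min 0 (-cap p / 2), p 2], ?_, rfl, rfl, ?_, ?_⟩
  · rw [grow_of_height_nonpos hh.le, hh]
    ext i
    fin_cases i <;> simp [hp]
  · change -17 ≤ -16 + min 0 (-cap p / 2)
    linarith [le_min (show (-1 : ℝ) ≤ 0 by norm_num) (show -1 ≤ -cap p / 2 by linarith [cap_le_one p])]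
  · change -16 + min 0 (-cap p / 2) ≤ -16
    linarith [min_le_left 0 (-cap p / 2)]

theorem exists_grow_eq_of_axis {p : R3} (hp : p ∈ axis) :
    ∃ p' : R3, grow p' = p ∧ 0 < cap p' ∧ p' 0 = -4 ∧ p' 2 = 0 ∧ -17 ≤ p' 1 ∧ p' 1 ≤ -16 := by
  obtain ⟨r, hr, rfl⟩ := hp
  have hc : cap !₂[-4, -16 - r / 2, 0] = 1 := by simp [cap]
  have hh : height !₂[-4, -16 - r / 2, 0] = 1 - r := by
    rw [height, hc]
    change max (-16 - r / 2 + 16) (2 * (-16 - r / 2 + 16) + 1) = 1 - r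
    rw [max_eq_right (by linarith [hr.2])]
    ring
  refine ⟨!₂[-4, -16 - r / 2, 0], ?_, by rw [hc]; exact one_pos, rfl, rfl, ?_, ?_⟩
  · rw [grow_of_height_nonneg (by rw [hh]; linarith [hr.2]), legParam, hh]
    simp
  · change -17 ≤ -16 - r / 2
    linarith [hr.2]
  · change -16 - r / 2 ≤ -16
    linarith [hr.1]

/-- Zooming in on the `i`-th pair of clasped legs. -/
def zoom (i : ℕ) : C(R3, R3) :=
  ⟨fun p => !₂[2 ^ i * p 0 - 40, 2 ^ i * p 1, 2 ^ i * p 2], by fun_prop⟩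

def zoomInv (i : ℕ) : C(R3, R3) :=
  ⟨fun p => !₂[(p 0 + 40) / 2 ^ i, p 1 / 2 ^ i, p 2 / 2 ^ i], by fun_prop⟩

theorem zoom_zero (i : ℕ) (p : R3) : zoom i p 0 = 2 ^ i * p 0 - 40 := rfl
theorem zoom_one (i : ℕ) (p : R3) : zoom i p 1 = 2 ^ i * p 1 := rfl
theorem zoom_two (i : ℕ) (p : R3) : zoom i p 2 = 2 ^ i * p 2 := rfl

theorem zoom_zoomInv (i : ℕ) (p : R3) : zoom i (zoomInv i p) = p := by
  ext j
  fin_cases j <;> simp [zoom, zoomInv] <;> field_simp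
  ring

theorem zoomInv_zoom (i : ℕ) (p : R3) : zoomInv i (zoom i p) = p := by
  ext j
  fin_cases j <;> simp [zoom, zoomInv]

def fromChain : Bool → C(R3, R3)
  | true => ⟨fun p => !₂[p 0 + 9, p 1 + 16, p 2 + 12], by fun_prop⟩
  | false => ⟨fun p => !₂[-p 0 - 9, 7 / 6 * (p 1 + 16), p 2 / 2], by fun_prop⟩

theorem toChain_fromChain (s : Bool) (p : R3) : toChain s (fromChain s p) = p := by
  ext j
  cases s <;> fin_cases j <;> simp [toChain, fromChain] <;> ring

theorem fromChain_toChain (s : Bool) (p : R3) : fromChain s (toChain s p) = p := by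
  ext j
  cases s <;> fin_cases j <;> simp [toChain, fromChain] <;> ring

/-- The coordinates adapted to a leg. -/
def chart (k : ℕ × Bool) : C(R3, R3) := (toChain k.2).comp (zoom k.1)

def place (k : ℕ × Bool) : C(R3, R3) := (zoomInv k.1).comp (fromChain k.2)

theorem chart_apply (k : ℕ × Bool) (p : R3) : chart k p = toChain k.2 (zoom k.1 p) := rfl

theorem chart_place (k : ℕ × Bool) (p : R3) : chart k (place k p) = p := by
  change toChain k.2 (zoom k.1 (zoomInv k.1 (fromChain k.2 p))) = p
  rw [zoom_zoomInv, toChain_fromChain]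

theorem place_chart (k : ℕ × Bool) (p : R3) : place k (chart k p) = p := by
  change zoomInv k.1 (fromChain k.2 (toChain k.2 (zoom k.1 p))) = p
  rw [fromChain_toChain, zoomInv_zoom]

/-- The coordinates of a point of `ℝ³` in the chart of a leg are affine functions of the
individual coordinates. -/
theorem exists_chart_eq (k : ℕ × Bool) : ∃ u v w z : ℝ, 0 < v ∧ 2 ^ k.1 * (6 / 7) ≤ v ∧
    2 ^ k.1 ≤ |u| ∧ 2 ^ k.1 ≤ w ∧ (k.2 = true ∧ u = 2 ^ k.1 ∨ k.2 = false ∧ u = -2 ^ k.1) ∧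
    ∀ p : R3, chart k p 0 = u * p 0 + (if k.2 then -49 else 31) ∧ chart k p 1 = v * p 1 - 16 ∧
      chart k p 2 = w * p 2 + z := by
  have h2 : (0 : ℝ) < 2 ^ k.1 := by positivity
  obtain ⟨i, s | s⟩ := k
  · refine ⟨-2 ^ i, 6 / 7 * 2 ^ i, 2 * 2 ^ i, 0, by positivity, by linarith, by
      rw [abs_neg, abs_of_pos h2], by linarith, .inr ⟨rfl, rfl⟩, fun p => ?_⟩
    simp only [chart_apply, toChain, zoom, ContinuousMap.coe_mk, Matrix.cons_val_zero, PiLp.toLp_apply,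
      Matrix.cons_val_one, Matrix.cons_val]
    refine ⟨?_, ?_, ?_⟩ <;> norm_num <;> ring
  · refine ⟨2 ^ i, 2 ^ i, 2 ^ i, -12, by positivity, by linarith, by
      rw [abs_of_pos h2], by linarith, .inl ⟨rfl, rfl⟩, fun p => ?_⟩
    simp only [chart_apply, toChain, zoom, ContinuousMap.coe_mk, Matrix.cons_val_zero, PiLp.toLp_apply,
      Matrix.cons_val_one, Matrix.cons_val]
    refine ⟨?_, ?_, ?_⟩ <;> norm_num <;> ring

theorem scale_unique {i j : ℕ} {x : ℝ} (h1 : 30 < 2 ^ i * x) (h2 : 2 ^ i * x < 50)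
    (h3 : 30 < 2 ^ j * x) (h4 : 2 ^ j * x < 50) : i = j := by
  wlog h : i ≤ j generalizing i j
  · exact (this h3 h4 h1 h2 (le_of_not_ge h)).symm
  by_contra hne
  have hx : 0 < x := pos_of_mul_pos_right (by linarith) (by positivity : (0 : ℝ) ≤ 2 ^ i)
  have : (2 : ℝ) ^ (i + 1) ≤ 2 ^ j := pow_le_pow_right₀ one_le_two (by omega)
  rw [pow_succ] at this
  nlinarith

theorem scale_bounds {k : ℕ × Bool} {p : R3} (h : -11 < chart k p 0) (h' : chart k p 0 ≤ 0) :
    30 < 2 ^ k.1 * p 0 ∧ 2 ^ k.1 * p 0 < 50 := by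
  obtain ⟨u, v, w, z, -, -, -, -, hu, hc⟩ := exists_chart_eq k
  rw [(hc p).1] at h h'
  rcases hu with ⟨hs, rfl⟩ | ⟨hs, rfl⟩ <;> simp only [hs, if_true, Bool.false_eq_true, if_false] at h h' <;>
    constructor <;> linarith

theorem chart_fst_congr {k : ℕ × Bool} {p p' : R3} (h : p 0 = p' 0) : chart k p 0 = chart k p' 0 := by
  obtain ⟨u, v, w, z, -, -, -, -, -, hc⟩ := exists_chart_eq k
  rw [(hc p).1, (hc p').1, h]

theorem cap_chart_congr {k : ℕ × Bool} {p p' : R3} (h0 : p 0 = p' 0) (h2 : p 2 = p' 2) :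
    cap (chart k p) = cap (chart k p') := by
  obtain ⟨u, v, w, z, -, -, -, -, -, hc⟩ := exists_chart_eq k
  exact cap_congr (chart_fst_congr h0) (by rw [(hc p).2.2, (hc p').2.2, h2])

theorem chart_one_le {k : ℕ × Bool} {p : R3} : chart k p 1 ≤ -16 ↔ p 1 ≤ 0 := by
  obtain ⟨u, v, w, z, hv, -, -, -, -, hc⟩ := exists_chart_eq k
  rw [(hc p).2.1]
  constructor <;> intro h <;> nlinarith

theorem chart_one_le_chart_one {k : ℕ × Bool} {p p' : R3} :
    chart k p 1 ≤ chart k p' 1 ↔ p 1 ≤ p' 1 := by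
  obtain ⟨u, v, w, z, hv, -, -, -, -, hc⟩ := exists_chart_eq k
  rw [(hc p).2.1, (hc p').2.1]
  constructor <;> intro h <;> nlinarith

theorem chart_zero_inj {k : ℕ × Bool} {p p' : R3} (h : chart k p 0 = chart k p' 0) :
    p 0 = p' 0 := by
  obtain ⟨u, v, w, z, -, -, hu, -, -, hc⟩ := exists_chart_eq k
  rw [(hc p).1, (hc p').1] at h
  have : u ≠ 0 := by
    rintro rfl
    have : (0 : ℝ) < 2 ^ k.1 := by positivity
    rw [abs_zero] at hu
    linarith
  exact mul_left_cancel₀ this (by linarith)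

theorem chart_two_inj {k : ℕ × Bool} {p p' : R3} (h : chart k p 2 = chart k p' 2) :
    p 2 = p' 2 := by
  obtain ⟨u, v, w, z, -, -, -, hw, -, hc⟩ := exists_chart_eq k
  rw [(hc p).2.2, (hc p').2.2] at h
  have : w ≠ 0 := by
    have : (0 : ℝ) < 2 ^ k.1 := by positivity
    exact (this.trans_le hw).ne'
  exact mul_left_cancel₀ this (by linarith)

/-- Different legs have disjoint feet. -/
theorem foot_unique {k k' : ℕ × Bool} {p : R3} (h : 0 < cap (chart k p))
    (h' : 0 < cap (chart k' p)) : k = k' := by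
  have hb := abs_lt.1 (cap_pos h).1
  have hb' := abs_lt.1 (cap_pos h').1
  have hs := scale_bounds (k := k) (p := p) (by linarith) (by linarith)
  have hs' := scale_bounds (k := k') (p := p) (by linarith) (by linarith)
  have hi := scale_unique hs.1 hs.2 hs'.1 hs'.2
  obtain ⟨u, v, w, z, -, -, -, -, hu, hc⟩ := exists_chart_eq k
  obtain ⟨u', v', w', z', -, -, -, -, hu', hc'⟩ := exists_chart_eq k'
  rw [(hc p).1] at hb
  rw [(hc' p).1] at hb'
  rw [← hi] at hu'
  refine Prod.ext hi ?_
  rcases hu with ⟨e, rfl⟩ | ⟨e, rfl⟩ <;> rcases hu' with ⟨e', rfl⟩ | ⟨e', rfl⟩ <;> rw [e, e']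
  all_goals
    simp only [e, e', if_true, Bool.false_eq_true, if_false] at hb hb'
    exfalso
    linarith

/-- Clasped legs are disjoint. -/
theorem clasp_disjoint {p : R3} (h : toChain true p ∈ leg 0 '' params)
    (h' : toChain false p ∈ leg 0 '' params) : False := by
  have hX : toChain false p 0 = -18 - toChain true p 0 := by
    change -p 0 - 9 = -18 - (p 0 - 9)
    ring
  have hY : toChain false p 1 + 16 = 6 / 7 * (toChain true p 1 + 16) := by
    change 6 / 7 * p 1 - 16 + 16 = 6 / 7 * (p 1 - 16 + 16)
    ring
  have hZ : toChain false p 2 = 2 * toChain true p 2 + 24 := by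
    change 2 * p 2 = 2 * (p 2 - 12) + 24
    ring
  obtain ⟨q, hq, hqe⟩ := h
  obtain ⟨q', hq', hqe'⟩ := h'
  rw [← hqe, ← hqe'] at hX hY hZ
  have hb := leg_bounds 0 (by norm_num) hq
  have hb' := leg_bounds 0 (by norm_num) hq'
  obtain ⟨-, k, c, hc0, hc1, -, hk⟩ := (leg_cases 0 hq).resolve_right fun H => by
    linarith [H.2.1.1, hb'.1.1]
  obtain ⟨-, k', c', hc0', hc1', -, hk'⟩ := (leg_cases 0 hq').resolve_right fun H => by
    linarith [H.2.1.1, hb.1.1]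
  have hn := hk.near (by norm_num) hc0 hc1.le (hq.2.1.trans (by linarith [hq.1]))
    (hq.2.2.trans (by linarith [hq.1]))
  have hn' := hk'.near (by norm_num) hc0' hc1'.le (hq'.2.1.trans (by linarith [hq'.1]))
    (hq'.2.2.trans (by linarith [hq'.1]))
  clear hk hk'
  generalize leg 0 q 0 = X at *
  generalize leg 0 q 1 = Y at *
  generalize leg 0 q 2 = Z at *
  generalize leg 0 q' 0 = X' at *
  generalize leg 0 q' 1 = Y' at *
  generalize leg 0 q' 2 = Z' at *
  fin_cases k <;> fin_cases k' <;> simp only [Near, abs_le] at hn hn' <;> linarith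

theorem leg_unique {k k' : ℕ × Bool} {p : R3} (h : chart k p ∈ leg 0 '' params)
    (h' : chart k' p ∈ leg 0 '' params) : k = k' := by
  have hsc : ∀ {k : ℕ × Bool}, chart k p ∈ leg 0 '' params →
      30 < 2 ^ k.1 * p 0 ∧ 2 ^ k.1 * p 0 < 50 := by
    rintro k ⟨q, hq, he⟩
    have hb := leg_bounds 0 (by norm_num) hq
    rw [he] at hb
    exact scale_bounds (by linarith [hb.1.1]) hb.1.2
  have hi := scale_unique (hsc h).1 (hsc h).2 (hsc h').1 (hsc h').2
  obtain ⟨i, s⟩ := k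
  obtain ⟨j, s'⟩ := k'
  obtain rfl : i = j := hi
  rw [chart_apply] at h h'
  cases s <;> cases s'
  exacts [rfl, (clasp_disjoint h' h).elim, (clasp_disjoint h h').elim, rfl]

/-- The displacement of the map growing a single leg. -/
def bump (k : ℕ × Bool) (p : R3) : R3 := place k (grow (chart k p)) - p

/-- The embedding growing all legs. -/
def growAll (p : R3) : R3 := p + ∑' k, bump k p

theorem bump_of_cap_nonpos {k : ℕ × Bool} {p : R3} (hp : p 1 ≤ 0) (h : cap (chart k p) ≤ 0) :
    bump k p = 0 := by
  rw [bump, grow_of_cap_nonpos (chart_one_le.2 hp) h, place_chart, sub_self]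

theorem growAll_of_cap_nonpos {p : R3} (hp : p 1 ≤ 0) (h : ∀ k, cap (chart k p) ≤ 0) :
    growAll p = p := by
  simp only [growAll, fun k => bump_of_cap_nonpos hp (h k), tsum_zero, add_zero]

theorem growAll_of_cap_pos {k : ℕ × Bool} {p : R3} (hp : p 1 ≤ 0) (h : 0 < cap (chart k p)) :
    growAll p = place k (grow (chart k p)) := by
  rw [growAll, tsum_eq_single k fun k' hk' => bump_of_cap_nonpos hp
    (not_lt.1 fun h' => hk' (foot_unique h' h)), bump, add_sub_cancel]

theorem chart_growAll {k : ℕ × Bool} {p : R3} (hp : p 1 ≤ 0) (h : 0 < cap (chart k p)) :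
    chart k (growAll p) = grow (chart k p) := by
  rw [growAll_of_cap_pos hp h, chart_place]

theorem norm_place_sub_le (k : ℕ × Bool) (p p' : R3) :
    ‖place k p - place k p'‖ ≤ 4 * ‖p - p'‖ * (1 / 2) ^ k.1 := by
  have h2 : (0 : ℝ) < 2 ^ k.1 := by positivity
  have h : ∀ j : Fin 3, |place k p j - place k p' j| ≤ 7 / 6 * |p j - p' j| / 2 ^ k.1 := by
    obtain ⟨i, s⟩ := k
    have key : ∀ x y c : ℝ, |c| ≤ 7 / 6 → x = c * y / 2 ^ i → |x| ≤ 7 / 6 * |y| / 2 ^ i := by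
      rintro x y c hc rfl
      rw [abs_div, abs_mul, abs_of_pos (show (0 : ℝ) < 2 ^ i by positivity)]
      gcongr
    intro j
    cases s
    · fin_cases j
      · refine key _ _ (-1) (by norm_num [abs_le]) ?_
        simp [place, zoomInv, fromChain]; ring
      · refine key _ _ (7 / 6) (by norm_num [abs_le]) ?_
        simp [place, zoomInv, fromChain]; ring
      · refine key _ _ (1 / 2) (by norm_num [abs_le]) ?_
        simp [place, zoomInv, fromChain]; ring
    · fin_cases j <;> refine key _ _ 1 (by norm_num [abs_le]) ?_ <;>
        simp [place, zoomInv, fromChain] <;> ring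
  have hn := norm_le_abs_add_abs_add_abs (place k p - place k p')
  simp only [PiLp.sub_apply] at hn
  have ha : ∀ j : Fin 3, |place k p j - place k p' j| ≤ 7 / 6 * ‖p - p'‖ / 2 ^ k.1 := fun j =>
    (h j).trans (by gcongr; exact abs_coord_le_norm (p - p') j)
  have h0 := ha 0
  have h1 := ha 1
  have h3 := ha 2
  have : 0 ≤ ‖p - p'‖ / 2 ^ k.1 := by positivity
  rw [one_div, inv_pow, ← div_eq_mul_inv, mul_div_assoc]
  rw [mul_div_assoc] at h0 h1 h3
  linarith

theorem norm_bump_le (k : ℕ × Bool) {p : R3} (hp : p 1 ≤ 0) :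
    ‖bump k p‖ ≤ 1200 * (1 / 2) ^ k.1 := by
  have h := norm_place_sub_le k (grow (chart k p)) (chart k p)
  rw [place_chart] at h
  refine h.trans ?_
  have := norm_grow_sub_le (chart_one_le.2 hp : chart k p 1 ≤ -16)
  gcongr
  linarith

theorem continuousOn_bump (k : ℕ × Bool) : ContinuousOn (bump k) {p | p 1 ≤ 0} :=
  ((place k).continuous.comp_continuousOn (continuousOn_grow.comp (chart k).continuous.continuousOn
    fun _ hp => chart_one_le.2 hp)).sub continuousOn_id

theorem continuousOn_growAll : ContinuousOn growAll {p | p 1 ≤ 0} := by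
  refine continuousOn_id.add (continuousOn_tsum (u := fun k : ℕ × Bool => 1200 * (1 / 2) ^ k.1)
    continuousOn_bump ?_ fun k p hp => norm_bump_le k hp)
  refine Summable.mul_left _ ?_
  have := Summable.mul_of_nonneg summable_geometric_two (summable_of_hasFiniteSupport (toFinite _) :
    Summable fun _ : Bool => (1 : ℝ)) (fun i => by positivity) (fun _ => zero_le_one)
  simpa using this

theorem growAll_cases {p : R3} (hp : p 1 ≤ 0) :
    (growAll p 0 = p 0 ∧ p 1 ≤ growAll p 1 ∧ growAll p 1 ≤ 0 ∧ growAll p 2 = p 2) ∨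
    (0 < growAll p 1 ∧ ∃ k, 0 < cap (chart k p) ∧ chart k (growAll p) ∈ leg 0 '' params) := by
  by_cases h : ∃ k, 0 < cap (chart k p)
  · obtain ⟨k, hk⟩ := h
    rcases grow_cases (chart_one_le.2 hp : chart k p 1 ≤ -16) with
      ⟨-, h0, h1, h1', h2⟩ | ⟨-, -, h1, hl⟩ <;> rw [← chart_growAll hp hk] at *
    · exact .inl ⟨chart_zero_inj h0, chart_one_le_chart_one.1 h1, chart_one_le.1 h1',
        chart_two_inj h2⟩
    · exact .inr ⟨lt_of_not_ge fun H => (chart_one_le.2 H).not_gt h1, k, hk, hl⟩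
  · push Not at h
    rw [growAll_of_cap_nonpos hp h]
    exact .inl ⟨rfl, le_rfl, hp, rfl⟩

theorem growAll_injOn : InjOn growAll {p | p 1 ≤ 0} := by
  intro p hp p' hp' heq
  have key : ∀ k, 0 < cap (chart k p) → 0 < cap (chart k p') → p = p' := by
    intro k hk hk'
    have := grow_injOn (chart_one_le.2 hp) (chart_one_le.2 hp')
      (by rw [← chart_growAll hp hk, ← chart_growAll hp' hk', heq])
    rw [← place_chart k p, this, place_chart]
  rcases growAll_cases hp with ⟨h0, -, h1, h2⟩ | ⟨h1, k, hk, hl⟩ <;>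
    rcases growAll_cases hp' with ⟨h0', -, h1', h2'⟩ | ⟨h1', k', hk', hl'⟩
  · have e0 : p 0 = p' 0 := by rw [← h0, ← h0', heq]
    have e2 : p 2 = p' 2 := by rw [← h2, ← h2', heq]
    by_cases h : ∃ k, 0 < cap (chart k p)
    · obtain ⟨k, hk⟩ := h
      exact key k hk (cap_chart_congr e0 e2 ▸ hk)
    · push Not at h
      rw [← growAll_of_cap_nonpos hp h, heq,
        growAll_of_cap_nonpos hp' fun k => (cap_chart_congr e0 e2).symm.trans_le (h k)]
  · rw [heq] at h1
    exact absurd h1 h1'.not_ge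
  · rw [heq] at h1
    exact absurd h1' h1.not_ge
  · rw [heq] at hl
    obtain rfl := leg_unique hl hl'
    exact key k hk hk'

/-- The box to which the legs are attached. -/
def box : Set R3 := {p | p 1 ≤ 0} ∩ {p | -100 ≤ p 0 ∧ p 0 ≤ 100 ∧ -100 ≤ p 1 ∧ -100 ≤ p 2 ∧ p 2 ≤ 100}

theorem isClosed_box : IsClosed box := by
  have h : ∀ j : Fin 3, Continuous fun p : R3 => p j := fun j => by fun_prop
  exact (isClosed_le (h 1) continuous_const).inter ((isClosed_le continuous_const (h 0)).inter
    ((isClosed_le (h 0) continuous_const).inter ((isClosed_le continuous_const (h 1)).inter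
      ((isClosed_le continuous_const (h 2)).inter (isClosed_le (h 2) continuous_const)))))

theorem isBounded_box : Bornology.IsBounded box := by
  refine isBounded_iff_forall_norm_le.2 ⟨300, fun p hp => ?_⟩
  obtain ⟨h1, h2, h3, h4, h5, h6⟩ := hp
  have h1 : p 1 ≤ 0 := h1
  have a0 : |p 0| ≤ 100 := abs_le.2 ⟨h2, h3⟩
  have a1 : |p 1| ≤ 100 := abs_le.2 ⟨h4, by linarith⟩
  have a2 : |p 2| ≤ 100 := abs_le.2 ⟨h5, h6⟩
  linarith [norm_le_abs_add_abs_add_abs p]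

theorem convex_box : Convex ℝ box := by
  have h : ∀ j : Fin 3, IsLinearMap ℝ fun p : R3 => p j := fun j =>
    ⟨fun _ _ => rfl, fun _ _ => rfl⟩
  exact (convex_halfSpace_le (h 1) _).inter ((convex_halfSpace_ge (h 0) _).inter
    ((convex_halfSpace_le (h 0) _).inter ((convex_halfSpace_ge (h 1) _).inter
      ((convex_halfSpace_ge (h 2) _).inter (convex_halfSpace_le (h 2) _)))))

theorem interior_box_nonempty : (interior box).Nonempty := by
  have h : ∀ j : Fin 3, Continuous fun p : R3 => p j := fun j => by fun_prop
  have ho : IsOpen ({p : R3 | p 1 < 0} ∩ {p | -100 < p 0 ∧ p 0 < 100 ∧ -100 < p 1 ∧ -100 < p 2 ∧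
      p 2 < 100}) :=
    (isOpen_lt (h 1) continuous_const).inter ((isOpen_lt continuous_const (h 0)).inter
    ((isOpen_lt (h 0) continuous_const).inter ((isOpen_lt continuous_const (h 1)).inter
      ((isOpen_lt continuous_const (h 2)).inter (isOpen_lt (h 2) continuous_const)))))
  refine ⟨!₂[0, -1, 0], interior_maximal ?_ ho ?_⟩
  · exact fun p hp => ⟨(show p 1 < 0 from hp.1).le, hp.2.1.le, hp.2.2.1.le, hp.2.2.2.1.le, hp.2.2.2.2.1.le,
      hp.2.2.2.2.2.le⟩
  · simp only [mem_inter_iff, mem_ofPred_eq, Matrix.cons_val_zero, Matrix.cons_val_one,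
      Matrix.cons_val]
    norm_num

theorem isCompact_box : IsCompact box := Metric.isCompact_of_isClosed_isBounded isClosed_box isBounded_box

theorem nonempty_box_homeomorph : Nonempty (box ≃ₜ Metric.closedBall (0 : R3) 1) := by
  obtain ⟨h, -, hc, -⟩ := exists_homeomorph_image_interior_closure_frontier_eq_unitBall convex_box
    interior_box_nonempty isBounded_box
  rw [isClosed_box.closure_eq] at hc
  exact ⟨(h.image box).trans (Homeomorph.setCongr hc)⟩

/-- The ball with wild legs. -/
def wildBall : Set R3 := growAll '' box

theorem isCompact_wildBall : IsCompact wildBall :=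
  isCompact_box.image_of_continuousOn (continuousOn_growAll.mono inter_subset_left)

theorem nonempty_wildBall_homeomorph : Nonempty (wildBall ≃ₜ Metric.closedBall (0 : R3) 1) := by
  obtain ⟨e⟩ := nonempty_box_homeomorph
  have hc : Continuous (box.domRestrict growAll) :=
    (continuousOn_growAll.mono inter_subset_left).domRestrict
  have hi : Function.Injective (box.domRestrict growAll) :=
    (growAll_injOn.mono inter_subset_left).injective
  have := isCompact_iff_compactSpace.1 isCompact_box
  have e' : box ≃ₜ range (box.domRestrict growAll) :=
    (hc.isClosedEmbedding hi).isEmbedding.toHomeomorph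
  exact ⟨((Homeomorph.setCongr (range_domRestrict growAll box).symm).trans e'.symm).trans e⟩

theorem neg_hundred_le {k : ℕ × Bool} {p : R3} (h : -17 ≤ chart k p 1) : -100 ≤ p 1 := by
  obtain ⟨u, v, w, z, hv, hv', -, -, -, hc⟩ := exists_chart_eq k
  rw [(hc p).2.1] at h
  have : (1 : ℝ) ≤ 2 ^ k.1 := one_le_pow₀ one_le_two
  by_contra! hp
  nlinarith

theorem abs_le_of_two_pow_mul {i : ℕ} {x : ℝ} (h : -100 ≤ 2 ^ i * x) (h' : 2 ^ i * x ≤ 100) :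
    -100 ≤ x ∧ x ≤ 100 := by
  have : (1 : ℝ) ≤ 2 ^ i := one_le_pow₀ one_le_two
  constructor <;> nlinarith

theorem mem_wildBall_of_base {p : R3} (h1 : p 1 = 0) (h0 : -100 ≤ p 0 ∧ p 0 ≤ 100)
    (h2 : -100 ≤ p 2 ∧ p 2 ≤ 100) : p ∈ wildBall := by
  by_cases h : ∃ k, 0 < cap (chart k p)
  · obtain ⟨k, hk⟩ := h
    have hb : chart k p 1 = -16 := by
      obtain ⟨u, v, w, z, -, -, -, -, -, hc⟩ := exists_chart_eq k
      rw [(hc p).2.1, h1]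
      ring
    obtain ⟨p', he, hp0, hp2, hp1, hp1'⟩ := exists_grow_eq_of_base hb
    rw [← chart_place k p'] at hp0 hp1 hp1' hp2
    have hq : place k p' 1 ≤ 0 := chart_one_le.1 hp1'
    have e0 := chart_zero_inj hp0
    have e2 := chart_two_inj hp2
    refine ⟨place k p', ⟨hq, ?_⟩, ?_⟩
    · change -100 ≤ place k p' 0 ∧ place k p' 0 ≤ 100 ∧ -100 ≤ place k p' 1 ∧
        -100 ≤ place k p' 2 ∧ place k p' 2 ≤ 100
      rw [e0, e2]
      exact ⟨h0.1, h0.2, neg_hundred_le hp1, h2⟩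
    · rw [growAll_of_cap_pos (k := k) hq (by rwa [cap_congr hp0 hp2]), chart_place, he, place_chart]
  · push Not at h
    refine ⟨p, ⟨h1.le, h0.1, h0.2, ?_, h2⟩, growAll_of_cap_nonpos h1.le h⟩
    rw [h1]
    norm_num

theorem mem_wildBall_of_axis {k : ℕ × Bool} {p : R3} (h : chart k p ∈ axis) : p ∈ wildBall := by
  obtain ⟨p', he, hcap, hp0, hp2, hp1, hp1'⟩ := exists_grow_eq_of_axis h
  obtain ⟨q, rfl⟩ : ∃ q, chart k q = p' := ⟨_, chart_place k p'⟩
  have hq : q 1 ≤ 0 := chart_one_le.1 hp1'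
  have hs := scale_bounds (k := k) (p := q) (by linarith) (by linarith)
  have h0 := abs_le_of_two_pow_mul (by linarith : -100 ≤ 2 ^ k.1 * q 0) (by linarith)
  have h2 : -100 ≤ q 2 ∧ q 2 ≤ 100 := by
    obtain ⟨i, s⟩ := k
    cases s
    · have : 2 * (2 ^ i * q 2) = 0 := hp2
      exact abs_le_of_two_pow_mul (i := i) (by linarith) (by linarith)
    · have : 2 ^ i * q 2 - 12 = 0 := hp2
      exact abs_le_of_two_pow_mul (i := i) (by linarith) (by linarith)
  refine ⟨q, ⟨hq, h0.1, h0.2, neg_hundred_le hp1, h2⟩, ?_⟩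
  rw [growAll_of_cap_pos hq hcap, he, place_chart]

/-- The bundle over the complement of the `i`-th pair of legs. -/
def cocycle (i : ℕ) : Cocycle R3 (Option (Bool × Option ℕ) × Fin 3) (Equiv.Perm (Fin 5)) :=
  permColouring.cocycle.comap (zoom i) univ isOpen_univ (zoom i).continuous.continuousOn

theorem zoom_mem_of_mem_compl_dom {i : ℕ} {p : R3} (hp : p ∈ (cocycle i).domᶜ) :
    (-4 < zoom i p 0 ∧ zoom i p 0 < 4 ∧ zoom i p ∈ centreCore) ∨
      ∃ s, chart (i, s) p ∈ legCore (footSlope s) := by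
  have h : zoom i p ∈ permColouring.cocycle.domᶜ := fun h => by
    obtain ⟨j, hj⟩ := mem_iUnion.1 h
    exact hp (mem_iUnion.2 ⟨j, mem_univ _, hj⟩)
  rcases permColouring.compl_dom_cocycle_subset h with h | h
  · exact .inl h
  · exact .inr (mem_iUnion.1 h)

theorem compl_dom_subset_wildBall (i : ℕ) : (cocycle i).domᶜ ⊆ wildBall := by
  intro p hp
  have h2 : (2 : ℝ) ^ i ≠ 0 := by positivity
  rcases zoom_mem_of_mem_compl_dom hp with ⟨h0, h0', hz⟩ | ⟨s, hs⟩
  · rcases mem_centreCore h0 h0' hz with ⟨s, hs⟩ | ⟨h1, hz⟩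
    · exact mem_wildBall_of_axis (k := (i, s)) hs
    · rw [zoom_zero] at h0 h0' hz
      rw [zoom_two] at hz
      rw [zoom_one] at h1
      exact mem_wildBall_of_base ((mul_eq_zero.1 h1).resolve_left h2)
        (abs_le_of_two_pow_mul (i := i) (by linarith) (by linarith))
        (abs_le_of_two_pow_mul (i := i) (by linarith) (by linarith))
  · rcases mem_axis_or_of_mem_legCore hs with hs | ⟨h1, h0, h0', hz⟩
    · exact mem_wildBall_of_axis hs
    · cases s
      · have e0 : chart (i, false) p 0 = -(2 ^ i * p 0 - 40) - 9 := rfl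
        have e1 : chart (i, false) p 1 = 6 / 7 * (2 ^ i * p 1) - 16 := rfl
        have e2 : chart (i, false) p 2 = 2 * (2 ^ i * p 2) := rfl
        rw [e0] at h0 h0' hz
        rw [e1] at h1
        rw [e2, footSlope] at hz
        refine mem_wildBall_of_base ((mul_eq_zero.1 (by linarith : 2 ^ i * p 1 = 0)).resolve_left h2)
          (abs_le_of_two_pow_mul (i := i) (by linarith) (by linarith))
          (abs_le_of_two_pow_mul (i := i) (by linarith) (by linarith))
      · have e0 : chart (i, true) p 0 = 2 ^ i * p 0 - 40 - 9 := rfl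
        have e1 : chart (i, true) p 1 = 2 ^ i * p 1 - 16 := rfl
        have e2 : chart (i, true) p 2 = 2 ^ i * p 2 - 12 := rfl
        rw [e0] at h0 h0' hz
        rw [e1] at h1
        rw [e2, footSlope] at hz
        refine mem_wildBall_of_base ((mul_eq_zero.1 (by linarith : 2 ^ i * p 1 = 0)).resolve_left h2)
          (abs_le_of_two_pow_mul (i := i) (by linarith) (by linarith))
          (abs_le_of_two_pow_mul (i := i) (by linarith) (by linarith))

/-- The slab containing the `i`-th pair of legs. -/
def slab (i : ℕ) : Set R3 := {p | 30 < 2 ^ i * p 0} ∩ {p | 2 ^ i * p 0 < 50}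

theorem isOpen_slab (i : ℕ) : IsOpen (slab i) :=
  (isOpen_lt continuous_const (by fun_prop)).inter (isOpen_lt (by fun_prop) continuous_const)

theorem convex_slab (i : ℕ) : Convex ℝ (slab i) := by
  have h : IsLinearMap ℝ fun p : R3 => 2 ^ i * p 0 :=
    ⟨fun _ _ => mul_add _ _ _, fun c p => mul_left_comm _ c _⟩
  exact (convex_halfSpace_gt h _).inter (convex_halfSpace_lt h _)

theorem slab_disjoint (i j : ℕ) (h : i ≠ j) : Disjoint (slab i) (slab j) :=
  disjoint_left.2 fun _ hp hp' => h (scale_unique hp.1 hp.2 hp'.1 hp'.2)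

theorem compl_dom_subset_slab (i : ℕ) : (cocycle i).domᶜ ⊆ slab i := by
  intro p hp
  rcases zoom_mem_of_mem_compl_dom hp with ⟨h0, h0', -⟩ | ⟨s, hs⟩
  · rw [zoom_zero] at h0 h0'
    exact ⟨show 30 < 2 ^ i * p 0 by linarith, show 2 ^ i * p 0 < 50 by linarith⟩
  · have hb := legCore_bounds hs
    exact scale_bounds (k := (i, s)) (by linarith [hb.1]) hb.2

/-- A loop linking the `i`-th pair of legs which is far from the ball. -/
def link (i : ℕ) : Set R3 := zoom i ⁻¹' loop (400 * 2 ^ i) (400 * 2 ^ i)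

theorem isCompact_link (i : ℕ) : IsCompact (link i) := by
  have h : link i = zoomInv i '' loop (400 * 2 ^ i) (400 * 2 ^ i) := by
    ext p
    constructor
    · exact fun hp => ⟨_, hp, zoomInv_zoom i p⟩
    · rintro ⟨q, hq, rfl⟩
      rwa [link, mem_preimage, zoom_zoomInv]
  rw [h]
  exact ((isCompact_arc _ _).union (isCompact_arc _ _)).image (zoomInv i).continuous

theorem coords_of_mem_link {i : ℕ} {p : R3} (hp : p ∈ link i) : zoom i p 0 = 0 ∧
    zoom i p 1 ≤ 4 ∧ (0 < p 1 ∨ p 1 < -100 ∨ 100 < |p 2|) := by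
  have h2 : (0 : ℝ) < 2 ^ i := by positivity
  obtain ⟨σ, hσ, hp⟩ : ∃ σ : ℝ, |σ| = 1 ∧ zoom i p ∈ WildLeg.arc (σ * (400 * 2 ^ i)) (400 * 2 ^ i) := by
    rcases hp with hp | hp
    · exact ⟨1, abs_one, by rwa [one_mul]⟩
    · exact ⟨-1, by norm_num, by rwa [neg_one_mul]⟩
  obtain ⟨h0, t, ht0, ht1, h1, hz⟩ := coords_of_mem_arc hp
  refine ⟨h0, ?_, ?_⟩
  · rcases h1 with h1 | h1
    · linarith
    · have : 0 ≤ 400 * 2 ^ i * t := by positivity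
      linarith
  · rw [zoom_two] at hz
    rw [zoom_one] at h1
    have hz : p 2 = (1 - t) * σ * 400 := mul_left_cancel₀ h2.ne' (by linarith)
    have hz' : |p 2| = (1 - t) * 400 := by
      rw [hz, abs_mul, abs_mul, hσ, abs_of_nonneg (sub_nonneg.2 ht1)]
      norm_num
    rcases h1 with h1 | h1
    · rcases ht0.eq_or_lt with rfl | ht0
      · exact .inr (.inr (by rw [hz']; norm_num))
      · exact .inl (pos_of_mul_pos_right (by linarith) h2.le)
    · have h1 : p 1 = -400 * t := mul_left_cancel₀ h2.ne' (by linarith)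
      rcases lt_or_ge (1 / 4) t with h | h
      · exact .inr (.inl (by linarith))
      · exact .inr (.inr (by linarith))

theorem link_subset_slab (i : ℕ) : link i ⊆ slab i := by
  intro p hp
  have h0 := (coords_of_mem_link hp).1
  rw [zoom_zero] at h0
  exact ⟨show 30 < 2 ^ i * p 0 by linarith, show 2 ^ i * p 0 < 50 by linarith⟩

theorem disjoint_link_wildBall (i : ℕ) : Disjoint (link i) wildBall := by
  refine disjoint_left.2 fun p hp => ?_
  rintro ⟨q, hq, rfl⟩
  obtain ⟨h0, h1, h⟩ := coords_of_mem_link hp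
  rcases growAll_cases hq.1 with ⟨-, h3, h4, h5⟩ | ⟨-, k, -, q', hq', he⟩
  · obtain ⟨-, -, -, h6, h7, h8⟩ := hq
    have h6 : -100 ≤ q 1 := h6
    have h9 : |growAll q 2| ≤ 100 := by rw [h5]; exact abs_le.2 ⟨h7, h8⟩
    rcases h with h | h | h <;> linarith
  · have hb := leg_bounds 0 (by norm_num) hq'
    rw [he] at hb
    have hs := link_subset_slab i hp
    have hs' := scale_bounds (k := k) (p := growAll q) (by linarith [hb.1.1]) hb.1.2
    obtain rfl : k.1 = i := scale_unique hs'.1 hs'.2 hs.1 hs.2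
    obtain ⟨j, s⟩ := k
    have hX : chart (j, s) (growAll q) 0 = -9 := by
      cases s
      · change -zoom j (growAll q) 0 - 9 = -9
        rw [h0]
        norm_num
      · change zoom j (growAll q) 0 - 9 = -9
        rw [h0]
        norm_num
    have hY : chart (j, s) (growAll q) 1 ≤ -12 := by
      cases s
      · change 6 / 7 * zoom j (growAll q) 1 - 16 ≤ -12
        linarith
      · change zoom j (growAll q) 1 - 16 ≤ -12
        linarith
    rw [← he] at hX hY
    obtain ⟨-, k, c, hc0, hc1, -, hk⟩ := (leg_cases 0 hq').resolve_right fun H => by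
      linarith [H.2.1.1]
    have hn := hk.near (by norm_num) hc0 hc1.le (hq'.2.1.trans (by linarith [hq'.1]))
      (hq'.2.2.trans (by linarith [hq'.1]))
    generalize leg 0 q' 0 = X at *
    generalize leg 0 q' 1 = Y at *
    clear hk
    fin_cases k <;> simp only [Near, abs_le] at hn <;> linarith

theorem not_splitsOn_link (i : ℕ) : ¬ (cocycle i).SplitsOn (link i) := fun h => by
  have h1 : (1 : ℝ) ≤ 2 ^ i := one_le_pow₀ one_le_two
  exact permColouring.not_splitsOn_loop permColouring_ne_one (by linarith) (by linarith)
    (h.of_comap (zoomInv i).continuous (zoom_zoomInv i))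

end WildLeg

/-- There is a ball (a compact set homeomorphic to the closed unit ball of `ℝ³`) in `ℝ³`,
e.g. the Alexander ball, that is not an attractor for any discrete dynamical system on any
open subset of `ℝ³`. -/
theorem exists_ball_not_attractor :
    ∃ B : Set R3, IsCompact B ∧ Nonempty (↥B ≃ₜ ↥(Metric.closedBall (0 : R3) 1)) ∧
      ∀ U : Set R3, IsOpen U → B ⊆ U →
        ∀ f : ↥U → ↥U, Continuous f → Function.Injective f → ¬ IsAttractor f B :=
  open WildLeg in
  ⟨wildBall, isCompact_wildBall, nonempty_wildBall_homeomorph, fun _ hU _ _ hf hfi =>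
    not_isAttractor_of_cocycles cocycle slab link isOpen_slab convex_slab slab_disjoint
      compl_dom_subset_wildBall compl_dom_subset_slab isCompact_link link_subset_slab
      disjoint_link_wildBall not_splitsOn_link
      (fun _ hV _ hg hgi => isOpen_image_of_injOn hV hg hgi) hU hf hfi⟩
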